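/- Let A = Σ_{j,k} a_jk(x)∂²_{jk} be a second-order strongly elliptic operator on a neighborhood of 0 in ℝ³ with coefficients a_jk in the Gevrey class G^s, and let α > 0 satisfy α > (λ₃ − λ₁)/λ₁, where λ₁ ≤ λ₂ ≤ λ₃ are the eigenvalues of (a_jk(0)), and s < 1 + 1/α. Then for every ν > 0 there exist τ₀ > 0, r₀ > 0 and C > 0 such that for every integer k with 0 ≤ k ≤ ν, every real σ with |σ| ≤ ν, every τ ≥ τ₀, and every smooth V compactly supported in B(0,r₀)∖{0}: Σ_{j=0}^{k+2} τ^{3−2j} ∫ |x|^{α+2j(1+α)} |x|^{2σ} e^{2τ|x|^{−α}} |D^j V|² dx ≤ C Σ_{j=0}^{k} τ^{−2j} ∫ |x|^{2(2+j)(1+α)} |x|^{2σ} e^{2τ|x|^{−α}} |D^j(AV)|² dx. -/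

import Mathlib

open MeasureTheory Metric Finset

noncomputable section

/-- `ℝ³` with the Euclidean norm. -/
abbrev E3 := EuclideanSpace ℝ (Fin 3)
/-- `ℝ⁷` with the Euclidean norm. -/
abbrev E7 := EuclideanSpace ℝ (Fin 7)

/-- The partial derivative `∂_i f`. -/
def pd (i : Fin 3) (f : E3 → ℝ) : E3 → ℝ :=
  fun x => fderiv ℝ f x (EuclideanSpace.single i 1)

/-- The multiindex partial derivative `∂^β f`. -/
def mpd (β : Fin 3 → ℕ) (f : E3 → ℝ) : E3 → ℝ :=
  (pd 0)^[β 0] ((pd 1)^[β 1] ((pd 2)^[β 2] f))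

/-- The length `|β|` of a multiindex. -/
def mdeg (β : Fin 3 → ℕ) : ℕ := β 0 + β 1 + β 2

/-- `f` belongs to the Gevrey class `G^s(Ω)`. -/
def GevreyOn (s : ℝ) (Ω : Set E3) (f : E3 → ℝ) : Prop :=
  ContDiffOn ℝ (⊤ : ℕ∞) f Ω ∧ ∃ c > 0, ∃ A > 0, ∀ β : Fin 3 → ℕ, ∀ x ∈ Ω,
    |mpd β f x| ≤ c * A ^ mdeg β * (Nat.factorial (mdeg β) : ℝ) ^ s

/-- The second-order operator `Σ_{j,k} a_jk(x) ∂²_{jk}` applied to a scalar function. -/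
def op2 (a : Fin 3 → Fin 3 → E3 → ℝ) (f : E3 → ℝ) : E3 → ℝ :=
  fun x => ∑ j, ∑ k, a j k x * pd j (pd k f) x

/-- Uniform (strong) ellipticity of `Σ_{j,k} a_jk(x) ∂²_{jk}` on `Ω`. -/
def UnifElliptic (a : Fin 3 → Fin 3 → E3 → ℝ) (Ω : Set E3) : Prop :=
  ∃ c0 > 0, ∀ x ∈ Ω, ∀ ξ : Fin 3 → ℝ,
    c0 * (∑ i, ξ i ^ 2) ≤ ∑ j, ∑ k, a j k x * ξ j * ξ k

/-- The coefficient matrix of the operator at a point. -/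
def coefMatrix (a : Fin 3 → Fin 3 → E3 → ℝ) (x : E3) : Matrix (Fin 3) (Fin 3) ℝ :=
  Matrix.of fun j k => a j k x

/-- `α > (λ₃ - λ₁)/λ₁` where `λ₁ ≤ λ₂ ≤ λ₃` are the eigenvalues of the coefficient
matrix at `0`: equivalently (the eigenvalues being positive), for any pair of
eigenvalues the corresponding ratio is `< α`. -/
def EigCond (a : Fin 3 → Fin 3 → E3 → ℝ) (α : ℝ) : Prop :=
  ∀ h : (coefMatrix a 0).IsHermitian, ∀ i j : Fin 3,
    (h.eigenvalues i - h.eigenvalues j) / h.eigenvalues j < α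

/-- The coefficients `a¹_jk = μ δ_jk + t_jk` of `P₁`. -/
def a1coef (t : Fin 3 → Fin 3 → E3 → ℝ) (mu : E3 → ℝ) : Fin 3 → Fin 3 → E3 → ℝ :=
  fun j k x => mu x * (if j = k then 1 else 0) + t j k x

/-- The coefficients `a²_jk = (λ + 2μ) δ_jk + t_jk` of `P₂`. -/
def a2coef (t : Fin 3 → Fin 3 → E3 → ℝ) (lam mu : E3 → ℝ) : Fin 3 → Fin 3 → E3 → ℝ :=
  fun j k x => (lam x + 2 * mu x) * (if j = k then 1 else 0) + t j k x

/-- The divergence `∇·u`. -/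
def divg (u : E3 → Fin 3 → ℝ) (x : E3) : ℝ := ∑ i, pd i (fun y => u y i) x

/-- The curl `∇×u`. -/
def curl (u : E3 → Fin 3 → ℝ) (x : E3) : Fin 3 → ℝ :=
  ![pd 1 (fun y => u y 2) x - pd 2 (fun y => u y 1) x,
    pd 2 (fun y => u y 0) x - pd 0 (fun y => u y 2) x,
    pd 0 (fun y => u y 1) x - pd 1 (fun y => u y 0) x]

/-- The infinitesimal strain `E = (∇u + (∇u)ᵗ)/2`. -/
def strain (u : E3 → Fin 3 → ℝ) (x : E3) (i j : Fin 3) : ℝ :=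
  (pd j (fun y => u y i) x + pd i (fun y => u y j) x) / 2

/-- The stress tensor `σ = T + (∇u)T + λ(tr E)I + 2μE`. -/
def stress (t : Fin 3 → Fin 3 → E3 → ℝ) (lam mu : E3 → ℝ) (u : E3 → Fin 3 → ℝ)
    (x : E3) (i j : Fin 3) : ℝ :=
  t i j x + (∑ k, pd k (fun y => u y i) x * t k j x)
    + lam x * divg u x * (if i = j then 1 else 0)
    + 2 * mu x * strain u x i j

/-- The residual stress system `∇·σ + κ²ρu = 0` on `Ω`. -/
def ResSystem (t : Fin 3 → Fin 3 → E3 → ℝ) (lam mu rho : E3 → ℝ) (κ : ℝ)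
    (u : E3 → Fin 3 → ℝ) (Ω : Set E3) : Prop :=
  ∀ x ∈ Ω, ∀ i : Fin 3,
    (∑ j, pd j (fun y => stress t lam mu u y i j) x) + κ ^ 2 * rho x * u x i = 0

/-- The vector `U = (u, ∇·u, ∇×u) : Ω → ℝ⁷`. -/
def Ufull (u : E3 → Fin 3 → ℝ) : E3 → Fin 7 → ℝ :=
  fun x => ![u x 0, u x 1, u x 2, divg u x, curl u x 0, curl u x 1, curl u x 2]

/-- The lower-order term `Σ_{|β|≤3} a_β ∂^β U`, component `i`. -/
def lowOrd (aβ : (Fin 3 → ℕ) → E3 → Fin 7 → Fin 7 → ℝ) (U : E3 → Fin 7 → ℝ)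
    (x : E3) (i : Fin 7) : ℝ :=
  ∑ β ∈ Finset.univ.filter (fun β : Fin 3 → Fin 4 => mdeg (fun k => (β k : ℕ)) ≤ 3),
    ∑ j, aβ (fun k => (β k : ℕ)) x i j * mpd (fun k => (β k : ℕ)) (fun y => U y j) x

/-- The operator `Σ_{j,k} a_jk(x) ∂²_{jk}` acting componentwise on `ℝ⁷`-valued maps. -/
def op2V (a : Fin 3 → Fin 3 → E3 → ℝ) (V : E3 → E7) : E3 → E7 :=
  fun x => (WithLp.equiv 2 (Fin 7 → ℝ)).symm fun i => op2 a (fun y => V y i) x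

section Calculus

variable {U : Set E3} {f g : E3 → ℝ} {x : E3}

/-- Smoothness of a scalar function on a set. -/
abbrev Sm (U : Set E3) (f : E3 → ℝ) : Prop := ContDiffOn ℝ (⊤ : ℕ∞) f U

lemma Sm.differentiableAt (hf : Sm U f) (hU : IsOpen U) (hx : x ∈ U) : DifferentiableAt ℝ f x :=
  (hf.contDiffAt (hU.mem_nhds hx)).differentiableAt (by simp)

lemma Sm.pd (hf : Sm U f) (hU : IsOpen U) (i : Fin 3) : Sm U (pd i f) :=
  (hf.fderiv_of_isOpen hU (m := (⊤ : ℕ∞)) (by simp)).clm_apply contDiffOn_const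

lemma pd_mul_apply (hf : DifferentiableAt ℝ f x) (hg : DifferentiableAt ℝ g x) (i : Fin 3) :
    pd i (fun y => f y * g y) x = pd i f x * g x + f x * pd i g x := by
  have := (hf.hasFDerivAt.mul hg.hasFDerivAt).fderiv
  unfold pd
  simp only [Pi.mul_def] at this
  rw [this]
  simp
  ring

lemma pd_add_apply (hf : DifferentiableAt ℝ f x) (hg : DifferentiableAt ℝ g x) (i : Fin 3) :
    pd i (fun y => f y + g y) x = pd i f x + pd i g x := by
  have := (hf.hasFDerivAt.add hg.hasFDerivAt).fderiv
  unfold pd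
  simp only [Pi.add_def] at this
  rw [this]
  simp

lemma pd_sub_apply (hf : DifferentiableAt ℝ f x) (hg : DifferentiableAt ℝ g x) (i : Fin 3) :
    pd i (fun y => f y - g y) x = pd i f x - pd i g x := by
  have := (hf.hasFDerivAt.sub hg.hasFDerivAt).fderiv
  unfold pd
  simp only [Pi.sub_def] at this
  rw [this]
  simp

lemma pd_const_mul_apply (c : ℝ) (hf : DifferentiableAt ℝ f x) (i : Fin 3) :
    pd i (fun y => c * f y) x = c * pd i f x := by
  have := (hf.hasFDerivAt.const_mul c).fderiv
  unfold pd
  rw [this]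
  simp

lemma pd_sum_apply {ι : Type*} (s : Finset ι) {F : ι → E3 → ℝ}
    (hF : ∀ k ∈ s, DifferentiableAt ℝ (F k) x) (i : Fin 3) :
    pd i (fun y => ∑ k ∈ s, F k y) x = ∑ k ∈ s, pd i (F k) x := by
  have := (HasFDerivAt.fun_sum (fun k hk => (hF k hk).hasFDerivAt)).fderiv
  unfold pd
  rw [this]
  simp

lemma pd_const (c : ℝ) (i : Fin 3) : pd i (fun _ => c) x = 0 := by
  simp [pd]

lemma pd_coord (i k : Fin 3) : pd i (fun y => y k) x = if k = i then 1 else 0 := by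
  have : HasFDerivAt (fun y : E3 => y k) (EuclideanSpace.proj k : E3 →L[ℝ] ℝ) x :=
    (EuclideanSpace.proj k : E3 →L[ℝ] ℝ).hasFDerivAt
  unfold pd
  rw [this.fderiv]
  simp

lemma sm_coord (k : Fin 3) : Sm U (fun y => y k) :=
  (EuclideanSpace.proj k : E3 →L[ℝ] ℝ).contDiff.contDiffOn

lemma pd_congr_on (hU : IsOpen U) (h : Set.EqOn f g U) (i : Fin 3) :
    Set.EqOn (pd i f) (pd i g) U := fun x hx => by
  have : f =ᶠ[nhds x] g := Filter.eventually_of_mem (hU.mem_nhds hx) h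
  simp [pd, this.fderiv_eq]

lemma pd_comm_apply (hf : Sm U f) (hU : IsOpen U) (hx : x ∈ U) (i j : Fin 3) :
    pd i (pd j f) x = pd j (pd i f) x := by
  have h1 : DifferentiableAt ℝ (fderiv ℝ f) x :=
    ((hf.fderiv_of_isOpen hU (m := (⊤ : ℕ∞)) (by simp)).contDiffAt
      (hU.mem_nhds hx)).differentiableAt (by simp)
  have h2 := (hf.contDiffAt (hU.mem_nhds hx)).isSymmSndFDerivAt (n := (⊤ : ℕ∞)) (by
    rw [minSmoothness_of_isRCLikeNormedField]
    exact WithTop.coe_le_coe.2 (le_top (a := (2 : ℕ∞))))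
  have key : ∀ i j, pd i (pd j f) x
      = fderiv ℝ (fderiv ℝ f) x (EuclideanSpace.single i 1) (EuclideanSpace.single j 1) := by
    intro i j
    have := (h1.hasFDerivAt.clm_apply
      (hasFDerivAt_const (EuclideanSpace.single j (1 : ℝ) : E3) x)).fderiv
    unfold pd
    rw [this]
    simp
  rw [key, key]
  exact h2 _ _

lemma tsupport_pd_subset (i : Fin 3) : tsupport (pd i f) ⊆ tsupport f := by
  refine subset_trans (closure_mono ?_) (tsupport_fderiv_subset ℝ (f := f))
  intro x hx h
  exact hx (by simp [pd, h])

lemma contDiff_of_eqOn_compl (hU : IsOpen U) (hf : Sm U f) {K : Set E3} (hK : IsClosed K)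
    (hKU : K ⊆ U) (h0 : ∀ x ∉ K, f x = 0) : ContDiff ℝ (⊤ : ℕ∞) f := by
  rw [contDiff_iff_contDiffAt]
  intro x
  by_cases hx : x ∈ K
  · exact hf.contDiffAt (hU.mem_nhds (hKU hx))
  · have : f =ᶠ[nhds x] fun _ => 0 :=
      Filter.eventually_of_mem (hK.isOpen_compl.mem_nhds hx) h0
    exact contDiffAt_const.congr_of_eventuallyEq this

lemma pd_eq_zero_of_notMem {K : Set E3} (hK : IsClosed K) (h0 : ∀ x ∉ K, f x = 0) (i : Fin 3) :
    ∀ x ∉ K, pd i f x = 0 := by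
  intro x hx
  have := pd_congr_on hK.isOpen_compl (f := f) (g := fun _ => 0) h0 i hx
  rw [this, pd_const]

lemma integrable_of_continuousOn {K : Set E3} (hK : IsCompact K) (hf : ContinuousOn f K)
    (h0 : ∀ x ∉ K, f x = 0) : Integrable f := by
  rw [← integrableOn_iff_integrable_of_support_subset (s := K)
    (fun x hx => by by_contra h; exact hx (h0 x h))]
  exact hf.integrableOn_compact hK

lemma integral_pd_eq_zero (hU : IsOpen U) (hf : Sm U f) {K : Set E3} (hK : IsCompact K)
    (hKU : K ⊆ U) (h0 : ∀ x ∉ K, f x = 0) (i : Fin 3) : ∫ x, pd i f x = 0 := by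
  have hc := contDiff_of_eqOn_compl hU hf hK.isClosed hKU h0
  have hI : Integrable (pd i f) := integrable_of_continuousOn hK
    ((hf.pd hU i).continuousOn.mono hKU) (pd_eq_zero_of_notMem hK.isClosed h0 i)
  have hI0 : Integrable f := integrable_of_continuousOn hK (hf.continuousOn.mono hKU) h0
  have := integral_mul_fderiv_eq_neg_fderiv_mul_of_integrable (𝕜 := ℝ) (μ := (volume : Measure E3))
    (f := fun _ => (1 : ℝ)) (g := f) (v := EuclideanSpace.single i 1)
    (by simp) (by simpa using! hI) (by simpa using hI0)
    (fun x _ => differentiableAt_const _) (fun x _ => hc.differentiable (by simp) x)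
  simpa [pd] using this

end Calculus

section Energy

/-- The sum of the squares of all partial derivatives of order `j`. -/
def derivEnergy : ℕ → (E3 → ℝ) → E3 → ℝ
  | 0, f => fun x => f x ^ 2
  | j + 1, f => fun x => ∑ i, derivEnergy j (pd i f) x

variable {U : Set E3} {f g : E3 → ℝ} {x : E3}

lemma derivEnergy_nonneg (j : ℕ) : ∀ (f : E3 → ℝ) (x : E3), 0 ≤ derivEnergy j f x := by
  induction j with
  | zero => intro f x; exact sq_nonneg _
  | succ j ih => intro f x; exact Finset.sum_nonneg fun i _ => ih _ _

lemma derivEnergy_congr_on (hU : IsOpen U) (j : ℕ) :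
    ∀ {f g : E3 → ℝ}, Set.EqOn f g U → Set.EqOn (derivEnergy j f) (derivEnergy j g) U := by
  induction j with
  | zero => intro f g h x hx; simp [derivEnergy, h hx]
  | succ j ih =>
    intro f g h x hx
    exact Finset.sum_congr rfl fun i _ => ih (pd_congr_on hU h i) hx

lemma continuousOn_derivEnergy (hU : IsOpen U) (j : ℕ) :
    ∀ {f : E3 → ℝ}, Sm U f → ContinuousOn (derivEnergy j f) U := by
  induction j with
  | zero => intro f h; exact h.continuousOn.pow 2
  | succ j ih => intro f h; exact continuousOn_finsetSum _ fun i _ => ih (h.pd hU i)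

lemma derivEnergy_eq_zero {K : Set E3} (hK : IsClosed K) (j : ℕ) :
    ∀ {f : E3 → ℝ}, (∀ x ∉ K, f x = 0) → ∀ x ∉ K, derivEnergy j f x = 0 := by
  induction j with
  | zero => intro f h x hx; simp [derivEnergy, h x hx]
  | succ j ih =>
    intro f h x hx
    exact Finset.sum_eq_zero fun i _ => ih (pd_eq_zero_of_notMem hK h i) x hx

lemma derivEnergy_sum_le {ι : Type*} (s : Finset ι) (hU : IsOpen U) (hx : x ∈ U) (j : ℕ) :
    ∀ {F : ι → E3 → ℝ}, (∀ k ∈ s, Sm U (F k)) →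
      derivEnergy j (fun y => ∑ k ∈ s, F k y) x ≤ s.card * ∑ k ∈ s, derivEnergy j (F k) x := by
  induction j with
  | zero => intro F _; exact sq_sum_le_card_mul_sum_sq
  | succ j ih =>
    intro F hF
    calc ∑ i, derivEnergy j (pd i (fun y => ∑ k ∈ s, F k y)) x
        = ∑ i, derivEnergy j (fun y => ∑ k ∈ s, pd i (F k) y) x := by
          refine Finset.sum_congr rfl fun i _ => ?_
          exact derivEnergy_congr_on hU j (fun y hy => pd_sum_apply s
            (fun k hk => (hF k hk).differentiableAt hU hy) i) hx
      _ ≤ ∑ i, s.card * ∑ k ∈ s, derivEnergy j (pd i (F k)) x :=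
          Finset.sum_le_sum fun i _ => ih fun k hk => (hF k hk).pd hU i
      _ = s.card * ∑ k ∈ s, derivEnergy (j + 1) (F k) x := by
          rw [← Finset.mul_sum, Finset.sum_comm]; rfl

lemma derivEnergy_add_le (hU : IsOpen U) (hx : x ∈ U) (j : ℕ) (hf : Sm U f) (hg : Sm U g) :
    derivEnergy j (fun y => f y + g y) x ≤ 2 * (derivEnergy j f x + derivEnergy j g x) := by
  have := derivEnergy_sum_le (x := x) (Finset.univ : Finset (Fin 2)) hU hx j (F := ![f, g])
    (by intro k _; fin_cases k <;> simpa)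
  simpa using this

lemma derivEnergy_neg (j : ℕ) : ∀ (f : E3 → ℝ), derivEnergy j (fun y => - f y) x
    = derivEnergy j f x := by
  induction j with
  | zero => intro f; simp [derivEnergy]
  | succ j ih =>
    intro f
    refine Finset.sum_congr rfl fun i _ => ?_
    rw [← ih]
    congr 1
    funext y
    simp [pd, fderiv_fun_neg]

lemma derivEnergy_mul_le {K : Set E3} (hU : IsOpen U) (hK : IsCompact K) (hKU : K ⊆ U) (j : ℕ) :
    ∀ {b : E3 → ℝ}, Sm U b → ∃ C : ℝ, 0 ≤ C ∧ ∀ f : E3 → ℝ, Sm U f → ∀ x ∈ K,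
      derivEnergy j (fun y => b y * f y) x ≤ C * ∑ m ∈ range (j + 1), derivEnergy m f x := by
  induction j with
  | zero =>
    intro b hb
    obtain ⟨C, hC⟩ := hK.exists_bound_of_continuousOn (hb.continuousOn.mono hKU)
    refine ⟨C ^ 2, sq_nonneg _, fun f _ x hx => ?_⟩
    have h := hC x hx
    have : b x ^ 2 ≤ C ^ 2 := sq_le_sq' (by linarith [neg_abs_le (b x), Real.norm_eq_abs (b x)])
      (le_trans (le_abs_self _) h)
    simp only [derivEnergy, zero_add, Finset.sum_range_one, mul_pow]
    exact mul_le_mul_of_nonneg_right this (sq_nonneg _)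
  | succ j ih =>
    intro b hb
    obtain ⟨C0, hC0, h0⟩ := ih hb
    choose C1 hC1 h1 using fun i => ih (hb.pd hU i)
    refine ⟨2 * (∑ i, C1 i + C0), by
      have := Finset.sum_nonneg fun i (_ : i ∈ Finset.univ) => hC1 i
      positivity, fun f hf x hx => ?_⟩
    have hxU := hKU hx
    have hsub : ∑ m ∈ range (j + 1), derivEnergy m f x
        ≤ ∑ m ∈ range (j + 1 + 1), derivEnergy m f x := by
      rw [Finset.sum_range_succ _ (j + 1)]
      linarith [derivEnergy_nonneg (j + 1) f x]
    have hsh : ∑ i, ∑ m ∈ range (j + 1), derivEnergy m (pd i f) x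
        ≤ ∑ m ∈ range (j + 1 + 1), derivEnergy m f x := by
      rw [Finset.sum_comm, Finset.sum_range_succ' _ (j + 1)]
      have : ∀ m, ∑ i, derivEnergy m (pd i f) x = derivEnergy (m + 1) f x := fun m => rfl
      simp only [this]
      linarith [derivEnergy_nonneg 0 f x]
    calc ∑ i, derivEnergy j (pd i (fun y => b y * f y)) x
        = ∑ i, derivEnergy j (fun y => pd i b y * f y + b y * pd i f y) x := by
          refine Finset.sum_congr rfl fun i _ => ?_
          exact derivEnergy_congr_on hU j (fun y hy => pd_mul_apply
            (hb.differentiableAt hU hy) (hf.differentiableAt hU hy) i) hxU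
      _ ≤ ∑ i, 2 * (C1 i * ∑ m ∈ range (j + 1), derivEnergy m f x
            + C0 * ∑ m ∈ range (j + 1), derivEnergy m (pd i f) x) := by
          refine Finset.sum_le_sum fun i _ => ?_
          refine (derivEnergy_add_le hU hxU j ((hb.pd hU i).mul hf) (hb.mul (hf.pd hU i))).trans ?_
          have := h1 i f hf x hx
          have := h0 (pd i f) (hf.pd hU i) x hx
          linarith
      _ = 2 * ((∑ i, C1 i) * ∑ m ∈ range (j + 1), derivEnergy m f x
            + C0 * ∑ i, ∑ m ∈ range (j + 1), derivEnergy m (pd i f) x) := by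
          rw [← Finset.mul_sum, Finset.sum_add_distrib, Finset.sum_mul, Finset.mul_sum]
      _ ≤ 2 * ((∑ i, C1 i) * ∑ m ∈ range (j + 1 + 1), derivEnergy m f x
            + C0 * ∑ m ∈ range (j + 1 + 1), derivEnergy m f x) := by
          have hs : 0 ≤ ∑ i, C1 i := Finset.sum_nonneg fun i _ => hC1 i
          gcongr
      _ = _ := by ring

end Energy

section Iteration

/-- The Carleman weight `|x|^e |x|^{2σ} e^{2τ|x|^{-α}}`. -/
def carlemanWeight (α τ e σ : ℝ) (x : E3) : ℝ :=
  ‖x‖ ^ e * ‖x‖ ^ (2 * σ) * Real.exp (2 * τ * ‖x‖ ^ (-α))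

lemma carlemanWeight_nonneg (α τ e σ : ℝ) (x : E3) : 0 ≤ carlemanWeight α τ e σ x := by
  unfold carlemanWeight; positivity

lemma continuousOn_carlemanWeight (α τ e σ : ℝ) {K : Set E3} (hK : (0 : E3) ∉ K) :
    ContinuousOn (carlemanWeight α τ e σ) K := by
  have h : ∀ p : ℝ, ContinuousOn (fun x : E3 => ‖x‖ ^ p) K := fun p =>
    continuous_norm.continuousOn.rpow_const fun x hx => Or.inl (by
      rw [norm_ne_zero_iff]; rintro rfl; exact hK hx)
  unfold carlemanWeight
  exact ((h e).mul (h _)).mul (Real.continuous_exp.comp_continuousOn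
    (continuousOn_const.mul (h _)))

/-- Smooth functions compactly supported in the punctured ball of radius `r`. -/
structure IsTest (r : ℝ) (f : E3 → ℝ) : Prop where
  smooth : ContDiff ℝ (⊤ : ℕ∞) f
  supp : tsupport f ⊆ ball (0 : E3) r \ {0}

variable {r : ℝ} {f : E3 → ℝ} {Ω : Set E3} {a : Fin 3 → Fin 3 → E3 → ℝ} {α : ℝ}

lemma IsTest.mono {r' : ℝ} (hf : IsTest r f) (h : r ≤ r') : IsTest r' f :=
  ⟨hf.smooth, hf.supp.trans (Set.sdiff_subset_sdiff_left (ball_subset_ball h))⟩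

lemma IsTest.pd (hf : IsTest r f) (i : Fin 3) : IsTest r (pd i f) :=
  ⟨contDiffOn_univ.1 (Sm.pd hf.smooth.contDiffOn isOpen_univ i),
    (tsupport_pd_subset i).trans hf.supp⟩

lemma IsTest.isCompact (hf : IsTest r f) : IsCompact (tsupport f) :=
  (isCompact_closedBall (0 : E3) r).of_isClosed_subset (isClosed_tsupport f)
    ((hf.supp.trans Set.sdiff_subset).trans ball_subset_closedBall)

lemma IsTest.zero_notMem (hf : IsTest r f) : (0 : E3) ∉ tsupport f :=
  fun h => (hf.supp h).2 rfl

lemma IsTest.sm (hf : IsTest r f) (U : Set E3) : Sm U f := hf.smooth.contDiffOn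

lemma IsTest.eq_zero : ∀ x ∉ tsupport f, f x = 0 :=
  fun _ hx => image_eq_zero_of_notMem_tsupport hx

lemma sm_op2 (hΩ : IsOpen Ω) (ha : ∀ j k, Sm Ω (a j k)) (hf : Sm Ω f) : Sm Ω (op2 a f) :=
  ContDiffOn.sum fun j _ => ContDiffOn.sum fun k _ => (ha j k).mul ((hf.pd hΩ k).pd hΩ j)

lemma op2_eq_zero {K : Set E3} (hK : IsClosed K) (h : ∀ x ∉ K, f x = 0) :
    ∀ x ∉ K, op2 a f x = 0 := by
  intro x hx
  unfold op2
  refine Finset.sum_eq_zero fun j _ => Finset.sum_eq_zero fun k _ => ?_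
  rw [pd_eq_zero_of_notMem hK (pd_eq_zero_of_notMem hK h k) j x hx, mul_zero]

lemma pd_op2 (hΩ : IsOpen Ω) (ha : ∀ j k, Sm Ω (a j k)) (hf : Sm Ω f) (i : Fin 3) {x : E3}
    (hx : x ∈ Ω) : pd i (op2 a f) x
      = op2 a (pd i f) x + ∑ j, ∑ k, pd i (a j k) x * pd j (pd k f) x := by
  have hd : ∀ j k, DifferentiableAt ℝ (fun y => a j k y * pd j (pd k f) y) x := fun j k =>
    Sm.differentiableAt (ContDiffOn.mul (ha j k) ((hf.pd hΩ k).pd hΩ j)) hΩ hx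
  have h1 : pd i (op2 a f) x = ∑ j, ∑ k, pd i (fun y => a j k y * pd j (pd k f) y) x := by
    unfold op2
    rw [pd_sum_apply _ (fun j _ => DifferentiableAt.fun_sum fun k _ => hd j k)]
    exact Finset.sum_congr rfl fun j _ => pd_sum_apply _ (fun k _ => hd j k) i
  rw [h1]
  unfold op2
  rw [← Finset.sum_add_distrib]
  refine Finset.sum_congr rfl fun j _ => ?_
  rw [← Finset.sum_add_distrib]
  refine Finset.sum_congr rfl fun k _ => ?_
  rw [pd_mul_apply ((ha j k).differentiableAt hΩ hx)
    (((hf.pd hΩ k).pd hΩ j).differentiableAt hΩ hx), pd_comm_apply (hf.pd hΩ k) hΩ hx i j]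
  have : pd j (pd i (pd k f)) x = pd j (pd k (pd i f)) x :=
    pd_congr_on hΩ (fun y hy => pd_comm_apply hf hΩ hy i k) j hx
  rw [this]
  ring

lemma integrable_weight_mul (hf : IsTest r f) {g : E3 → ℝ} {w : E3 → ℝ}
    (hw : ContinuousOn w (tsupport f)) (hg : ContinuousOn g (tsupport f))
    (h0 : ∀ x ∉ tsupport f, g x = 0) : Integrable fun x => w x * g x :=
  integrable_of_continuousOn hf.isCompact (hw.mul hg) fun x hx => by rw [h0 x hx, mul_zero]

/-- The Carleman estimate with `k` additional derivatives, for scalar test functions. -/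
def CarlemanHolds (a : Fin 3 → Fin 3 → E3 → ℝ) (α : ℝ) (k : ℕ) : Prop :=
  ∀ ν : ℝ, 0 < ν → ∃ τ0 ≥ (1 : ℝ), ∃ r0 > (0 : ℝ), r0 ≤ 1 ∧ ∃ C > (0 : ℝ),
    ∀ σ : ℝ, |σ| ≤ ν → ∀ τ ≥ τ0, ∀ f : E3 → ℝ, IsTest r0 f →
      (∑ j ∈ range (k + 3), τ ^ ((3 : ℤ) - 2 * j)
          * ∫ x : E3, carlemanWeight α τ (α + 2 * (j : ℝ) * (1 + α)) σ x * derivEnergy j f x)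
      ≤ C * ∑ j ∈ range (k + 1), τ ^ (-(2 : ℤ) * j)
          * ∫ x : E3, carlemanWeight α τ (2 * (2 + (j : ℝ)) * (1 + α)) σ x
              * derivEnergy j (op2 a f) x

lemma carlemanWeight_shift (α τ e e' σ σ' : ℝ) (h : e + 2 * σ = e' + 2 * σ') {x : E3}
    (hx : x ≠ 0) : carlemanWeight α τ e σ x = carlemanWeight α τ e' σ' x := by
  have hx' : 0 < ‖x‖ := norm_pos_iff.2 hx
  unfold carlemanWeight
  rw [← Real.rpow_add hx', ← Real.rpow_add hx', h]

lemma carlemanWeight_anti (α τ e e' σ : ℝ) (h : e' ≤ e) {x : E3} (hx : x ≠ 0) (hx1 : ‖x‖ ≤ 1) :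
    carlemanWeight α τ e σ x ≤ carlemanWeight α τ e' σ x := by
  have hx' : 0 < ‖x‖ := norm_pos_iff.2 hx
  unfold carlemanWeight
  have := Real.rpow_le_rpow_of_exponent_ge hx' hx1 h
  gcongr

lemma derivEnergy_op2_pd_le (hΩ : IsOpen Ω) (ha : ∀ j k, Sm Ω (a j k)) {K : Set E3}
    (hK : IsCompact K) (hKU : K ⊆ Ω) (j : ℕ) :
    ∃ C : ℝ, 0 ≤ C ∧ ∀ i : Fin 3, ∀ f : E3 → ℝ, Sm Ω f → ∀ x ∈ K,
      derivEnergy j (op2 a (pd i f)) x ≤ 2 * derivEnergy j (pd i (op2 a f)) x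
        + C * ∑ m ∈ range (j + 1), derivEnergy (m + 2) f x := by
  choose C hC0 hC using fun i k l => derivEnergy_mul_le hΩ hK hKU j ((ha k l).pd hΩ i)
  refine ⟨18 * ∑ i, ∑ k, ∑ l, C i k l, ?_, fun i f hf x hx => ?_⟩
  · have : 0 ≤ ∑ i, ∑ k, ∑ l, C i k l := Finset.sum_nonneg fun i _ => Finset.sum_nonneg fun k _ =>
      Finset.sum_nonneg fun l _ => hC0 i k l
    positivity
  have hxU := hKU hx
  have hpp : ∀ k l, Sm Ω (pd k (pd l f)) := fun k l => (hf.pd hΩ l).pd hΩ k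
  set S := ∑ m ∈ range (j + 1), derivEnergy (m + 2) f x with hS
  have hSkl : ∀ k l, ∑ m ∈ range (j + 1), derivEnergy m (pd k (pd l f)) x ≤ S := by
    intro k l
    refine Finset.sum_le_sum fun m _ => ?_
    have h1 : derivEnergy m (pd k (pd l f)) x ≤ derivEnergy (m + 1) (pd l f) x :=
      Finset.single_le_sum (f := fun k => derivEnergy m (pd k (pd l f)) x)
        (fun i _ => derivEnergy_nonneg _ _ _) (Finset.mem_univ k)
    exact h1.trans (Finset.single_le_sum (f := fun l => derivEnergy (m + 1) (pd l f) x)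
        (fun i _ => derivEnergy_nonneg _ _ _) (Finset.mem_univ l))
  have hS0 : 0 ≤ S := Finset.sum_nonneg fun m _ => derivEnergy_nonneg _ _ _
  have hcomm : derivEnergy j (fun y => ∑ p : Fin 3 × Fin 3,
      pd i (a p.1 p.2) y * pd p.1 (pd p.2 f) y) x ≤ 9 * ∑ i, ∑ k, ∑ l, C i k l * S := by
    refine (derivEnergy_sum_le Finset.univ hΩ hxU j
      (fun p _ => ((ha p.1 p.2).pd hΩ i).mul (hpp p.1 p.2))).trans ?_
    simp only [Finset.card_univ, Fintype.card_prod, Fintype.card_fin, Fintype.sum_prod_type]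
    norm_num
    have hi : ∑ k, ∑ l, C i k l * S ≤ ∑ i, ∑ k, ∑ l, C i k l * S :=
      Finset.single_le_sum (f := fun i => ∑ k, ∑ l, C i k l * S)
        (fun i _ => Finset.sum_nonneg fun k _ => Finset.sum_nonneg fun l _ =>
          mul_nonneg (hC0 i k l) hS0) (Finset.mem_univ i)
    refine le_trans (Finset.sum_le_sum fun k _ => Finset.sum_le_sum fun l _ => ?_) hi
    exact (hC i k l _ (hpp k l) x hx).trans (mul_le_mul_of_nonneg_left (hSkl k l) (hC0 i k l))
  have hsm : Sm Ω (fun y => ∑ p : Fin 3 × Fin 3, pd i (a p.1 p.2) y * pd p.1 (pd p.2 f) y) :=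
    ContDiffOn.sum fun p _ => ((ha p.1 p.2).pd hΩ i).mul (hpp p.1 p.2)
  have heq : Set.EqOn (op2 a (pd i f)) (fun y => pd i (op2 a f) y
      + -(∑ p : Fin 3 × Fin 3, pd i (a p.1 p.2) y * pd p.1 (pd p.2 f) y)) Ω := by
    intro y hy
    simp only [Fintype.sum_prod_type, pd_op2 hΩ ha hf i hy]
    ring
  rw [derivEnergy_congr_on hΩ j heq hxU]
  refine (derivEnergy_add_le hΩ hxU j ((sm_op2 hΩ ha hf).pd hΩ i) hsm.neg).trans ?_
  rw [derivEnergy_neg]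
  simp only [← Finset.sum_mul] at hcomm
  linarith

lemma integral_shift_eq {K : Set E3} (h0K : (0 : E3) ∉ K) {g : E3 → ℝ}
    (hg : ∀ x ∉ K, g x = 0) (α τ : ℝ) {e e' σ σ' : ℝ} (h : e + 2 * σ = e' + 2 * σ') :
    ∫ x, carlemanWeight α τ e σ x * g x = ∫ x, carlemanWeight α τ e' σ' x * g x := by
  refine integral_congr_ae (Filter.Eventually.of_forall fun x => ?_)
  by_cases hx : x = 0
  · subst hx; simp [hg 0 h0K]
  · simp only [carlemanWeight_shift α τ e e' σ σ' h hx]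

lemma CarlemanHolds.succ (hΩ : IsOpen Ω) (h0 : (0 : E3) ∈ Ω) (ha : ∀ j k, Sm Ω (a j k))
    (hα : 0 < α) {k : ℕ} (H : CarlemanHolds a α k) : CarlemanHolds a α (k + 1) := by
  intro ν hν
  obtain ⟨τ0, hτ0, r0, hr0, hr1, C, hC, hbase⟩ := H (ν + (1 + α)) (by positivity)
  obtain ⟨r2, hr2, hball⟩ := Metric.isOpen_iff.1 hΩ 0 h0
  set r := min r0 (r2 / 2) with hr
  have hrpos : 0 < r := lt_min hr0 (by positivity)
  have hrr0 : r ≤ r0 := min_le_left _ _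
  have hKΩ : closedBall (0 : E3) r ⊆ Ω := (closedBall_subset_ball
    (lt_of_le_of_lt (min_le_right _ _) (by linarith))).trans hball
  choose D hD0 hD using fun j =>
    derivEnergy_op2_pd_le hΩ ha (isCompact_closedBall (0 : E3) r) hKΩ j
  set DD := ∑ j ∈ range (k + 1), D j with hDD
  have hDD0 : 0 ≤ DD := Finset.sum_nonneg fun j _ => hD0 j
  refine ⟨τ0, hτ0, r, hrpos, hrr0.trans hr1, C + 2 * C + 3 * C * DD * C, by positivity,
    fun σ hσ τ hτ f hf => ?_⟩
  have hτ1 : 1 ≤ τ := hτ0.trans hτ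
  have hτpos : 0 < τ := by linarith
  have hf0 : IsTest r0 f := hf.mono hrr0
  have hK : IsClosed (tsupport f) := isClosed_tsupport f
  have hKΩ' : tsupport f ⊆ Ω := fun x hx => hKΩ (ball_subset_closedBall (hf.supp hx).1)
  set L : ℕ → ℝ := fun j => τ ^ ((3 : ℤ) - 2 * j)
    * ∫ x : E3, carlemanWeight α τ (α + 2 * (j : ℝ) * (1 + α)) σ x * derivEnergy j f x with hL
  set R : ℕ → ℝ := fun j => τ ^ (-(2 : ℤ) * j)
    * ∫ x : E3, carlemanWeight α τ (2 * (2 + (j : ℝ)) * (1 + α)) σ x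
      * derivEnergy j (op2 a f) x with hR
  have hwc : ∀ e σ, ContinuousOn (carlemanWeight α τ e σ) (tsupport f) := fun e σ =>
    continuousOn_carlemanWeight α τ e σ hf.zero_notMem
  have hEc : ∀ j, ∀ g, Sm Ω g → ContinuousOn (derivEnergy j g) (tsupport f) := fun j g hg =>
    (continuousOn_derivEnergy hΩ j hg).mono hKΩ'
  have hAf : Sm Ω (op2 a f) := sm_op2 hΩ ha (hf.sm Ω)
  have hAf0 := op2_eq_zero (a := a) hK (IsTest.eq_zero (f := f))
  have hL0 : ∀ j, 0 ≤ L j := fun j => mul_nonneg (zpow_nonneg hτpos.le _)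
    (integral_nonneg fun x => mul_nonneg (carlemanWeight_nonneg _ _ _ _ _)
      (derivEnergy_nonneg _ _ _))
  have hR0 : ∀ j, 0 ≤ R j := fun j => mul_nonneg (zpow_nonneg hτpos.le _)
    (integral_nonneg fun x => mul_nonneg (carlemanWeight_nonneg _ _ _ _ _)
      (derivEnergy_nonneg _ _ _))
  have h1 : ∑ j ∈ range (k + 3), L j ≤ C * ∑ j ∈ range (k + 1), R j :=
    hbase σ (hσ.trans (by linarith)) τ hτ f hf0
  have h2 : ∀ i : Fin 3, _ := fun i => hbase (σ + (1 + α))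
    ((abs_add_le _ _).trans (by rw [abs_of_pos (by linarith : 0 < 1 + α)]; linarith))
    τ hτ (pd i f) (hf0.pd i)
  have hLshift : ∀ j : ℕ, L (j + 1) = τ ^ (-2 : ℤ) * ∑ i, τ ^ ((3 : ℤ) - 2 * j)
      * ∫ x : E3, carlemanWeight α τ (α + 2 * (j : ℝ) * (1 + α)) (σ + (1 + α)) x
        * derivEnergy j (pd i f) x := by
    intro j
    rw [← Finset.mul_sum, ← integral_finsetSum, ← mul_assoc, ← zpow_add₀ hτpos.ne']
    · simp only [← Finset.mul_sum, hL]
      rw [show (-2 : ℤ) + (3 - 2 * j) = 3 - 2 * ((j + 1 : ℕ) : ℤ) by push_cast; ring]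
      congr 1
      refine integral_shift_eq hf.zero_notMem
        (derivEnergy_eq_zero hK (j + 1) IsTest.eq_zero) α τ ?_
      push_cast; ring
    · intro i _
      exact integrable_weight_mul hf (hwc _ _) (hEc j _ ((hf.sm Ω).pd hΩ i))
        (derivEnergy_eq_zero hK j (pd_eq_zero_of_notMem hK IsTest.eq_zero i))
  have hRi : ∀ i : Fin 3, ∀ j ∈ range (k + 1), τ ^ (-2 : ℤ) * (τ ^ (-(2 : ℤ) * j)
      * ∫ x : E3, carlemanWeight α τ (2 * (2 + (j : ℝ)) * (1 + α)) (σ + (1 + α)) x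
        * derivEnergy j (op2 a (pd i f)) x)
      ≤ 2 * (τ ^ (-(2 : ℤ) * (j + 1 : ℕ))
      * ∫ x : E3, carlemanWeight α τ (2 * (2 + ((j + 1 : ℕ) : ℝ)) * (1 + α)) σ x
        * derivEnergy j (pd i (op2 a f)) x) + D j * ∑ m ∈ range (j + 1), L (m + 2) := by
    intro i j hj
    have hint1 : Integrable fun x => carlemanWeight α τ (2 * (2 + ((j + 1 : ℕ) : ℝ)) * (1 + α)) σ x
        * derivEnergy j (pd i (op2 a f)) x :=
      integrable_weight_mul hf (hwc _ _) (hEc j _ (hAf.pd hΩ i))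
        (derivEnergy_eq_zero hK j (pd_eq_zero_of_notMem hK hAf0 i))
    have hint2 : ∀ m : ℕ, Integrable fun x => carlemanWeight α τ
        (α + 2 * ((m + 2 : ℕ) : ℝ) * (1 + α)) σ x * derivEnergy (m + 2) f x := fun m =>
      integrable_weight_mul hf (hwc _ _) (hEc _ _ (hf.sm Ω))
        (derivEnergy_eq_zero hK _ IsTest.eq_zero)
    have hfi0 := pd_eq_zero_of_notMem hK (IsTest.eq_zero (f := f)) i
    have hint3 : Integrable fun x => carlemanWeight α τ (2 * (2 + (j : ℝ)) * (1 + α))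
        (σ + (1 + α)) x * derivEnergy j (op2 a (pd i f)) x :=
      integrable_weight_mul hf (hwc _ _) (hEc j _ (sm_op2 hΩ ha ((hf.sm Ω).pd hΩ i)))
        (derivEnergy_eq_zero hK j (op2_eq_zero hK hfi0))
    simp only [hL]
    simp only [← integral_const_mul]
    rw [← integral_finsetSum _ (fun m _ => (hint2 m).const_mul _), ← integral_const_mul,
      ← integral_add ((hint1.const_mul _).const_mul _)
        ((integrable_finsetSum _ (fun m _ => (hint2 m).const_mul _)).const_mul _)]
    refine integral_mono ((hint3.const_mul _).const_mul _) (((hint1.const_mul _).const_mul _).add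
        ((integrable_finsetSum _ (fun m _ => (hint2 m).const_mul _)).const_mul _)) fun x => ?_
    by_cases hx : x ∈ tsupport f
    swap
    · have e1 := derivEnergy_eq_zero hK j (op2_eq_zero (a := a) hK hfi0) x hx
      have e2 := derivEnergy_eq_zero hK j (pd_eq_zero_of_notMem hK hAf0 i) x hx
      have e3 := fun m => derivEnergy_eq_zero hK m (IsTest.eq_zero (f := f)) x hx
      simp [e1, e2, e3]
    have hxb := hf.supp hx
    have hxn : x ≠ 0 := hxb.2
    have hx1 : ‖x‖ ≤ 1 := (mem_ball_zero_iff.1 hxb.1).le.trans (hrr0.trans hr1)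
    have hE := hD j i f (hf.sm Ω) x (ball_subset_closedBall hxb.1)
    have hw : carlemanWeight α τ (2 * (2 + (j : ℝ)) * (1 + α)) (σ + (1 + α)) x
        = carlemanWeight α τ (2 * (2 + ((j + 1 : ℕ) : ℝ)) * (1 + α)) σ x :=
      carlemanWeight_shift _ _ _ _ _ _ (by push_cast; ring) hxn
    have hτz : τ ^ (-2 : ℤ) * τ ^ (-(2 : ℤ) * j) = τ ^ (-(2 : ℤ) * (j + 1 : ℕ)) := by
      rw [← zpow_add₀ hτpos.ne']; congr 1; push_cast; ring
    simp only [hw]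
    set W := carlemanWeight α τ (2 * (2 + ((j + 1 : ℕ) : ℝ)) * (1 + α)) σ x with hW
    have hWn : 0 ≤ W := carlemanWeight_nonneg _ _ _ _ _
    set T := τ ^ (-(2 : ℤ) * (j + 1 : ℕ)) with hT
    have hTn : 0 ≤ T := zpow_nonneg hτpos.le _
    have hm : ∀ m ∈ range (j + 1), T * (W * derivEnergy (m + 2) f x)
        ≤ τ ^ ((3 : ℤ) - 2 * (m + 2 : ℕ)) * (carlemanWeight α τ
          (α + 2 * ((m + 2 : ℕ) : ℝ) * (1 + α)) σ x * derivEnergy (m + 2) f x) := by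
      intro m hm
      have hmj : m ≤ j := Nat.lt_succ_iff.1 (Finset.mem_range.1 hm)
      have hmj' : (m : ℝ) ≤ j := by exact_mod_cast hmj
      have a1 : T ≤ τ ^ ((3 : ℤ) - 2 * (m + 2 : ℕ)) :=
        zpow_le_zpow_right₀ hτ1 (by push_cast; omega)
      have a2 : W ≤ carlemanWeight α τ (α + 2 * ((m + 2 : ℕ) : ℝ) * (1 + α)) σ x :=
        carlemanWeight_anti _ _ _ _ _ (by push_cast; nlinarith) hxn hx1
      have := derivEnergy_nonneg (m + 2) f x
      gcongr
    have hsum := Finset.sum_le_sum hm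
    rw [← Finset.mul_sum, ← Finset.mul_sum] at hsum
    have hD' := mul_le_mul_of_nonneg_left hsum (hD0 j)
    have hE' := mul_le_mul_of_nonneg_left hE (mul_nonneg hTn hWn)
    calc τ ^ (-2 : ℤ) * (τ ^ (-(2 : ℤ) * j) * (W * derivEnergy j (op2 a (pd i f)) x))
        = T * W * derivEnergy j (op2 a (pd i f)) x := by rw [← hτz]; ring
      _ ≤ _ := by linarith
  have hRsum : ∀ j : ℕ, ∑ i, τ ^ (-(2 : ℤ) * (j + 1 : ℕ))
      * ∫ x : E3, carlemanWeight α τ (2 * (2 + ((j + 1 : ℕ) : ℝ)) * (1 + α)) σ x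
        * derivEnergy j (pd i (op2 a f)) x = R (j + 1) := by
    intro j
    rw [← Finset.mul_sum, ← integral_finsetSum]
    · simp only [← Finset.mul_sum]; rfl
    · intro i _
      exact integrable_weight_mul hf (hwc _ _) (hEc j _ (hAf.pd hΩ i))
        (derivEnergy_eq_zero hK j (pd_eq_zero_of_notMem hK hAf0 i))
  have hLm : ∀ j ∈ range (k + 1), ∑ m ∈ range (j + 1), L (m + 2) ≤ ∑ m ∈ range (k + 3), L m := by
    intro j hj
    have hj' := Finset.mem_range.1 hj
    calc ∑ m ∈ range (j + 1), L (m + 2) ≤ ∑ m ∈ range (k + 1), L (m + 2) :=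
          Finset.sum_le_sum_of_subset_of_nonneg
            (Finset.range_subset_range.2 (by omega)) (fun _ _ _ => hL0 _)
      _ ≤ ∑ m ∈ range (k + 3), L m := by
          rw [Finset.sum_range_succ' _ (k + 2), Finset.sum_range_succ' _ (k + 1)]
          linarith [hL0 0, hL0 (0 + 1)]
  have h3 : ∑ j ∈ range (k + 3), L (j + 1) ≤ C * (2 * ∑ j ∈ range (k + 1), R (j + 1)
      + 3 * DD * (C * ∑ j ∈ range (k + 1), R j)) := by
    calc ∑ j ∈ range (k + 3), L (j + 1)
        = τ ^ (-2 : ℤ) * ∑ i, ∑ j ∈ range (k + 3), τ ^ ((3 : ℤ) - 2 * j)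
      * ∫ x : E3, carlemanWeight α τ (α + 2 * (j : ℝ) * (1 + α)) (σ + (1 + α)) x
        * derivEnergy j (pd i f) x := by
          rw [Finset.sum_comm, Finset.mul_sum]; exact Finset.sum_congr rfl fun j _ => hLshift j
      _ ≤ τ ^ (-2 : ℤ) * ∑ i, (C * ∑ j ∈ range (k + 1), τ ^ (-(2 : ℤ) * j)
      * ∫ x : E3, carlemanWeight α τ (2 * (2 + (j : ℝ)) * (1 + α)) (σ + (1 + α)) x
        * derivEnergy j (op2 a (pd i f)) x) := by
          gcongr with i _; exact h2 i
      _ = C * ∑ i, ∑ j ∈ range (k + 1), τ ^ (-2 : ℤ) * (τ ^ (-(2 : ℤ) * j)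
      * ∫ x : E3, carlemanWeight α τ (2 * (2 + (j : ℝ)) * (1 + α)) (σ + (1 + α)) x
        * derivEnergy j (op2 a (pd i f)) x) := by
          simp only [← Finset.mul_sum]; ring
      _ ≤ C * ∑ i : Fin 3, ∑ j ∈ range (k + 1), (2 * (τ ^ (-(2 : ℤ) * (j + 1 : ℕ))
      * ∫ x : E3, carlemanWeight α τ (2 * (2 + ((j + 1 : ℕ) : ℝ)) * (1 + α)) σ x
        * derivEnergy j (pd i (op2 a f)) x) + D j * (C * ∑ j ∈ range (k + 1), R j)) := by
          gcongr with i _ j hj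
          refine (hRi i j hj).trans ?_
          have := mul_le_mul_of_nonneg_left ((hLm j hj).trans h1) (hD0 j)
          linarith
      _ = _ := by
          congr 1
          rw [Finset.sum_comm]
          simp only [Finset.sum_add_distrib, ← Finset.mul_sum _ _ (2 : ℝ), hRsum]
          simp only [Finset.sum_const, Finset.card_univ, Fintype.card_fin, ← Finset.smul_sum,
            ← Finset.sum_mul]
          rw [← hDD]
          simp only [nsmul_eq_mul]
          push_cast
          ring
  have hR1 : ∑ j ∈ range (k + 1), R j ≤ ∑ j ∈ range (k + 1 + 1), R j := by
    rw [Finset.sum_range_succ _ (k + 1)]; linarith [hR0 (k + 1)]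
  have hR2 : ∑ j ∈ range (k + 1), R (j + 1) ≤ ∑ j ∈ range (k + 1 + 1), R j := by
    rw [Finset.sum_range_succ' _ (k + 1)]; linarith [hR0 0]
  have hL1 : L 0 ≤ ∑ j ∈ range (k + 3), L j :=
    Finset.single_le_sum (fun j _ => hL0 j) (Finset.mem_range.2 (by omega))
  rw [show k + 1 + 3 = (k + 3) + 1 by ring, Finset.sum_range_succ']
  have b1 := mul_le_mul_of_nonneg_left hR1 hC.le
  have b2 := mul_le_mul_of_nonneg_left hR2 hC.le
  have b3 := mul_le_mul_of_nonneg_left hR1 (by positivity : 0 ≤ 3 * C * DD * C)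
  have : L 0 + ∑ j ∈ range (k + 3), L (j + 1)
      ≤ (C + 2 * C + 3 * C * DD * C) * ∑ j ∈ range (k + 1 + 1), R j := by
    linarith
  linarith

end Iteration

section Norms

variable {f : E3 → ℝ} {x : E3}

lemma norm_iteratedFDeriv_pd_le (hf : ContDiff ℝ (⊤ : ℕ∞) f) (j : ℕ) (i : Fin 3) (x : E3) :
    ‖iteratedFDeriv ℝ j (pd i f) x‖ ≤ ‖iteratedFDeriv ℝ (j + 1) f x‖ := by
  rw [← norm_iteratedFDeriv_fderiv]
  have hf' : ContDiff ℝ (⊤ : ℕ∞) (fderiv ℝ f) := hf.fderiv_right (by simp)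
  have h := (ContinuousLinearMap.apply ℝ ℝ (EuclideanSpace.single i (1 : ℝ) : E3)
    ).norm_iteratedFDeriv_comp_left (f := fderiv ℝ f) (x := x) (N := (⊤ : ℕ∞)) (n := j)
    hf'.contDiffAt (by exact_mod_cast le_top)
  have hn : ‖ContinuousLinearMap.apply ℝ ℝ (EuclideanSpace.single i (1 : ℝ) : E3)‖ ≤ 1 := by
    refine ContinuousLinearMap.opNorm_le_bound _ zero_le_one fun L => ?_
    have := L.le_opNorm (EuclideanSpace.single i (1 : ℝ) : E3)
    simpa using this
  refine le_trans h ?_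
  exact mul_le_of_le_one_left (norm_nonneg _) hn

lemma norm_iteratedFDeriv_succ_le (hf : ContDiff ℝ (⊤ : ℕ∞) f) (j : ℕ) (x : E3) :
    ‖iteratedFDeriv ℝ (j + 1) f x‖ ≤ ∑ i, ‖iteratedFDeriv ℝ j (pd i f) x‖ := by
  rw [← norm_iteratedFDeriv_fderiv]
  let L : Fin 3 → ℝ →L[ℝ] (E3 →L[ℝ] ℝ) := fun i =>
    ContinuousLinearMap.toSpanSingleton ℝ (EuclideanSpace.proj i : E3 →L[ℝ] ℝ)
  have hL : ∀ i, ‖L i‖ ≤ 1 := fun i => by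
    rw [ContinuousLinearMap.norm_toSpanSingleton]
    refine ContinuousLinearMap.opNorm_le_bound _ zero_le_one fun y => ?_
    simpa using PiLp.norm_apply_le y i
  have heq : fderiv ℝ f = fun y => ∑ i, (L i ∘ pd i f) y := by
    funext y
    ext v
    have hv : v = ∑ i, v i • (EuclideanSpace.single i (1 : ℝ) : E3) := by
      ext k; simp [Finset.sum_apply, Pi.single_apply]
    conv_lhs => rw [hv]
    simp [L, pd, mul_comm]
  have hp : ∀ i, ContDiff ℝ (⊤ : ℕ∞) (pd i f) := fun i =>
    contDiffOn_univ.1 (Sm.pd hf.contDiffOn isOpen_univ i)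
  have hj : (j : WithTop ℕ∞) ≤ ((⊤ : ℕ∞) : WithTop ℕ∞) := by exact_mod_cast le_top
  rw [heq, iteratedFDeriv_fun_sum_apply
    (fun i _ => (((L i).contDiff.comp (hp i)).of_le hj).contDiffAt)]
  refine (norm_sum_le _ _).trans (Finset.sum_le_sum fun i _ => ?_)
  refine ((L i).norm_iteratedFDeriv_comp_left (hp i).contDiffAt hj).trans ?_
  exact mul_le_of_le_one_left (norm_nonneg _) (hL i)

lemma norm_sq_iteratedFDeriv_le (j : ℕ) : ∀ {f : E3 → ℝ}, ContDiff ℝ (⊤ : ℕ∞) f → ∀ x,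
    ‖iteratedFDeriv ℝ j f x‖ ^ 2 ≤ 3 ^ j * derivEnergy j f x := by
  induction j with
  | zero => intro f _ x; simp [derivEnergy]
  | succ j ih =>
    intro f hf x
    have h1 := pow_le_pow_left₀ (norm_nonneg _) (norm_iteratedFDeriv_succ_le hf j x) 2
    have h2 := sq_sum_le_card_mul_sum_sq (s := (Finset.univ : Finset (Fin 3)))
      (f := fun i => ‖iteratedFDeriv ℝ j (pd i f) x‖)
    have h3 : ∑ i, ‖iteratedFDeriv ℝ j (pd i f) x‖ ^ 2
        ≤ ∑ i, 3 ^ j * derivEnergy j (pd i f) x := Finset.sum_le_sum fun i _ =>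
      ih (contDiffOn_univ.1 (Sm.pd hf.contDiffOn isOpen_univ i)) x
    rw [← Finset.mul_sum] at h3
    simp only [Finset.card_univ, Fintype.card_fin] at h2
    push_cast at h2
    have h4 : ∑ i, derivEnergy j (pd i f) x = derivEnergy (j + 1) f x := rfl
    rw [h4] at h3
    rw [pow_succ (3 : ℝ) j]
    linarith

lemma derivEnergy_le_norm_sq (j : ℕ) : ∀ {f : E3 → ℝ}, ContDiff ℝ (⊤ : ℕ∞) f → ∀ x,
    derivEnergy j f x ≤ 3 ^ j * ‖iteratedFDeriv ℝ j f x‖ ^ 2 := by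
  induction j with
  | zero => intro f _ x; simp [derivEnergy]
  | succ j ih =>
    intro f hf x
    have h3 : derivEnergy (j + 1) f x
        ≤ ∑ i : Fin 3, 3 ^ j * ‖iteratedFDeriv ℝ (j + 1) f x‖ ^ 2 :=
      Finset.sum_le_sum fun i _ =>
        (ih (contDiffOn_univ.1 (Sm.pd hf.contDiffOn isOpen_univ i)) x).trans (by
          have := norm_iteratedFDeriv_pd_le hf j i x
          gcongr)
    refine h3.trans (le_of_eq ?_)
    simp; ring

lemma norm_sq_iteratedFDeriv_vector_le {V : E3 → E7} (hV : ContDiff ℝ (⊤ : ℕ∞) V) (j : ℕ) (x : E3) :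
    ‖iteratedFDeriv ℝ j V x‖ ^ 2 ≤ 7 * ∑ c, ‖iteratedFDeriv ℝ j (fun y => V y c) x‖ ^ 2 := by
  let L : Fin 7 → ℝ →L[ℝ] E7 := fun c =>
    ContinuousLinearMap.toSpanSingleton ℝ (EuclideanSpace.single c (1 : ℝ) : E7)
  have hL : ∀ c, ‖L c‖ ≤ 1 := fun c => by
    rw [ContinuousLinearMap.norm_toSpanSingleton]
    simp
  have hp : ∀ c, ContDiff ℝ (⊤ : ℕ∞) (fun y => V y c) := fun c =>
    (EuclideanSpace.proj c : E7 →L[ℝ] ℝ).contDiff.comp hV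
  have heq : V = fun y => ∑ c, (L c ∘ fun y => V y c) y := by
    funext y
    ext k
    simp [L, Finset.sum_apply, Pi.single_apply]
  have hj : (j : WithTop ℕ∞) ≤ ((⊤ : ℕ∞) : WithTop ℕ∞) := by exact_mod_cast le_top
  have h1 : ‖iteratedFDeriv ℝ j V x‖ ≤ ∑ c, ‖iteratedFDeriv ℝ j (fun y => V y c) x‖ := by
    conv_lhs => rw [heq]
    rw [iteratedFDeriv_fun_sum_apply
      (fun c _ => (((L c).contDiff.comp (hp c)).of_le hj).contDiffAt)]
    refine (norm_sum_le _ _).trans (Finset.sum_le_sum fun c _ => ?_)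
    refine ((L c).norm_iteratedFDeriv_comp_left (hp c).contDiffAt hj).trans ?_
    exact mul_le_of_le_one_left (norm_nonneg _) (hL c)
  have h2 := sq_sum_le_card_mul_sum_sq (s := (Finset.univ : Finset (Fin 7)))
      (f := fun c => ‖iteratedFDeriv ℝ j (fun y => V y c) x‖)
  simp only [Finset.card_univ, Fintype.card_fin] at h2
  push_cast at h2
  exact (pow_le_pow_left₀ (norm_nonneg _) h1 2).trans h2

lemma norm_iteratedFDeriv_component_le {V : E3 → E7} (hV : ContDiff ℝ (⊤ : ℕ∞) V) (j : ℕ) (x : E3)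
    (c : Fin 7) : ‖iteratedFDeriv ℝ j (fun y => V y c) x‖ ≤ ‖iteratedFDeriv ℝ j V x‖ := by
  have h := (EuclideanSpace.proj c : E7 →L[ℝ] ℝ).norm_iteratedFDeriv_comp_left (f := V) (x := x)
    (N := (⊤ : ℕ∞)) (n := j) hV.contDiffAt (by exact_mod_cast le_top)
  have hn : ‖(EuclideanSpace.proj c : E7 →L[ℝ] ℝ)‖ ≤ 1 := by
    refine ContinuousLinearMap.opNorm_le_bound _ zero_le_one fun y => ?_
    simpa using PiLp.norm_apply_le y c
  exact h.trans (mul_le_of_le_one_left (norm_nonneg _) hn)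

end Norms

section Assembly

variable {Ω : Set E3} {a : Fin 3 → Fin 3 → E3 → ℝ} {α : ℝ}

lemma CarlemanHolds.all (hΩ : IsOpen Ω) (h0 : (0 : E3) ∈ Ω) (ha : ∀ j k, Sm Ω (a j k))
    (hα : 0 < α) (H : CarlemanHolds a α 0) (k : ℕ) : CarlemanHolds a α k := by
  induction k with
  | zero => exact H
  | succ k ih => exact ih.succ hΩ h0 ha hα

/-- Constants that serve every `k ≤ N` simultaneously. -/
lemma CarlemanHolds.uniform (H : ∀ k, CarlemanHolds a α k) (ν : ℝ) (hν : 0 < ν) (N : ℕ) :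
    ∃ τ0 ≥ (1 : ℝ), ∃ r0 > (0 : ℝ), r0 ≤ 1 ∧ ∃ C > (0 : ℝ),
    ∀ k ≤ N, ∀ σ : ℝ, |σ| ≤ ν → ∀ τ ≥ τ0, ∀ f : E3 → ℝ, IsTest r0 f →
      (∑ j ∈ range (k + 3), τ ^ ((3 : ℤ) - 2 * j)
          * ∫ x : E3, carlemanWeight α τ (α + 2 * (j : ℝ) * (1 + α)) σ x * derivEnergy j f x)
      ≤ C * ∑ j ∈ range (k + 1), τ ^ (-(2 : ℤ) * j)
          * ∫ x : E3, carlemanWeight α τ (2 * (2 + (j : ℝ)) * (1 + α)) σ x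
              * derivEnergy j (op2 a f) x := by
  choose τ0 hτ0 r0 hr0 hr1 C hC h using fun k => H k ν hν
  have hne : (range (N + 1)).Nonempty := ⟨0, by simp⟩
  refine ⟨(range (N + 1)).sup' hne τ0, ?_, (range (N + 1)).inf' hne r0, ?_, ?_,
    (range (N + 1)).sup' hne C, ?_, ?_⟩
  · exact (hτ0 0).trans (Finset.le_sup' τ0 (by simp : 0 ∈ range (N + 1)))
  · exact (Finset.lt_inf'_iff _).2 fun k _ => hr0 k
  · exact (Finset.inf'_le r0 (by simp : 0 ∈ range (N + 1))).trans (hr1 0)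
  · exact (hC 0).trans_le (Finset.le_sup' C (by simp : 0 ∈ range (N + 1)))
  · intro k hk σ hσ τ hτ f hf
    have hk' : k ∈ range (N + 1) := Finset.mem_range.2 (by omega)
    have hτ' : τ0 k ≤ τ := (Finset.le_sup' τ0 hk').trans hτ
    have hτpos : 0 ≤ τ := (zero_le_one.trans (hτ0 k)).trans hτ'
    refine (h k σ hσ τ hτ' f (hf.mono (Finset.inf'_le r0 hk'))).trans ?_
    refine mul_le_mul_of_nonneg_right (Finset.le_sup' C hk') (Finset.sum_nonneg fun j _ => ?_)
    exact mul_nonneg (zpow_nonneg hτpos _) (integral_nonneg fun x =>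
      mul_nonneg (carlemanWeight_nonneg _ _ _ _ _) (derivEnergy_nonneg _ _ _))

lemma carleman_vector_of_scalar (hΩ : IsOpen Ω) (h0 : (0 : E3) ∈ Ω) (ha : ∀ j k, Sm Ω (a j k))
    (hα : 0 < α) (H : CarlemanHolds a α 0) :
    ∀ ν : ℝ, 0 < ν → ∃ τ0 > (0 : ℝ), ∃ r0 > (0 : ℝ), ∃ C > (0 : ℝ),
      ∀ k : ℕ, (k : ℝ) ≤ ν → ∀ σ : ℝ, |σ| ≤ ν → ∀ τ : ℝ, τ ≥ τ0 →
        ∀ V : E3 → E7, ContDiff ℝ (⊤ : ℕ∞) V → tsupport V ⊆ ball (0 : E3) r0 \ {0} →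
          (∑ j ∈ Finset.range (k + 3), τ ^ ((3 : ℤ) - 2 * j)
              * ∫ x : E3, ‖x‖ ^ (α + 2 * (j : ℝ) * (1 + α)) * ‖x‖ ^ (2 * σ)
                  * Real.exp (2 * τ * ‖x‖ ^ (-α)) * ‖iteratedFDeriv ℝ j V x‖ ^ 2)
          ≤ C * ∑ j ∈ Finset.range (k + 1), τ ^ (-(2 : ℤ) * j)
              * ∫ x : E3, ‖x‖ ^ (2 * (2 + (j : ℝ)) * (1 + α)) * ‖x‖ ^ (2 * σ)
                  * Real.exp (2 * τ * ‖x‖ ^ (-α)) * ‖iteratedFDeriv ℝ j (op2V a V) x‖ ^ 2 := by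
  intro ν hν
  obtain ⟨τ0, hτ0, r0, hr0, -, C, hC, hbase⟩ :=
    CarlemanHolds.uniform (CarlemanHolds.all hΩ h0 ha hα H) ν hν ⌊ν⌋₊
  obtain ⟨r2, hr2, hball⟩ := Metric.isOpen_iff.1 hΩ 0 h0
  set N := ⌊ν⌋₊ with hN
  refine ⟨τ0, by linarith, min r0 r2, lt_min hr0 hr2,
    7 * 3 ^ (N + 3) * C * (7 * 3 ^ (N + 3)), by positivity, fun k hk σ hσ τ hτ V hV hsupp => ?_⟩
  have hkN : k ≤ N := Nat.le_floor hk
  have hτpos : 0 < τ := by linarith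
  have hVc : ∀ c, IsTest (min r0 r2) (fun y => V y c) := fun c =>
    ⟨(EuclideanSpace.proj c : E7 →L[ℝ] ℝ).contDiff.comp hV, by
      refine subset_trans (closure_mono ?_) hsupp
      exact fun x hx h => hx (by simp [h])⟩
  have hVr : ∀ c, IsTest r0 (fun y => V y c) := fun c => (hVc c).mono (min_le_left _ _)
  have hKc : IsClosed (tsupport V) := isClosed_tsupport V
  have hK : IsCompact (tsupport V) := (isCompact_closedBall (0 : E3) (min r0 r2)).of_isClosed_subset
    hKc ((hsupp.trans Set.sdiff_subset).trans ball_subset_closedBall)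
  have hKΩ : tsupport V ⊆ Ω := fun x hx =>
    hball (ball_subset_ball (min_le_right _ _) (hsupp hx).1)
  have h0K : (0 : E3) ∉ tsupport V := fun h => (hsupp h).2 rfl
  have hV0 : ∀ c, ∀ x ∉ tsupport V, V x c = 0 := fun c x hx => by
    rw [image_eq_zero_of_notMem_tsupport hx]; rfl
  have hAc : ∀ c, ContDiff ℝ (⊤ : ℕ∞) (op2 a (fun y => V y c)) := fun c =>
    contDiff_of_eqOn_compl hΩ (sm_op2 hΩ ha ((hVc c).sm Ω)) hKc hKΩ (op2_eq_zero hKc (hV0 c))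
  have hA : ContDiff ℝ (⊤ : ℕ∞) (op2V a V) := by
    rw [contDiff_euclidean]
    exact hAc
  have hwc : ∀ e, ContinuousOn (carlemanWeight α τ e σ) (tsupport V) := fun e =>
    continuousOn_carlemanWeight α τ e σ h0K
  have hintE : ∀ e j c, Integrable fun x =>
      carlemanWeight α τ e σ x * derivEnergy j (fun y => V y c) x := fun e j c =>
    integrable_of_continuousOn hK ((hwc e).mul ((continuousOn_derivEnergy hΩ j
      ((hVc c).sm Ω)).mono hKΩ)) fun x hx => by
        rw [derivEnergy_eq_zero hKc j (hV0 c) x hx, mul_zero]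
  have hintA : ∀ e j c, Integrable fun x =>
      carlemanWeight α τ e σ x * derivEnergy j (op2 a (fun y => V y c)) x := fun e j c =>
    integrable_of_continuousOn hK ((hwc e).mul ((continuousOn_derivEnergy hΩ j
      (sm_op2 hΩ ha ((hVc c).sm Ω))).mono hKΩ)) fun x hx => by
        rw [derivEnergy_eq_zero hKc j (op2_eq_zero hKc (hV0 c)) x hx, mul_zero]
  have hAsupp : tsupport (op2V a V) ⊆ tsupport V := by
    refine closure_minimal (fun x hx => ?_) hKc
    by_contra h
    apply hx
    ext c
    exact op2_eq_zero hKc (hV0 c) x h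
  have hintN : ∀ e j, Integrable fun x =>
      carlemanWeight α τ e σ x * ‖iteratedFDeriv ℝ j (op2V a V) x‖ ^ 2 := fun e j =>
    integrable_of_continuousOn hK ((hwc e).mul
      (((hA.continuous_iteratedFDeriv (by exact_mod_cast le_top)).norm.pow 2).continuousOn))
      fun x hx => by
        have : iteratedFDeriv ℝ j (op2V a V) x = 0 := by
          by_contra h
          exact hx (hAsupp (support_iteratedFDeriv_subset (𝕜 := ℝ) j h))
        rw [this]; simp
  have hpow : ∀ j ≤ N + 2, (3 : ℝ) ^ j ≤ 3 ^ (N + 3) := fun j hj =>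
    pow_le_pow_right₀ (by norm_num) (by omega)
  have hleft : ∀ j ∈ range (k + 3), τ ^ ((3 : ℤ) - 2 * j)
      * ∫ x : E3, carlemanWeight α τ (α + 2 * (j : ℝ) * (1 + α)) σ x * ‖iteratedFDeriv ℝ j V x‖ ^ 2
      ≤ 7 * 3 ^ (N + 3) * ∑ c, τ ^ ((3 : ℤ) - 2 * j) * ∫ x : E3,
        carlemanWeight α τ (α + 2 * (j : ℝ) * (1 + α)) σ x
          * derivEnergy j (fun y => V y c) x := by
    intro j hj
    have hj' := Finset.mem_range.1 hj
    rw [← Finset.mul_sum, ← integral_finsetSum _ (fun c _ => hintE _ j c), mul_left_comm]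
    refine mul_le_mul_of_nonneg_left ?_ (zpow_nonneg hτpos.le _)
    rw [← integral_const_mul]
    refine integral_mono_of_nonneg (Filter.Eventually.of_forall fun x =>
      mul_nonneg (carlemanWeight_nonneg _ _ _ _ _) (sq_nonneg _))
      ((integrable_finsetSum _ (fun c _ => hintE _ j c)).const_mul _)
      (Filter.Eventually.of_forall fun x => ?_)
    have h1 := norm_sq_iteratedFDeriv_vector_le hV j x
    have h2 : ∑ c, ‖iteratedFDeriv ℝ j (fun y => V y c) x‖ ^ 2
        ≤ ∑ c, 3 ^ (N + 3) * derivEnergy j (fun y => V y c) x := by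
      refine Finset.sum_le_sum fun c _ => (norm_sq_iteratedFDeriv_le j (hVc c).smooth x).trans ?_
      exact mul_le_mul_of_nonneg_right (hpow j (by omega)) (derivEnergy_nonneg _ _ _)
    rw [← Finset.mul_sum] at h2
    have h3 : ‖iteratedFDeriv ℝ j V x‖ ^ 2
        ≤ 7 * 3 ^ (N + 3) * ∑ c, derivEnergy j (fun y => V y c) x := by linarith
    have := mul_le_mul_of_nonneg_left h3
      (carlemanWeight_nonneg α τ (α + 2 * (j : ℝ) * (1 + α)) σ x)
    simp only [← Finset.mul_sum]
    linarith
  have hright : ∀ j ∈ range (k + 1), ∑ c, τ ^ (-(2 : ℤ) * j) * ∫ x : E3,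
        carlemanWeight α τ (2 * (2 + (j : ℝ)) * (1 + α)) σ x
          * derivEnergy j (op2 a (fun y => V y c)) x
      ≤ 7 * 3 ^ (N + 3) * (τ ^ (-(2 : ℤ) * j) * ∫ x : E3,
        carlemanWeight α τ (2 * (2 + (j : ℝ)) * (1 + α)) σ x
          * ‖iteratedFDeriv ℝ j (op2V a V) x‖ ^ 2) := by
    intro j hj
    have hj' := Finset.mem_range.1 hj
    rw [← Finset.mul_sum, ← integral_finsetSum _ (fun c _ => hintA _ j c), mul_left_comm]
    refine mul_le_mul_of_nonneg_left ?_ (zpow_nonneg hτpos.le _)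
    rw [← integral_const_mul]
    refine integral_mono (integrable_finsetSum _ (fun c _ => hintA _ j c))
      ((hintN _ j).const_mul _) fun x => ?_
    have h2 : ∑ c, derivEnergy j (op2 a (fun y => V y c)) x
        ≤ ∑ c : Fin 7, 3 ^ (N + 3) * ‖iteratedFDeriv ℝ j (op2V a V) x‖ ^ 2 := by
      refine Finset.sum_le_sum fun c _ => (derivEnergy_le_norm_sq j (hAc c) x).trans ?_
      have := norm_iteratedFDeriv_component_le hA j x c
      exact mul_le_mul (hpow j (by omega)) (pow_le_pow_left₀ (norm_nonneg _) this 2)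
        (sq_nonneg _) (by positivity)
    rw [Finset.sum_const, Finset.card_univ, Fintype.card_fin, nsmul_eq_mul] at h2
    push_cast at h2
    have := mul_le_mul_of_nonneg_left h2
      (carlemanWeight_nonneg α τ (2 * (2 + (j : ℝ)) * (1 + α)) σ x)
    simp only [← Finset.mul_sum]
    linarith
  have hmid : ∀ c, _ := fun c => hbase k hkN σ hσ τ hτ (fun y => V y c) (hVr c)
  calc _ ≤ ∑ j ∈ range (k + 3), 7 * 3 ^ (N + 3) * ∑ c, τ ^ ((3 : ℤ) - 2 * j) * ∫ x : E3,
        carlemanWeight α τ (α + 2 * (j : ℝ) * (1 + α)) σ x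
          * derivEnergy j (fun y => V y c) x := Finset.sum_le_sum hleft
    _ = 7 * 3 ^ (N + 3) * ∑ c, ∑ j ∈ range (k + 3), τ ^ ((3 : ℤ) - 2 * j) * ∫ x : E3,
        carlemanWeight α τ (α + 2 * (j : ℝ) * (1 + α)) σ x
          * derivEnergy j (fun y => V y c) x := by rw [← Finset.mul_sum, Finset.sum_comm]
    _ ≤ 7 * 3 ^ (N + 3) * ∑ c, (C * ∑ j ∈ range (k + 1), τ ^ (-(2 : ℤ) * j) * ∫ x : E3,
        carlemanWeight α τ (2 * (2 + (j : ℝ)) * (1 + α)) σ x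
          * derivEnergy j (op2 a (fun y => V y c)) x) :=
        mul_le_mul_of_nonneg_left (Finset.sum_le_sum fun c _ => hmid c) (by positivity)
    _ = 7 * 3 ^ (N + 3) * C * ∑ j ∈ range (k + 1), ∑ c, τ ^ (-(2 : ℤ) * j) * ∫ x : E3,
        carlemanWeight α τ (2 * (2 + (j : ℝ)) * (1 + α)) σ x
          * derivEnergy j (op2 a (fun y => V y c)) x := by
        rw [← Finset.mul_sum, Finset.sum_comm]; ring
    _ ≤ 7 * 3 ^ (N + 3) * C * ∑ j ∈ range (k + 1), 7 * 3 ^ (N + 3) * (τ ^ (-(2 : ℤ) * j)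
          * ∫ x : E3, carlemanWeight α τ (2 * (2 + (j : ℝ)) * (1 + α)) σ x
          * ‖iteratedFDeriv ℝ j (op2V a V) x‖ ^ 2) :=
        mul_le_mul_of_nonneg_left (Finset.sum_le_sum hright) (by positivity)
    _ = _ := by rw [← Finset.mul_sum, ← mul_assoc]; rfl

end Assembly

section Gradients

/-- `f` is differentiable at `x` with partial derivatives `f'`. -/
structure HasGrad (f : E3 → ℝ) (f' : Fin 3 → ℝ) (x : E3) : Prop where
  diff : DifferentiableAt ℝ f x
  eq : ∀ i, pd i f x = f' i

variable {U : Set E3} {f g : E3 → ℝ} {f' g' : Fin 3 → ℝ} {x : E3}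

lemma Sm.hasGrad (hf : Sm U f) (hU : IsOpen U) (hx : x ∈ U) : HasGrad f (fun i => _root_.pd i f x) x :=
  ⟨hf.differentiableAt hU hx, fun _ => rfl⟩

lemma HasGrad.congr_grad (hf : HasGrad f f' x) (h : ∀ i, f' i = g' i) : HasGrad f g' x :=
  ⟨hf.diff, fun i => (hf.eq i).trans (h i)⟩

lemma HasGrad.congr_on (hf : HasGrad f f' x) (hU : IsOpen U) (hx : x ∈ U) (h : Set.EqOn g f U) :
    HasGrad g f' x :=
  ⟨hf.diff.congr_of_eventuallyEq (Filter.eventually_of_mem (hU.mem_nhds hx) h),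
    fun i => (pd_congr_on hU h i hx).trans (hf.eq i)⟩

lemma HasGrad.mul (hf : HasGrad f f' x) (hg : HasGrad g g' x) :
    HasGrad (fun y => f y * g y) (fun i => f' i * g x + f x * g' i) x :=
  ⟨hf.diff.mul hg.diff, fun i => by rw [pd_mul_apply hf.diff hg.diff, hf.eq, hg.eq]⟩

lemma HasGrad.add (hf : HasGrad f f' x) (hg : HasGrad g g' x) :
    HasGrad (fun y => f y + g y) (fun i => f' i + g' i) x :=
  ⟨hf.diff.add hg.diff, fun i => by rw [pd_add_apply hf.diff hg.diff, hf.eq, hg.eq]⟩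

lemma HasGrad.sub (hf : HasGrad f f' x) (hg : HasGrad g g' x) :
    HasGrad (fun y => f y - g y) (fun i => f' i - g' i) x :=
  ⟨hf.diff.sub hg.diff, fun i => by rw [pd_sub_apply hf.diff hg.diff, hf.eq, hg.eq]⟩

lemma HasGrad.const_mul (c : ℝ) (hf : HasGrad f f' x) :
    HasGrad (fun y => c * f y) (fun i => c * f' i) x :=
  ⟨hf.diff.const_mul c, fun i => by rw [pd_const_mul_apply c hf.diff, hf.eq]⟩

lemma HasGrad.sum {ι : Type*} {s : Finset ι} {F : ι → E3 → ℝ} {F' : ι → Fin 3 → ℝ}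
    (h : ∀ k, HasGrad (F k) (F' k) x) :
    HasGrad (fun y => ∑ k ∈ s, F k y) (fun i => ∑ k ∈ s, F' k i) x :=
  ⟨DifferentiableAt.fun_sum fun k _ => (h k).diff, fun i => by
    rw [pd_sum_apply s (fun k _ => (h k).diff)]
    exact Finset.sum_congr rfl fun k _ => (h k).eq i⟩

lemma hasGrad_coord (k : Fin 3) : HasGrad (fun y => y k) (fun i => if k = i then 1 else 0) x :=
  ⟨(EuclideanSpace.proj k : E3 →L[ℝ] ℝ).differentiableAt, fun i => pd_coord i k⟩

lemma hasGrad_comp {φ : ℝ → ℝ} {φ' : ℝ} (hφ : HasDerivAt φ φ' (f x)) (hf : HasGrad f f' x) :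
    HasGrad (fun y => φ (f y)) (fun i => φ' * f' i) x := by
  have := hφ.comp_hasFDerivAt x hf.diff.hasFDerivAt
  refine ⟨this.differentiableAt, fun i => ?_⟩
  have h2 : fderiv ℝ (fun y => φ (f y)) x = φ' • fderiv ℝ f x := this.fderiv
  rw [← hf.eq, pd, h2]
  rfl

lemma norm_sq_eq_sum (x : E3) : ‖x‖ ^ 2 = ∑ i, x i ^ 2 := EuclideanSpace.real_norm_sq_eq x

lemma hasGrad_norm_rpow (p : ℝ) (hx : x ≠ 0) :
    HasGrad (fun y => ‖y‖ ^ p) (fun i => p * ‖x‖ ^ (p - 2) * x i) x := by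
  have hpos : 0 < ‖x‖ := norm_pos_iff.2 hx
  have h1 : HasGrad (fun y : E3 => ∑ i, y i * y i) (fun i => 2 * x i) x :=
    (HasGrad.sum fun k => (hasGrad_coord k).mul (hasGrad_coord k)).congr_grad fun i => by
      simp [Finset.sum_add_distrib]; ring
  have hs : ∀ y : E3, ∑ i, y i * y i = ‖y‖ ^ 2 := fun y => by
    rw [norm_sq_eq_sum]; exact Finset.sum_congr rfl fun i _ => (sq _).symm
  have h2 := hasGrad_comp (φ := fun t => t ^ (p / 2))
    (Real.hasDerivAt_rpow_const (p := p / 2) (Or.inl (by rw [hs]; positivity))) h1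
  have h3 : (fun y : E3 => (∑ i, y i * y i) ^ (p / 2)) = fun y => ‖y‖ ^ p := by
    funext y
    rw [hs, ← Real.rpow_natCast, ← Real.rpow_mul (norm_nonneg _)]
    congr 1
    push_cast; ring
  rw [h3] at h2
  refine h2.congr_grad fun i => ?_
  rw [hs, ← Real.rpow_natCast, ← Real.rpow_mul (norm_nonneg _)]
  have : ((2 : ℕ) : ℝ) * (p / 2 - 1) = p - 2 := by push_cast; ring
  rw [this]
  ring

lemma sm_norm_rpow (p : ℝ) (h0 : (0 : E3) ∉ U) : Sm U fun y => ‖y‖ ^ p := by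
  have hne : ∀ y ∈ U, y ≠ 0 := by rintro y hy rfl; exact h0 hy
  exact (contDiffOn_id.norm ℝ hne).rpow_const_of_ne fun y hy => (norm_pos_iff.2 (hne y hy)).ne'

/-- The multiplier `-2 M·∇v - g v` applied to `Σ a_jk v_jk + E v` is a divergence plus
a quadratic form in `(v, ∇v)`. -/
lemma multiplier_identity (hU : IsOpen U) (hx : x ∈ U) {a : Fin 3 → Fin 3 → E3 → ℝ}
    (hsym : ∀ j k y, a j k y = a k j y) (ha : ∀ j k, Sm U (a j k)) {M : Fin 3 → E3 → ℝ}
    (hM : ∀ l, Sm U (M l)) {E v : E3 → ℝ} (hg : Sm U g) (hE : Sm U E) (hv : Sm U v) :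
    (∑ j, ∑ k, a j k x * pd j (pd k v) x + E x * v x)
        * (-2 * ∑ l, M l x * pd l v x - g x * v x)
      = ∑ j, pd j (fun y => (-2 * ((∑ k, a j k y * pd k v y) * ∑ l, M l y * pd l v y)
          + M j y * ∑ k, ∑ l, a k l y * (pd k v y * pd l v y))
          - (g y * v y * (∑ k, a j k y * pd k v y) + E y * M j y * (v y * v y))) x
        + (2 * (∑ j, ∑ k, ∑ l, a j k x * pd j (M l) x * (pd k v x * pd l v x))
          + (g x - ∑ l, pd l (M l) x) * (∑ k, ∑ l, a k l x * (pd k v x * pd l v x))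
          + 2 * (∑ j, ∑ k, ∑ l, pd j (a j k) x * M l x * (pd k v x * pd l v x))
          - (∑ j, ∑ k, ∑ l, M l x * pd l (a j k) x * (pd j v x * pd k v x))
          + (∑ j, ∑ k, (pd j g x * a j k x + g x * pd j (a j k) x) * pd k v x) * v x
          + (∑ l, M l x * pd l E x + E x * (∑ l, pd l (M l) x) - g x * E x) * v x ^ 2) := by
  have hvk : ∀ k, HasGrad (pd k v) (fun i => pd i (pd k v) x) x := fun k =>
    (hv.pd hU k).hasGrad hU hx
  have hv' := hv.hasGrad hU hx
  have hg' := hg.hasGrad hU hx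
  have hE' := hE.hasGrad hU hx
  have hM' := fun l => (hM l).hasGrad hU hx
  have ha' := fun j k => (ha j k).hasGrad hU hx
  have hP : ∀ j, HasGrad (fun y => ∑ k, a j k y * pd k v y) _ x := fun j =>
    HasGrad.sum fun k => (ha' j k).mul (hvk k)
  have hQ : HasGrad (fun y => ∑ l, M l y * pd l v y) _ x :=
    HasGrad.sum fun l => (hM' l).mul (hvk l)
  have hR : HasGrad (fun y => ∑ k, ∑ l, a k l y * (pd k v y * pd l v y)) _ x :=
    HasGrad.sum fun k => HasGrad.sum fun l => (ha' k l).mul ((hvk k).mul (hvk l))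
  have hF := fun j => ((((hP j).mul hQ).const_mul (-2)).add ((hM' j).mul hR)).sub
    (((hg'.mul hv').mul (hP j)).add ((hE'.mul (hM' j)).mul (hv'.mul hv')))
  rw [Finset.sum_congr rfl fun j _ => (hF j).eq j]
  have c1 := pd_comm_apply hv hU hx 1 0
  have c2 := pd_comm_apply hv hU hx 2 0
  have c3 := pd_comm_apply hv hU hx 2 1
  have e1 : a 1 0 = a 0 1 := funext fun y => hsym 1 0 y
  have e2 : a 2 0 = a 0 2 := funext fun y => hsym 2 0 y
  have e3 : a 2 1 = a 1 2 := funext fun y => hsym 2 1 y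
  simp only [Fin.sum_univ_three, c1, c2, c3, e1, e2, e3]
  ring

end Gradients

section Spectral

variable {A : Matrix (Fin 3) (Fin 3) ℝ}

lemma exists_eigen_coordinates (h : A.IsHermitian) (z : E3) : ∃ c : Fin 3 → ℝ,
    ∑ i, z i ^ 2 = ∑ i, c i ^ 2 ∧
    ∑ i, z i * ∑ k, A i k * z k = ∑ i, h.eigenvalues i * c i ^ 2 ∧
    ∑ i, (∑ k, A i k * z k) ^ 2 = ∑ i, h.eigenvalues i ^ 2 * c i ^ 2 := by
  set b := h.eigenvectorBasis
  set w : E3 := WithLp.toLp 2 (A.mulVec z) with hw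
  have hwi : ∀ i, w i = ∑ k, A i k * z k := fun i => rfl
  have hc : ∀ i, inner ℝ (b i) w = h.eigenvalues i * inner ℝ (b i) z := by
    intro i
    have h1 : A.mulVec (b i) = h.eigenvalues i • (b i : Fin 3 → ℝ) := h.mulVec_eigenvectorBasis i
    have hA : ∀ k l, A k l = A l k := fun k l => by simpa using (h.apply k l).symm
    have h2 : ∀ k, ∑ l, A k l * b i l = h.eigenvalues i * b i k := fun k => congrFun h1 k
    simp only [PiLp.inner_apply, hwi]
    calc ∑ k, inner ℝ (b i k) (∑ l, A k l * z l)
        = ∑ l, z l * ∑ k, A l k * b i k := by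
          simp only [Finset.mul_sum, Finset.sum_mul, RCLike.inner_apply, conj_trivial]
          rw [Finset.sum_comm]
          refine Finset.sum_congr rfl fun l _ => Finset.sum_congr rfl fun k _ => ?_
          rw [hA k l]; ring
      _ = _ := by
          simp only [h2, Finset.mul_sum, RCLike.inner_apply, conj_trivial]
          exact Finset.sum_congr rfl fun l _ => by ring
  refine ⟨fun i => inner ℝ (b i) z, ?_, ?_, ?_⟩
  · rw [← norm_sq_eq_sum, ← b.sum_sq_norm_inner_right z]
    simp
  · have := b.sum_inner_mul_inner z w
    simp only [hc, real_inner_comm] at this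
    rw [PiLp.inner_apply] at this
    simp only [RCLike.inner_apply, conj_trivial, hwi] at this
    rw [Finset.sum_congr rfl fun i _ => mul_comm (z i) _]
    rw [← this]
    refine Finset.sum_congr rfl fun i _ => ?_
    rw [real_inner_comm]; ring
  · simp only [← hwi]
    rw [← norm_sq_eq_sum, ← b.sum_sq_norm_inner_right w]
    refine Finset.sum_congr rfl fun i _ => ?_
    rw [hc]; simp [mul_pow]

lemma spectral_algebra {α l L N q s : ℝ} (hl : 0 < l) (hL : l ≤ L) (hα : (L - l) / l < α)
    (hN : 0 ≤ N) (h1 : l * N ≤ q) (h2 : s ≤ L * q) (h3 : s ≤ (l + L) * q - l * L * N) :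
    ((α + 2) - (l + L) / l) * l ^ 2 / 2 * N
        ≤ (L + ((α + 2) - (l + L) / l) * l / 2) * q - s ∧
      ((α + 2) - (l + L) / l) * l ^ 2 / 2 * N ^ 2
        ≤ (α + 2) * q ^ 2 - N * s - (L + ((α + 2) - (l + L) / l) * l / 2) * (N * q) := by
  obtain ⟨t, ht⟩ : ∃ t, L = t * l := ⟨L / l, by field_simp⟩
  subst ht
  have e1 : (l + t * l) / l = 1 + t := by field_simp
  have e2 : (t * l - l) / l = t - 1 := by field_simp
  rw [e1]
  rw [e2] at hα
  set κ := α + 2 - (1 + t) with hκ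
  have hκ0 : 0 < κ := by linarith
  have hα' : α = κ + (1 + t) - 2 := by rw [hκ]; ring
  have hq : 0 ≤ q := (mul_nonneg hl.le hN).trans h1
  have hd : 0 ≤ q - l * N := by linarith
  refine ⟨?_, ?_⟩
  · nlinarith [mul_nonneg (mul_nonneg hκ0.le hl.le) hd]
  · have h4 : N * s ≤ N * ((l + t * l) * q - l * (t * l) * N) := mul_le_mul_of_nonneg_left h3 hN
    have h5 : 0 ≤ κ * (q * (q - l * N)) := by positivity
    have h6 : 0 ≤ κ * (l * N * (q - l * N)) := by positivity
    have ht : 0 ≤ 1 + t := by nlinarith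
    have h7 : 0 ≤ (1 + t) * (q - l * N) ^ 2 := by positivity
    have h8 : 0 ≤ (l * N) * (q - l * N) := by positivity
    rw [hα']
    nlinarith

theorem spectral_inequality (h : A.IsHermitian) {c0 α : ℝ} (hc0 : 0 < c0)
    (hell : ∀ ξ : Fin 3 → ℝ, c0 * ∑ i, ξ i ^ 2 ≤ ∑ i, ξ i * ∑ k, A i k * ξ k)
    (hα : ∀ i j, (h.eigenvalues i - h.eigenvalues j) / h.eigenvalues j < α) :
    ∃ γ c : ℝ, 0 < c ∧ ∀ z : E3,
      c * ‖z‖ ^ 2 ≤ γ * (∑ i, z i * ∑ k, A i k * z k) - ∑ i, (∑ k, A i k * z k) ^ 2 ∧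
      c * ‖z‖ ^ 4 ≤ (α + 2) * (∑ i, z i * ∑ k, A i k * z k) ^ 2
        - ‖z‖ ^ 2 * (∑ i, (∑ k, A i k * z k) ^ 2)
        - γ * (‖z‖ ^ 2 * ∑ i, z i * ∑ k, A i k * z k) := by
  obtain ⟨i0, hi0⟩ := Finite.exists_min h.eigenvalues
  obtain ⟨i1, hi1⟩ := Finite.exists_max h.eigenvalues
  set l := h.eigenvalues i0
  set L := h.eigenvalues i1
  have hl : 0 < l := by
    have h1 : A.mulVec (h.eigenvectorBasis i0)
      = l • (h.eigenvectorBasis i0 : Fin 3 → ℝ) := h.mulVec_eigenvectorBasis i0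
    have h2 : ∀ k, ∑ j, A k j * h.eigenvectorBasis i0 j = l * h.eigenvectorBasis i0 k :=
      fun k => congrFun h1 k
    have h3 := hell (h.eigenvectorBasis i0)
    simp only [h2] at h3
    have h4 : ∑ i, h.eigenvectorBasis i0 i ^ 2 = 1 := by
      rw [← norm_sq_eq_sum, h.eigenvectorBasis.orthonormal.1 i0]; norm_num
    have h5 : ∑ i, h.eigenvectorBasis i0 i * (l * h.eigenvectorBasis i0 i) = l := by
      conv_rhs => rw [← mul_one l, ← h4, Finset.mul_sum]
      exact Finset.sum_congr rfl fun i _ => by ring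
    rw [h4, h5] at h3
    linarith
  have hLl : 0 < (α + 2) - (l + L) / l := by
    have := hα i1 i0
    have e : (l + L) / l = (L - l) / l + 2 := by field_simp; ring
    rw [e]; linarith
  refine ⟨L + ((α + 2) - (l + L) / l) * l / 2, ((α + 2) - (l + L) / l) * l ^ 2 / 2, by positivity,
    fun z => ?_⟩
  obtain ⟨c, e1, e2, e3⟩ := exists_eigen_coordinates h z
  rw [show ‖z‖ ^ 4 = (‖z‖ ^ 2) ^ 2 by ring, norm_sq_eq_sum, e1, e2, e3]
  refine spectral_algebra hl (hi0 i1) (hα i1 i0) (by positivity) ?_ ?_ ?_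
  · rw [Finset.mul_sum]
    exact Finset.sum_le_sum fun i _ => mul_le_mul_of_nonneg_right (hi0 i) (sq_nonneg _)
  · rw [Finset.mul_sum]
    refine Finset.sum_le_sum fun i _ => ?_
    have := hi1 i
    have h0 : 0 < h.eigenvalues i := hl.trans_le (hi0 i)
    nlinarith [mul_nonneg (mul_nonneg h0.le (sub_nonneg.2 this)) (sq_nonneg (c i))]
  · rw [Finset.mul_sum, Finset.mul_sum, ← Finset.sum_sub_distrib]
    refine Finset.sum_le_sum fun i _ => ?_
    nlinarith [mul_nonneg (mul_nonneg (sub_nonneg.2 (hi0 i)) (sub_nonneg.2 (hi1 i)))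
      (sq_nonneg (c i))]

end Spectral

section LocalPositivity

lemma eventually_forall_homogeneous_pos {Φ : E3 → E3 → ℝ} {d : ℕ} (hd : d ≠ 0) {c : ℝ} (hc : 0 < c)
    (hhom : ∀ p (t : ℝ) u, Φ p (t • u) = t ^ d * Φ p u)
    (hcont : ∀ u, ContinuousAt (fun z : E3 × E3 => Φ z.1 z.2) (0, u))
    (hpos : ∀ u, 2 * c * ‖u‖ ^ d ≤ Φ 0 u) :
    ∀ᶠ p in nhds (0 : E3), ∀ u, c * ‖u‖ ^ d ≤ Φ p u := by
  have h1 : ∀ᶠ p in nhds (0 : E3), ∀ u ∈ sphere (0 : E3) 1, c < Φ p u := by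
    refine (isCompact_sphere (0 : E3) 1).eventually_forall_of_forall_eventually fun u hu => ?_
    refine (hcont u).eventually (lt_mem_nhds ?_)
    have := hpos u
    rw [mem_sphere_zero_iff_norm.1 hu] at this
    simp only [one_pow, mul_one] at this
    change c < Φ 0 u
    linarith
  filter_upwards [h1] with p hp u
  rcases eq_or_ne u 0 with rfl | hu
  · have := hhom p 0 0
    simp only [smul_zero, zero_pow hd, zero_mul] at this
    simp [this, hd]
  · have hn : 0 < ‖u‖ := norm_pos_iff.2 hu
    have h2 := hp (‖u‖⁻¹ • u) (by simp [norm_smul, hn.ne'])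
    have h3 := hhom p ‖u‖ (‖u‖⁻¹ • u)
    rw [smul_smul, mul_inv_cancel₀ hn.ne', one_smul] at h3
    rw [h3, mul_comm c]
    exact mul_le_mul_of_nonneg_left h2.le (by positivity)

variable (a : Fin 3 → Fin 3 → E3 → ℝ)

/-- The vector field `A(x)x`. -/
def coefField (l : Fin 3) (y : E3) : ℝ := ∑ k, a l k y * y k

/-- The quadratic form `⟨A(x)x, x⟩`. -/
def coefForm (y : E3) : ℝ := ∑ l, y l * coefField a l y

/-- The divergence of `A(x)x`. -/
def coefDiv (y : E3) : ℝ := ∑ l, pd l (coefField a l) y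

/-- The zeroth-order correction `tr A - div(Ax) + 2γ` of the conjugated operator. -/
def coefTheta (γ : ℝ) (y : E3) : ℝ := (∑ l, a l l y) - coefDiv a y + 2 * γ

/-- The coefficients of the form in `∇v` produced by the multiplier argument. -/
def gradForm (γ : ℝ) (k l : Fin 3) (x : E3) : ℝ :=
  -2 * (∑ j, a j k x * pd j (coefField a l) x) + 2 * γ * a k l x
    - 2 * (∑ j, pd j (a j k) x) * coefField a l x + ∑ j, coefField a j x * pd j (a k l) x

variable {a} {Ω : Set E3} {x : E3}

lemma sm_coefField (ha : ∀ j k, Sm Ω (a j k)) (l : Fin 3) : Sm Ω (coefField a l) :=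
  ContDiffOn.sum fun k _ => (ha l k).mul (sm_coord k)

lemma sm_coefForm (ha : ∀ j k, Sm Ω (a j k)) : Sm Ω (coefForm a) :=
  ContDiffOn.sum fun l _ => (sm_coord l).mul (sm_coefField ha l)

lemma sm_coefDiv (hΩ : IsOpen Ω) (ha : ∀ j k, Sm Ω (a j k)) : Sm Ω (coefDiv a) :=
  ContDiffOn.sum fun l _ => (sm_coefField ha l).pd hΩ l

lemma sm_coefTheta (hΩ : IsOpen Ω) (ha : ∀ j k, Sm Ω (a j k)) (γ : ℝ) : Sm Ω (coefTheta a γ) :=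
  ((ContDiffOn.sum fun l _ => ha l l).sub (sm_coefDiv hΩ ha)).add contDiffOn_const

lemma pd_coefField (hΩ : IsOpen Ω) (ha : ∀ j k, Sm Ω (a j k)) (hx : x ∈ Ω) (j l : Fin 3) :
    pd j (coefField a l) x = a l j x + ∑ k, pd j (a l k) x * x k := by
  have := (HasGrad.sum (s := univ) fun k =>
    ((ha l k).hasGrad hΩ hx).mul (hasGrad_coord k)).eq j
  refine this.trans ?_
  simp [Finset.sum_add_distrib, add_comm]

lemma pd_coefForm (hΩ : IsOpen Ω) (ha : ∀ j k, Sm Ω (a j k))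
    (hsym : ∀ j k y, a j k y = a k j y) (hx : x ∈ Ω) (l : Fin 3) :
    pd l (coefForm a) x
      = 2 * coefField a l x + ∑ j, ∑ k, pd l (a j k) x * x j * x k := by
  have := (HasGrad.sum (s := univ) fun k =>
    (hasGrad_coord k).mul ((sm_coefField ha k).hasGrad hΩ hx)).eq l
  refine this.trans ?_
  simp only [pd_coefField hΩ ha hx, Finset.sum_add_distrib]
  have h1 : ∑ k, x k * a k l x = coefField a l x := by
    refine Finset.sum_congr rfl fun k _ => ?_
    rw [hsym k l, mul_comm]
  have h2 : ∑ k, (if k = l then 1 else 0) * coefField a k x = coefField a l x := by simp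
  rw [h2]
  simp only [mul_add, Finset.sum_add_distrib, h1]
  have h3 : ∀ j, x j * ∑ k, pd l (a j k) x * x k = ∑ k, pd l (a j k) x * x j * x k := fun j => by
    rw [Finset.mul_sum]; exact Finset.sum_congr rfl fun k _ => by ring
  simp only [h3]
  ring

theorem eventually_local_positivity (hΩ : IsOpen Ω) (h0 : (0 : E3) ∈ Ω)
    (ha : ∀ j k, Sm Ω (a j k)) (hsym : ∀ j k y, a j k y = a k j y) {α γ c : ℝ} (hc : 0 < c)
    (H : ∀ z : E3, c * ‖z‖ ^ 2
        ≤ γ * (∑ i, z i * ∑ k, a i k 0 * z k) - ∑ i, (∑ k, a i k 0 * z k) ^ 2 ∧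
      c * ‖z‖ ^ 4 ≤ (α + 2) * (∑ i, z i * ∑ k, a i k 0 * z k) ^ 2
        - ‖z‖ ^ 2 * (∑ i, (∑ k, a i k 0 * z k) ^ 2)
        - γ * (‖z‖ ^ 2 * ∑ i, z i * ∑ k, a i k 0 * z k)) :
    ∀ᶠ x in nhds (0 : E3),
      (∀ z : E3, c * ‖z‖ ^ 2 ≤ ∑ k, ∑ l, gradForm a γ k l x * (z k * z l)) ∧
      c * ‖x‖ ^ 4 ≤ 2 * (α + 2) * coefForm a x ^ 2
        - ‖x‖ ^ 2 * (∑ l, coefField a l x * pd l (coefForm a) x)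
        - 2 * γ * (‖x‖ ^ 2 * coefForm a x) := by
  have hnhds := hΩ.mem_nhds h0
  have hcont : ∀ {f : E3 → ℝ}, Sm Ω f → ∀ u : E3,
      ContinuousAt (fun z : E3 × E3 => f z.1) (0, u) := fun hf u =>
    ContinuousAt.comp (x := ((0, u) : E3 × E3)) (f := Prod.fst) (hf.continuousOn.continuousAt hnhds)
      continuousAt_fst
  have hcoord : ∀ (k : Fin 3) (u : E3), ContinuousAt (fun z : E3 × E3 => z.2 k) (0, u) :=
    fun k u => by fun_prop
  have hcoord' : ∀ (k : Fin 3) (u : E3), ContinuousAt (fun z : E3 × E3 => z.1 k) (0, u) :=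
    fun k u => by fun_prop
  have hB : ∀ k l, Sm Ω (gradForm a γ k l) := fun k l =>
    (((contDiffOn_const.mul (ContDiffOn.sum fun j _ => (ha j k).mul
      ((sm_coefField ha l).pd hΩ j))).add (contDiffOn_const.mul (ha k l))).sub
      ((contDiffOn_const.mul (ContDiffOn.sum fun j _ => (ha j k).pd hΩ j)).mul
        (sm_coefField ha l))).add
      (ContDiffOn.sum fun j _ => (sm_coefField ha j).mul ((ha k l).pd hΩ j))
  have hY0 : ∀ l, coefField a l 0 = 0 := fun l => by simp [coefField]
  have h1 := eventually_forall_homogeneous_pos (d := 2) two_ne_zero hc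
    (Φ := fun p u => ∑ k, ∑ l, gradForm a γ k l p * (u k * u l))
    (fun p t u => by
      simp only [Finset.mul_sum]
      refine Finset.sum_congr rfl fun k _ => Finset.sum_congr rfl fun l _ => ?_
      simp; ring)
    (fun u => tendsto_finsetSum _ fun k _ => tendsto_finsetSum _ fun l _ =>
      (hcont (hB k l) u).mul ((hcoord k u).mul (hcoord l u)))
    (fun u => by
      have h := (H u).1
      simp only [gradForm, hY0, pd_coefField hΩ ha h0]
      refine le_trans (by linarith : _ ≤ 2 * (γ * (∑ i, u i * ∑ k, a i k 0 * u k)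
        - ∑ i, (∑ k, a i k 0 * u k) ^ 2)) (le_of_eq ?_)
      have e1 := hsym 1 0 0
      have e2 := hsym 2 0 0
      have e3 := hsym 2 1 0
      simp only [Fin.sum_univ_three, e1, e2, e3, PiLp.zero_apply]
      ring)
  have h2 := eventually_forall_homogeneous_pos (d := 4) four_ne_zero hc
    (Φ := fun p u => 2 * (α + 2) * (∑ i, u i * ∑ k, a i k p * u k) ^ 2
      - (∑ i, u i ^ 2) * (∑ l, (∑ k, a l k p * u k) * (2 * (∑ k, a l k p * u k)
        + ∑ j, ∑ k, pd l (a j k) p * p j * u k))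
      - 2 * γ * ((∑ i, u i ^ 2) * ∑ i, u i * ∑ k, a i k p * u k))
    (fun p t u => by
      have e1 : ∀ l, ∑ k, a l k p * (t • u) k = t * ∑ k, a l k p * u k := fun l => by
        rw [Finset.mul_sum]; exact Finset.sum_congr rfl fun k _ => by simp; ring
      have e2 : ∀ l, ∑ j, ∑ k, pd l (a j k) p * p j * (t • u) k
          = t * ∑ j, ∑ k, pd l (a j k) p * p j * u k := fun l => by
        simp only [Finset.mul_sum]
        exact Finset.sum_congr rfl fun j _ => Finset.sum_congr rfl fun k _ => by simp; ring
      have e3 : ∑ i, (t • u) i ^ 2 = t ^ 2 * ∑ i, u i ^ 2 := by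
        rw [Finset.mul_sum]; exact Finset.sum_congr rfl fun k _ => by simp; ring
      simp only [e1, e2, e3]
      simp only [Fin.sum_univ_three, PiLp.smul_apply, smul_eq_mul]
      ring)
    (fun u => by
      have hY : ∀ l, ContinuousAt (fun z : E3 × E3 => ∑ k, a l k z.1 * z.2 k) (0, u) := fun l =>
        tendsto_finsetSum _ fun k _ => (hcont (ha l k) u).mul (hcoord k u)
      have hQ : ContinuousAt (fun z : E3 × E3 => ∑ l, z.2 l * ∑ k, a l k z.1 * z.2 k) (0, u) :=
        tendsto_finsetSum _ fun l _ => (hcoord l u).mul (hY l)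
      have hN : ContinuousAt (fun z : E3 × E3 => ∑ l, z.2 l ^ 2) (0, u) :=
        tendsto_finsetSum _ fun l _ => (hcoord l u).pow 2
      have hD : ∀ l, ContinuousAt
          (fun z : E3 × E3 => ∑ j, ∑ k, pd l (a j k) z.1 * z.1 j * z.2 k) (0, u) := fun l =>
        tendsto_finsetSum _ fun j _ => tendsto_finsetSum _ fun k _ =>
          ((hcont ((ha j k).pd hΩ l) u).mul (hcoord' j u)).mul (hcoord k u)
      have hS : ContinuousAt (fun z : E3 × E3 => ∑ l, (∑ k, a l k z.1 * z.2 k)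
          * (2 * (∑ k, a l k z.1 * z.2 k) + ∑ j, ∑ k, pd l (a j k) z.1 * z.1 j * z.2 k)) (0, u) :=
        tendsto_finsetSum _ fun l _ => (hY l).mul ((continuousAt_const.mul (hY l)).add (hD l))
      exact ((continuousAt_const.mul (hQ.pow 2)).sub (hN.mul hS)).sub
        (continuousAt_const.mul (hN.mul hQ)))
    (fun u => by
      have h := (H u).2
      rw [norm_sq_eq_sum] at h
      refine le_trans (by linarith : _ ≤ 2 * ((α + 2) * (∑ i, u i * ∑ k, a i k 0 * u k) ^ 2
        - (∑ i, u i ^ 2) * (∑ i, (∑ k, a i k 0 * u k) ^ 2)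
        - γ * ((∑ i, u i ^ 2) * ∑ i, u i * ∑ k, a i k 0 * u k))) (le_of_eq ?_)
      have e : ∀ l, (∑ k, a l k 0 * u k) * (2 * (∑ k, a l k 0 * u k)
        + ∑ j, ∑ k, pd l (a j k) 0 * (0 : E3) j * u k) = 2 * (∑ k, a l k 0 * u k) ^ 2 := fun l => by
        simp; ring
      simp only [e, ← Finset.mul_sum]
      ring)
  filter_upwards [h1, h2, hnhds] with x hx1 hx2 hx
  refine ⟨hx1, (hx2 x).trans (le_of_eq ?_)⟩
  simp only [pd_coefForm hΩ ha hsym hx, norm_sq_eq_sum]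
  rfl

end LocalPositivity

section Conjugation

variable {a : Fin 3 → Fin 3 → E3 → ℝ} {U : Set E3} {x : E3} {W m n f : E3 → ℝ} {p γ : ℝ}

variable (a) in
/-- The zeroth-order coefficient of the skew part of the conjugated operator. -/
def skewCoef (m n : E3 → ℝ) (γ : ℝ) (y : E3) : ℝ :=
  n y * coefForm a y - m y * coefDiv a y + 2 * γ * m y

variable (a) in
/-- The zeroth-order coefficient of the symmetric part of the conjugated operator. -/
def symmCoef (m : E3 → ℝ) (γ : ℝ) (y : E3) : ℝ :=
  m y * m y * coefForm a y + m y * coefTheta a γ y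

lemma pd_weight_mul (hU : IsOpen U) (hW : ∀ y ∈ U, HasGrad W (fun j => -(m y * y j) * W y) y)
    (hf : Sm U f) (k : Fin 3) :
    Set.EqOn (pd k fun y => W y * f y)
      (fun y => W y * pd k f y - m y * y k * (W y * f y)) U := fun y hy => by
  rw [((hW y hy).mul (hf.hasGrad hU hy)).eq k]
  ring

lemma weight_mul_op2 (hU : IsOpen U) (hx : x ∈ U)
    (hsym : ∀ j k y, a j k y = a k j y)
    (hW : ∀ y ∈ U, HasGrad W (fun j => -(m y * y j) * W y) y)
    (hm : HasGrad m (fun j => -(n x * x j)) x) (hf : Sm U f) :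
    W x * op2 a f x
      = (∑ j, ∑ k, a j k x * pd j (pd k fun y => W y * f y) x
          + symmCoef a m γ x * (W x * f x))
        + (2 * m x * ∑ l, coefField a l x * pd l (fun y => W y * f y) x
          - skewCoef a m n γ x * (W x * f x)) := by
  have hf' := hf.hasGrad hU hx
  have hv := (hW x hx).mul hf'
  have h1 := fun k => pd_weight_mul hU hW hf k hx
  have h2 : ∀ k, HasGrad (pd k fun y => W y * f y) _ x := fun k =>
    (((hW x hx).mul ((hf.pd hU k).hasGrad hU hx)).sub
      ((hm.mul (hasGrad_coord k)).mul hv)).congr_on hU hx (pd_weight_mul hU hW hf k)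
  simp only [h1, fun j k => (h2 k).eq j]
  have e1 : a 1 0 = a 0 1 := funext fun y => hsym 1 0 y
  have e2 : a 2 0 = a 0 2 := funext fun y => hsym 2 0 y
  have e3 : a 2 1 = a 1 2 := funext fun y => hsym 2 1 y
  simp only [op2, skewCoef, symmCoef, coefTheta, coefForm, coefField, Fin.sum_univ_three, e1, e2,
    e3]
  norm_num [Fin.ext_iff]
  ring

/-- The vector field whose divergence appears in the multiplier identity. -/
def carlemanFlux (a : Fin 3 → Fin 3 → E3 → ℝ) (m n : E3 → ℝ) (γ : ℝ) (v : E3 → ℝ) (j : Fin 3)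
    (y : E3) : ℝ :=
  (-2 * ((∑ k, a j k y * pd k v y) * ∑ l, -(m y * coefField a l y) * pd l v y)
      + -(m y * coefField a j y) * ∑ k, ∑ l, a k l y * (pd k v y * pd l v y))
    - (skewCoef a m n γ y * v y * (∑ k, a j k y * pd k v y)
      + symmCoef a m γ y * -(m y * coefField a j y) * (v y * v y))

lemma sm_skewCoef (hU : IsOpen U) (ha : ∀ j k, Sm U (a j k)) (hm : Sm U m) (hn : Sm U n) :
    Sm U (skewCoef a m n γ) :=
  ((hn.mul (sm_coefForm ha)).sub (hm.mul (sm_coefDiv hU ha))).add (contDiffOn_const.mul hm)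

lemma sm_symmCoef (hU : IsOpen U) (ha : ∀ j k, Sm U (a j k)) (hm : Sm U m) :
    Sm U (symmCoef a m γ) :=
  ((hm.mul hm).mul (sm_coefForm ha)).add (hm.mul (sm_coefTheta hU ha γ))

lemma sm_carlemanFlux (hU : IsOpen U) (ha : ∀ j k, Sm U (a j k)) (hm : Sm U m) (hn : Sm U n)
    {v : E3 → ℝ} (hv : Sm U v) (j : Fin 3) : Sm U (carlemanFlux a m n γ v j) := by
  have hY := fun l => (hm.mul (sm_coefField ha l)).neg
  have hP : Sm U fun y => ∑ k, a j k y * pd k v y :=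
    ContDiffOn.sum fun k _ => (ha j k).mul (hv.pd hU k)
  exact ((contDiffOn_const.mul (hP.mul (ContDiffOn.sum fun l _ => (hY l).mul (hv.pd hU l)))).add
    ((hY j).mul (ContDiffOn.sum fun k _ => ContDiffOn.sum fun l _ =>
      (ha k l).mul ((hv.pd hU k).mul (hv.pd hU l))))).sub
    ((((sm_skewCoef hU ha hm hn).mul hv).mul hP).add
      (((sm_symmCoef hU ha hm).mul (hY j)).mul (hv.mul hv)))

lemma carlemanFlux_eq_zero {v : E3 → ℝ} (h : v x = 0) (h' : ∀ k, pd k v x = 0) (j : Fin 3) :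
    carlemanFlux a m n γ v j x = 0 := by
  simp [carlemanFlux, h, h']

lemma conjugated_identity (hU : IsOpen U) (hx : x ∈ U) (hsym : ∀ j k y, a j k y = a k j y)
    (ha : ∀ j k, Sm U (a j k)) (hm : Sm U m) (hn : Sm U n)
    (hm' : HasGrad m (fun j => -(n x * x j)) x) (hn' : HasGrad n (fun j => -(p * x j)) x)
    {v : E3 → ℝ} (hv : Sm U v) :
    (∑ j, ∑ k, a j k x * pd j (pd k v) x + symmCoef a m γ x * v x)
        * (2 * m x * ∑ l, coefField a l x * pd l v x - skewCoef a m n γ x * v x)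
      = ∑ j, pd j (carlemanFlux a m n γ v j) x
        + (2 * n x * (∑ l, coefField a l x * pd l v x) ^ 2
          + m x * (∑ k, ∑ l, gradForm a γ k l x * (pd k v x * pd l v x))
          + (∑ j, ∑ k, ((-(p * x j) * coefForm a x + n x * pd j (coefForm a) x
              + n x * x j * coefDiv a x - m x * pd j (coefDiv a) x - 2 * γ * (n x * x j)) * a j k x
              + skewCoef a m n γ x * pd j (a j k) x) * pd k v x) * v x
          + (2 * m x ^ 2 * n x * coefForm a x ^ 2
              - m x ^ 3 * (∑ l, coefField a l x * pd l (coefForm a) x)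
              + m x * n x * coefForm a x * coefTheta a γ x
              - m x ^ 2 * (∑ l, coefField a l x * pd l (coefTheta a γ) x)
              - 2 * γ * m x ^ 3 * coefForm a x - 2 * γ * m x ^ 2 * coefTheta a γ x) * v x ^ 2) := by
  have hM : ∀ l, Sm U fun y => -(m y * coefField a l y) := fun l =>
    (hm.mul (sm_coefField ha l)).neg
  have key := multiplier_identity hU hx hsym ha hM (sm_skewCoef (γ := γ) hU ha hm hn)
    (sm_symmCoef (γ := γ) hU ha hm) hv
  have hq := (sm_coefForm ha).hasGrad hU hx
  have hd := (sm_coefDiv hU ha).hasGrad hU hx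
  have hθ := (sm_coefTheta hU ha γ).hasGrad hU hx
  have hY := fun l => (sm_coefField ha l).hasGrad hU hx
  have dM : ∀ j l, pd j (fun y => -(m y * coefField a l y)) x
      = n x * x j * coefField a l x - m x * pd j (coefField a l) x := fun j l => by
    have h := ((hm'.mul (hY l)).const_mul (-1)).eq j
    simp only [neg_one_mul] at h
    rw [h]; ring
  have dg : ∀ j, pd j (skewCoef a m n γ) x
      = -(p * x j) * coefForm a x + n x * pd j (coefForm a) x
        + n x * x j * coefDiv a x - m x * pd j (coefDiv a) x - 2 * γ * (n x * x j) := fun j => by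
    have h := (((hn'.mul hq).sub (hm'.mul hd)).add (hm'.const_mul (2 * γ))).eq j
    refine h.trans ?_
    ring
  have dE : ∀ j, pd j (symmCoef a m γ) x
      = -2 * m x * n x * x j * coefForm a x + m x ^ 2 * pd j (coefForm a) x
        - n x * x j * coefTheta a γ x + m x * pd j (coefTheta a γ) x := fun j => by
    have h := (((hm'.mul hm').mul hq).add (hm'.mul hθ)).eq j
    refine h.trans ?_
    ring
  have hqx : ∑ l, x l * coefField a l x = coefForm a x := rfl
  have hdx : ∑ l, pd l (coefField a l) x = coefDiv a x := rfl
  have hdiv : ∑ l, pd l (fun y => -(m y * coefField a l y)) x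
      = n x * coefForm a x - m x * coefDiv a x := by
    simp only [dM, Finset.sum_sub_distrib, mul_assoc, ← Finset.mul_sum, hqx, hdx]
  rw [hdiv] at key
  have hT : -2 * ∑ l, -(m x * coefField a l x) * pd l v x
      = 2 * m x * ∑ l, coefField a l x * pd l v x := by
    simp only [Fin.sum_univ_three]; ring
  rw [hT] at key
  rw [key]
  have hg : skewCoef a m n γ x - (n x * coefForm a x - m x * coefDiv a x) = 2 * γ * m x := by
    unfold skewCoef; ring
  rw [hg]
  have hEpart : ∑ l, -(m x * coefField a l x) * pd l (symmCoef a m γ) x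
        + symmCoef a m γ x * (n x * coefForm a x - m x * coefDiv a x)
        - skewCoef a m n γ x * symmCoef a m γ x
      = 2 * m x ^ 2 * n x * coefForm a x ^ 2
              - m x ^ 3 * (∑ l, coefField a l x * pd l (coefForm a) x)
              + m x * n x * coefForm a x * coefTheta a γ x
              - m x ^ 2 * (∑ l, coefField a l x * pd l (coefTheta a γ) x)
              - 2 * γ * m x ^ 3 * coefForm a x - 2 * γ * m x ^ 2 * coefTheta a γ x := by
    simp only [dE]
    rw [← sub_eq_zero, sub_eq_add_neg]
    have h3 : skewCoef a m n γ x = (n x * coefForm a x - m x * coefDiv a x) + 2 * γ * m x := rfl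
    rw [h3]
    unfold symmCoef
    have h4 : coefForm a x = x 0 * coefField a 0 x + x 1 * coefField a 1 x
        + x 2 * coefField a 2 x := by rw [← hqx, Fin.sum_univ_three]
    simp only [Fin.sum_univ_three]
    linear_combination (-2 * m x ^ 2 * n x * coefForm a x - m x * n x * coefTheta a γ x) * h4
  rw [hEpart]
  simp only [dg, dM]
  have e1 : a 1 0 = a 0 1 := funext fun y => hsym 1 0 y
  have e2 : a 2 0 = a 0 2 := funext fun y => hsym 2 0 y
  have e3 : a 2 1 = a 1 2 := funext fun y => hsym 2 1 y
  have hgrad : 2 * (∑ j, ∑ k, ∑ l, a j k x * (n x * x j * coefField a l x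
          - m x * pd j (coefField a l) x) * (pd k v x * pd l v x))
        + 2 * γ * m x * (∑ k, ∑ l, a k l x * (pd k v x * pd l v x))
        + 2 * (∑ j, ∑ k, ∑ l, pd j (a j k) x * -(m x * coefField a l x) * (pd k v x * pd l v x))
        - (∑ j, ∑ k, ∑ l, -(m x * coefField a l x) * pd l (a j k) x * (pd j v x * pd k v x))
      = 2 * n x * (∑ l, coefField a l x * pd l v x) ^ 2
          + m x * (∑ k, ∑ l, gradForm a γ k l x * (pd k v x * pd l v x)) := by
    have h5 : ∀ l, coefField a l x = a l 0 x * x 0 + a l 1 x * x 1 + a l 2 x * x 2 := fun l => by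
      simp only [coefField, Fin.sum_univ_three]
    have h6 : ∑ l, coefField a l x * pd l v x = ∑ j, ∑ k, a j k x * x j * pd k v x := by
      simp only [h5, Fin.sum_univ_three, e1, e2, e3]; ring
    rw [sq, mul_assoc, mul_assoc]
    nth_rewrite 1 [h6]
    simp only [gradForm, Fin.sum_univ_three]
    ring
  rw [hgrad]
  rfl

end Conjugation

section PointwiseBound

lemma zeroth_order_bound {α γ c K ρ s M N q S θ T : ℝ} (hα : 0 < α) (hK : 0 ≤ K)
    (hρ : 0 < ρ) (hM : 0 < M) (hN : N * ρ = (α + 2) * M + α * s / ρ)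
    (hN0 : 0 ≤ N) (hNK : N * ρ ≤ K * M) (hs : |s| ≤ K) (hq : |q| ≤ K * ρ) (hθ : |θ| ≤ K)
    (hT : |T| ≤ K) (h : c * ρ ^ 2 ≤ 2 * (α + 2) * q ^ 2 - ρ * S - 2 * γ * (ρ * q)) :
    c * M ^ 3 * ρ - (2 * α * K ^ 3 + K ^ 3 + K + 2 * |γ| * K) * M ^ 2
      ≤ 2 * M ^ 2 * N * q ^ 2 - M ^ 3 * S + M * N * q * θ - M ^ 2 * T - 2 * γ * M ^ 3 * q
        - 2 * γ * M ^ 2 * θ := by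
  have h1 : -(K * K ^ 2 * ρ) ≤ s * q ^ 2 / ρ := by
    have : |s * q ^ 2 / ρ| ≤ K * (K * ρ) ^ 2 / ρ := by
      rw [abs_div, abs_mul, abs_pow, abs_of_pos hρ]
      gcongr
    have e : K * (K * ρ) ^ 2 / ρ = K * K ^ 2 * ρ := by field_simp
    rw [e] at this
    exact (abs_le.1 this).1
  have h2 : -(K * M * (K * K)) ≤ N * q * θ := by
    have : |N * q * θ| ≤ N * (K * ρ) * K := by
      rw [abs_mul, abs_mul, abs_of_nonneg hN0]
      gcongr
    have h3 : N * (K * ρ) * K ≤ K * M * (K * K) := by nlinarith [mul_nonneg hK hK]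
    linarith [(abs_le.1 this).1]
  have h3 : γ * θ ≤ |γ| * K := by
    have : |γ * θ| ≤ |γ| * K := by rw [abs_mul]; gcongr
    exact (le_abs_self _).trans this
  have h4 := (abs_le.1 hT).2
  refine le_of_mul_le_mul_left ?_ hρ
  have e : ρ * (2 * M ^ 2 * N * q ^ 2 - M ^ 3 * S + M * N * q * θ - M ^ 2 * T - 2 * γ * M ^ 3 * q
        - 2 * γ * M ^ 2 * θ)
      = M ^ 3 * (2 * (α + 2) * q ^ 2 - ρ * S - 2 * γ * (ρ * q)) + 2 * α * M ^ 2 * (s * q ^ 2 / ρ)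
        + ρ * (M * (N * q * θ)) - ρ * M ^ 2 * T - 2 * ρ * M ^ 2 * (γ * θ) := by
    linear_combination (2 * M ^ 2 * q ^ 2) * hN
  rw [e]
  have g1 := mul_le_mul_of_nonneg_left h (by positivity : 0 ≤ M ^ 3)
  have g2 := mul_le_mul_of_nonneg_left h1 (by positivity : 0 ≤ 2 * α * M ^ 2)
  have g3 := mul_le_mul_of_nonneg_left h2 (by positivity : 0 ≤ ρ * M)
  have g4 := mul_le_mul_of_nonneg_left h4 (by positivity : 0 ≤ ρ * M ^ 2)
  have g5 := mul_le_mul_of_nonneg_left h3 (by positivity : 0 ≤ 2 * ρ * M ^ 2)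
  linarith

lemma cross_term_bound {c L M r v : ℝ} (hc : 0 < c) (hM : 0 < M) (hr : 0 < r)
    {D : Fin 3 → Fin 3 → ℝ} (hD : ∀ j k, |D j k| ≤ L * (M / r)) (w : Fin 3 → ℝ) :
    -(c / 2 * M * ∑ k, w k ^ 2 + 27 * L ^ 2 / (2 * c) * (M / r ^ 2) * v ^ 2)
      ≤ (∑ j, ∑ k, D j k * w k) * v := by
  have h1 : ∀ j k, -(c / 6 * M * w k ^ 2 + 3 * L ^ 2 / (2 * c) * (M / r ^ 2) * v ^ 2)
      ≤ D j k * w k * v := fun j k => by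
    have h2 : |D j k * w k * v| ≤ L * (M / r) * |w k| * |v| := by
      rw [abs_mul, abs_mul]
      have := hD j k
      gcongr
    have h3 : c / 6 * M * w k ^ 2 + 3 * L ^ 2 / (2 * c) * (M / r ^ 2) * v ^ 2
        - L * (M / r) * |w k| * |v| = c / 6 * M * (|w k| - 3 * L / (c * r) * |v|) ^ 2 := by
      rw [← sq_abs (w k), ← sq_abs v]
      field_simp
      ring
    have h4 : 0 ≤ c / 6 * M * (|w k| - 3 * L / (c * r) * |v|) ^ 2 := by positivity
    linarith [(abs_le.1 h2).1]
  have h5 : ∑ j : Fin 3, ∑ k, -(c / 6 * M * w k ^ 2 + 3 * L ^ 2 / (2 * c) * (M / r ^ 2) * v ^ 2)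
      ≤ ∑ j, ∑ k, D j k * w k * v :=
    Finset.sum_le_sum fun j _ => Finset.sum_le_sum fun k _ => h1 j k
  simp only [Finset.sum_mul]
  refine le_trans (le_of_eq ?_) h5
  simp only [Fin.sum_univ_three]
  field_simp
  ring

/-- Bounds for the coefficients and the quantities built from them at a point. -/
structure CoefBounds (a : Fin 3 → Fin 3 → E3 → ℝ) (γ K : ℝ) (x : E3) : Prop where
  coef : ∀ j k, |a j k x| ≤ K
  dcoef : ∀ i j k, |pd i (a j k) x| ≤ K
  div : |coefDiv a x| ≤ K
  ddiv : ∀ i, |pd i (coefDiv a) x| ≤ K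
  theta : |coefTheta a γ x| ≤ K
  fieldTheta : |∑ l, coefField a l x * pd l (coefTheta a γ) x| ≤ K
  form : |coefForm a x| ≤ K * ‖x‖ ^ 2
  dform : ∀ l, |pd l (coefForm a) x| ≤ K * ‖x‖

lemma abs_coord_le (x : E3) (k : Fin 3) : |x k| ≤ ‖x‖ := by
  simpa using PiLp.norm_apply_le x k

lemma exists_family_bound {ι : Type*} [Fintype ι] {Ω B : Set E3} (hB : IsCompact B) (hBΩ : B ⊆ Ω)
    {F : ι → E3 → ℝ} (hF : ∀ i, Sm Ω (F i)) : ∃ K, 0 ≤ K ∧ ∀ i, ∀ x ∈ B, |F i x| ≤ K := by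
  choose C hC using fun i => hB.exists_bound_of_continuousOn ((hF i).continuousOn.mono hBΩ)
  refine ⟨∑ i, |C i|, Finset.sum_nonneg fun i _ => abs_nonneg _, fun i x hx => ?_⟩
  exact ((hC i x hx).trans (le_abs_self _)).trans
    (Finset.single_le_sum (f := fun i => |C i|) (fun i _ => abs_nonneg _) (Finset.mem_univ i))

lemma exists_coefBounds {Ω B : Set E3} (hΩ : IsOpen Ω) (hB : IsCompact B) (hBΩ : B ⊆ Ω)
    (hB1 : ∀ x ∈ B, ‖x‖ ≤ 1) {a : Fin 3 → Fin 3 → E3 → ℝ} (ha : ∀ j k, Sm Ω (a j k))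
    (hsym : ∀ j k y, a j k y = a k j y) (γ K0 : ℝ) :
    ∃ K ≥ K0, 1 ≤ K ∧ ∀ x ∈ B, CoefBounds a γ K x := by
  obtain ⟨K1, h10, h1⟩ := exists_family_bound hB hBΩ (F := fun i : Fin 3 × Fin 3 => a i.1 i.2)
    fun i => ha _ _
  obtain ⟨K2, h20, h2⟩ := exists_family_bound hB hBΩ
    (F := fun i : Fin 3 × Fin 3 × Fin 3 => pd i.1 (a i.2.1 i.2.2)) fun i => (ha _ _).pd hΩ _
  obtain ⟨K3, h30, h3⟩ := exists_family_bound hB hBΩ (F := fun _ : Fin 1 => coefDiv a)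
    fun _ => sm_coefDiv hΩ ha
  obtain ⟨K4, h40, h4⟩ := exists_family_bound hB hBΩ (F := fun i : Fin 3 => pd i (coefDiv a))
    fun i => (sm_coefDiv hΩ ha).pd hΩ i
  obtain ⟨K5, h50, h5⟩ := exists_family_bound hB hBΩ (F := fun _ : Fin 1 => coefTheta a γ)
    fun _ => sm_coefTheta hΩ ha γ
  obtain ⟨K6, h60, h6⟩ := exists_family_bound hB hBΩ
    (F := fun _ : Fin 1 => fun x => ∑ l, coefField a l x * pd l (coefTheta a γ) x)
    fun _ => ContDiffOn.sum fun l _ => (sm_coefField ha l).mul ((sm_coefTheta hΩ ha γ).pd hΩ l)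
  have hY : ∀ x ∈ B, ∀ l, |coefField a l x| ≤ 3 * K1 * ‖x‖ := fun x hx l => by
    refine (Finset.abs_sum_le_sum_abs _ _).trans ?_
    refine (Finset.sum_le_sum (g := fun _ : Fin 3 => K1 * ‖x‖) fun k _ => ?_).trans ?_
    · rw [abs_mul]
      exact mul_le_mul (h1 (l, k) x hx) (abs_coord_le x k) (abs_nonneg _) h10
    · simp; linarith
  refine ⟨|K0| + 1 + 9 * K1 + 9 * K2 + K3 + K4 + K5 + K6, ?_, ?_, fun x hx => ⟨?_, ?_, ?_, ?_, ?_,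
    ?_, ?_, ?_⟩⟩
  · have := le_abs_self K0; show K0 ≤ _; linarith
  · have := abs_nonneg K0; linarith
  · intro j k; have := h1 (j, k) x hx; have := abs_nonneg K0; dsimp at *; linarith
  · intro i j k; have := h2 (i, j, k) x hx; have := abs_nonneg K0; dsimp at *; linarith
  · have := h3 0 x hx; have := abs_nonneg K0; linarith
  · intro i; have := h4 i x hx; have := abs_nonneg K0; linarith
  · have := h5 0 x hx; have := abs_nonneg K0; linarith
  · have := h6 0 x hx; have := abs_nonneg K0; linarith
  · have : |coefForm a x| ≤ 9 * K1 * ‖x‖ ^ 2 := by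
      refine (Finset.abs_sum_le_sum_abs _ _).trans ?_
      refine (Finset.sum_le_sum (g := fun _ : Fin 3 => ‖x‖ * (3 * K1 * ‖x‖)) fun k _ => ?_).trans ?_
      · rw [abs_mul]
        exact mul_le_mul (abs_coord_le x k) (hY x hx k) (abs_nonneg _) (norm_nonneg _)
      · simp; apply le_of_eq; ring
    refine this.trans (mul_le_mul_of_nonneg_right ?_ (sq_nonneg _))
    have := abs_nonneg K0; linarith
  · intro l
    rw [pd_coefForm hΩ ha hsym (hBΩ hx)]
    have g1 : |∑ j, ∑ k, pd l (a j k) x * x j * x k| ≤ 9 * K2 * ‖x‖ := by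
      refine (Finset.abs_sum_le_sum_abs _ _).trans ?_
      refine (Finset.sum_le_sum (g := fun _ : Fin 3 => 3 * (K2 * ‖x‖)) fun j _ => ?_).trans ?_
      · refine (Finset.abs_sum_le_sum_abs _ _).trans ?_
        refine (Finset.sum_le_sum (g := fun _ : Fin 3 => K2 * ‖x‖) fun k _ => ?_).trans ?_
        · rw [abs_mul, abs_mul]
          have g2 := abs_coord_le x j
          have g3 := (abs_coord_le x k).trans (hB1 x hx)
          have g4 := h2 (l, j, k) x hx
          calc |pd l (a j k) x| * |x j| * |x k| ≤ K2 * ‖x‖ * 1 := by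
                refine mul_le_mul (mul_le_mul g4 g2 (abs_nonneg _) h20) g3 (abs_nonneg _) ?_
                positivity
            _ = _ := mul_one _
        · simp
      · simp; apply le_of_eq; ring
    have g2 : |2 * coefField a l x| ≤ 6 * K1 * ‖x‖ := by
      rw [abs_mul, abs_two]; linarith [hY x hx l]
    refine (abs_add_le _ _).trans ((add_le_add g2 g1).trans ?_)
    rw [← add_mul]
    refine mul_le_mul_of_nonneg_right ?_ (norm_nonneg _)
    have := abs_nonneg K0; linarith

end PointwiseBound

section LowerBound

variable {a : Fin 3 → Fin 3 → E3 → ℝ} {γ K : ℝ} {x : E3}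

lemma abs_cross_coef_le (hx : x ≠ 0) (hx1 : ‖x‖ ≤ 1) (hK : 1 ≤ K) (hb : CoefBounds a γ K x)
    {m n : E3 → ℝ} {p : ℝ} (hM : 0 < m x) (hN0 : 0 ≤ n x) (hNK : n x * ‖x‖ ^ 2 ≤ K * m x)
    (hp : |p| * ‖x‖ ^ 4 ≤ K * m x) (j k : Fin 3) :
    |(-(p * x j) * coefForm a x + n x * pd j (coefForm a) x
              + n x * x j * coefDiv a x - m x * pd j (coefDiv a) x - 2 * γ * (n x * x j)) * a j k x
              + skewCoef a m n γ x * pd j (a j k) x|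
      ≤ ((3 * K ^ 2 + K + 2 * |γ| * K) * K + (K ^ 2 + K + 2 * |γ|) * K) * (m x / ‖x‖) := by
  have hr : 0 < ‖x‖ := norm_pos_iff.2 hx
  set r := ‖x‖ with hrdef
  have hK0 : 0 ≤ K := by linarith
  have hxj := abs_coord_le x j
  have hMr : m x ≤ m x / r := by rw [le_div_iff₀ hr]; nlinarith
  have hNr : n x * r ≤ K * (m x / r) := by
    rw [← mul_div_assoc, le_div_iff₀ hr]; nlinarith
  have hpr : |p| * r ^ 3 ≤ K * (m x / r) := by
    rw [← mul_div_assoc, le_div_iff₀ hr]; nlinarith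
  have t1 : |(-(p * x j) * coefForm a x)| ≤ K ^ 2 * (m x / r) := by
    rw [abs_mul, abs_neg, abs_mul]
    calc |p| * |x j| * |coefForm a x| ≤ |p| * r * (K * r ^ 2) := by
          have := hb.form; gcongr
      _ = K * (|p| * r ^ 3) := by ring
      _ ≤ K * (K * (m x / r)) := by gcongr
      _ = _ := by ring
  have t2 : |n x * pd j (coefForm a) x| ≤ K ^ 2 * (m x / r) := by
    rw [abs_mul, abs_of_nonneg hN0]
    calc n x * |pd j (coefForm a) x| ≤ n x * (K * r) := by
          have := hb.dform j; gcongr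
      _ = K * (n x * r) := by ring
      _ ≤ K * (K * (m x / r)) := by gcongr
      _ = _ := by ring
  have t0 : |n x * x j| ≤ K * (m x / r) := by
    rw [abs_mul, abs_of_nonneg hN0]
    exact (mul_le_mul_of_nonneg_left hxj hN0).trans hNr
  have t3 : |n x * x j * coefDiv a x| ≤ K ^ 2 * (m x / r) := by
    rw [abs_mul]
    calc _ ≤ K * (m x / r) * K := by have := hb.div; gcongr
      _ = _ := by ring
  have t4 : |m x * pd j (coefDiv a) x| ≤ K * (m x / r) := by
    rw [abs_mul, abs_of_pos hM]
    calc _ ≤ m x / r * K := by have := hb.ddiv j; gcongr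
      _ = _ := by ring
  have t5 : |2 * γ * (n x * x j)| ≤ 2 * |γ| * K * (m x / r) := by
    rw [abs_mul, abs_mul, abs_two]
    calc _ ≤ 2 * |γ| * (K * (m x / r)) := by gcongr
      _ = _ := by ring
  have hdg : |(-(p * x j) * coefForm a x + n x * pd j (coefForm a) x
      + n x * x j * coefDiv a x - m x * pd j (coefDiv a) x - 2 * γ * (n x * x j))|
      ≤ (3 * K ^ 2 + K + 2 * |γ| * K) * (m x / r) := by
    rw [abs_le] at *
    constructor <;> linarith
  have u1 : |n x * coefForm a x| ≤ K ^ 2 * (m x / r) := by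
    rw [abs_mul, abs_of_nonneg hN0]
    calc n x * |coefForm a x| ≤ n x * (K * r ^ 2) := by have := hb.form; gcongr
      _ = K * (n x * r ^ 2) := by ring
      _ ≤ K * (K * (m x / r)) :=
          mul_le_mul_of_nonneg_left (hNK.trans (mul_le_mul_of_nonneg_left hMr hK0)) hK0
      _ = _ := by ring
  have u2 : |m x * coefDiv a x| ≤ K * (m x / r) := by
    rw [abs_mul, abs_of_pos hM]
    calc _ ≤ m x / r * K := by have := hb.div; gcongr
      _ = _ := by ring
  have u3 : |2 * γ * m x| ≤ 2 * |γ| * (m x / r) := by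
    rw [abs_mul, abs_mul, abs_two, abs_of_pos hM]
    gcongr
  have hg : |skewCoef a m n γ x| ≤ (K ^ 2 + K + 2 * |γ|) * (m x / r) := by
    unfold skewCoef
    rw [abs_le] at *
    constructor <;> linarith
  refine (abs_add_le _ _).trans ?_
  rw [abs_mul, abs_mul, add_mul]
  refine add_le_add ?_ ?_
  · calc _ ≤ (3 * K ^ 2 + K + 2 * |γ| * K) * (m x / r) * K := by
          have := hb.coef j k; gcongr
      _ = _ := by ring
  · calc _ ≤ (K ^ 2 + K + 2 * |γ|) * (m x / r) * K := by
          have := hb.dcoef j j k; gcongr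
      _ = _ := by ring

lemma exists_form_lower_bound {α c : ℝ} (hα : 0 < α) (hc : 0 < c) (hK : 1 ≤ K) :
    ∃ Λ : ℝ, 1 ≤ Λ ∧ ∀ x : E3, x ≠ 0 → ‖x‖ ≤ 1 → CoefBounds a γ K x →
      (∀ z : E3, c * ‖z‖ ^ 2 ≤ ∑ k, ∑ l, gradForm a γ k l x * (z k * z l)) →
      (c * ‖x‖ ^ 4 ≤ 2 * (α + 2) * coefForm a x ^ 2
        - ‖x‖ ^ 2 * (∑ l, coefField a l x * pd l (coefForm a) x)
        - 2 * γ * (‖x‖ ^ 2 * coefForm a x)) →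
      ∀ (m n v : E3 → ℝ) (s p : ℝ), 0 < m x → 0 ≤ n x →
      n x * ‖x‖ ^ 2 = (α + 2) * m x + α * s / ‖x‖ ^ 2 →
      n x * ‖x‖ ^ 2 ≤ K * m x → |s| ≤ K → |p| * ‖x‖ ^ 4 ≤ K * m x → Λ ≤ m x * ‖x‖ ^ 2 →
      c / 2 * (m x * ∑ k, pd k v x ^ 2 + m x ^ 3 * ‖x‖ ^ 2 * v x ^ 2)
        ≤ 2 * n x * (∑ l, coefField a l x * pd l v x) ^ 2
          + m x * (∑ k, ∑ l, gradForm a γ k l x * (pd k v x * pd l v x))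
          + (∑ j, ∑ k, ((-(p * x j) * coefForm a x + n x * pd j (coefForm a) x
              + n x * x j * coefDiv a x - m x * pd j (coefDiv a) x - 2 * γ * (n x * x j)) * a j k x
              + skewCoef a m n γ x * pd j (a j k) x) * pd k v x) * v x
          + (2 * m x ^ 2 * n x * coefForm a x ^ 2
              - m x ^ 3 * (∑ l, coefField a l x * pd l (coefForm a) x)
              + m x * n x * coefForm a x * coefTheta a γ x
              - m x ^ 2 * (∑ l, coefField a l x * pd l (coefTheta a γ) x)
              - 2 * γ * m x ^ 3 * coefForm a x - 2 * γ * m x ^ 2 * coefTheta a γ x) * v x ^ 2 := by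
  set K1 := 2 * α * K ^ 3 + K ^ 3 + K + 2 * |γ| * K with hK1
  set K2 := (3 * K ^ 2 + K + 2 * |γ| * K) * K + (K ^ 2 + K + 2 * |γ|) * K with hK2
  set K3 := 27 * K2 ^ 2 / (2 * c) with hK3
  have hK0 : 0 ≤ K := by linarith
  have hK10 : 0 ≤ K1 := by positivity
  have hK30 : 0 ≤ K3 := by positivity
  refine ⟨1 + 4 * K1 / c + 4 * K3 / c, ?_, ?_⟩
  · have : 0 ≤ 4 * K1 / c + 4 * K3 / c := by positivity
    linarith
  intro x hx hx1 hb hB hF m n v s p hM hN0 hN hNK hs hp hΛ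
  have hr : 0 < ‖x‖ := norm_pos_iff.2 hx
  have hz := zeroth_order_bound (γ := γ) hα hK0 (by positivity : 0 < ‖x‖ ^ 2) hM hN hN0 hNK hs
    hb.form hb.theta hb.fieldTheta (by rw [← pow_mul]; exact hF)
  have hcr := cross_term_bound (v := v x) hc hM hr
    (fun j k => abs_cross_coef_le hx hx1 hK hb hM hN0 hNK hp j k) (fun k => pd k v x)
  have hg := hB (WithLp.toLp 2 fun k => pd k v x)
  rw [norm_sq_eq_sum] at hg
  have hg' := mul_le_mul_of_nonneg_left hg hM.le
  have hsq : 0 ≤ 2 * n x * (∑ l, coefField a l x * pd l v x) ^ 2 := by positivity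
  have hz' := mul_le_mul_of_nonneg_right hz (sq_nonneg (v x))
  set P := m x * ‖x‖ ^ 2 with hP
  have hP1 : 1 ≤ P := by
    have : 0 ≤ 4 * K1 / c + 4 * K3 / c := by positivity
    linarith
  have b1 : K1 ≤ c / 4 * P := by
    have : 4 * K1 / c ≤ P := by
      have : 0 ≤ 4 * K3 / c := by positivity
      linarith
    rw [div_le_iff₀ hc] at this
    linarith
  have b2 : K3 ≤ c / 4 * P ^ 2 := by
    have : 4 * K3 / c ≤ P := by
      have : 0 ≤ 4 * K1 / c := by positivity
      linarith
    rw [div_le_iff₀ hc] at this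
    nlinarith
  have d1 : K1 * m x ^ 2 ≤ c / 4 * (m x ^ 3 * ‖x‖ ^ 2) := by
    calc _ ≤ c / 4 * P * m x ^ 2 := by gcongr
      _ = _ := by rw [hP]; ring
  have d2 : K3 * (m x / ‖x‖ ^ 2) ≤ c / 4 * (m x ^ 3 * ‖x‖ ^ 2) := by
    calc _ ≤ c / 4 * P ^ 2 * (m x / ‖x‖ ^ 2) := by gcongr
      _ = _ := by rw [hP]; field_simp
  have d1' := mul_le_mul_of_nonneg_right d1 (sq_nonneg (v x))
  have d2' := mul_le_mul_of_nonneg_right d2 (sq_nonneg (v x))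
  linarith

end LowerBound

section Weights

/-- The square root `|x|^s e^{τ|x|^{-α}}` of a Carleman weight. -/
def carlemanRoot (α τ s : ℝ) (y : E3) : ℝ := ‖y‖ ^ s * Real.exp (τ * ‖y‖ ^ (-α))

/-- The function `m` with `∇W = -m x W` for the weight `W = |x|^s e^{τ|x|^{-α}}`. -/
def carlemanSlope (α τ s : ℝ) (y : E3) : ℝ :=
  τ * α * ‖y‖ ^ (-α - 2) - s * ‖y‖ ^ (-2 : ℝ)

/-- The function `n` with `∇m = -n x` for the slope `m` of the Carleman weight. -/
def carlemanCurv (α τ s : ℝ) (y : E3) : ℝ :=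
  (α + 2) * (τ * α) * ‖y‖ ^ (-α - 4) - 2 * s * ‖y‖ ^ (-4 : ℝ)

variable {α τ s : ℝ} {x : E3} {U : Set E3}

lemma hasGrad_carlemanRoot (hx : x ≠ 0) : HasGrad (carlemanRoot α τ s)
    (fun j => -(carlemanSlope α τ s x * x j) * carlemanRoot α τ s x) x := by
  have hr : 0 < ‖x‖ := norm_pos_iff.2 hx
  refine ((hasGrad_norm_rpow s hx).mul (hasGrad_comp (φ := fun t => Real.exp (τ * t))
    (((hasDerivAt_id _).const_mul τ).exp) (hasGrad_norm_rpow (-α) hx))).congr_grad fun i => ?_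
  have e1 : ‖x‖ ^ (s - 2) = ‖x‖ ^ s * ‖x‖ ^ (-2 : ℝ) := by
    rw [← Real.rpow_add hr]; ring_nf
  simp only [carlemanSlope, carlemanRoot, e1, id]
  ring

lemma hasGrad_carlemanSlope (hx : x ≠ 0) : HasGrad (carlemanSlope α τ s)
    (fun j => -(carlemanCurv α τ s x * x j)) x := by
  refine (((hasGrad_norm_rpow (-α - 2) hx).const_mul (τ * α)).sub
    ((hasGrad_norm_rpow (-2) hx).const_mul s)).congr_grad fun i => ?_
  simp only [carlemanCurv]
  rw [show -α - 2 - 2 = -α - 4 by ring, show (-2 : ℝ) - 2 = -4 by ring]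
  ring

lemma hasGrad_carlemanCurv (hx : x ≠ 0) : HasGrad (carlemanCurv α τ s)
    (fun j => -(((α + 2) * (α + 4) * (τ * α) * ‖x‖ ^ (-α - 6) - 8 * s * ‖x‖ ^ (-6 : ℝ)) * x j))
    x := by
  refine (((hasGrad_norm_rpow (-α - 4) hx).const_mul ((α + 2) * (τ * α))).sub
    ((hasGrad_norm_rpow (-4) hx).const_mul (2 * s))).congr_grad fun i => ?_
  rw [show -α - 4 - 2 = -α - 6 by ring, show (-4 : ℝ) - 2 = -6 by ring]
  ring

lemma sm_carlemanRoot (h0 : (0 : E3) ∉ U) : Sm U (carlemanRoot α τ s) :=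
  (sm_norm_rpow s h0).mul (contDiffOn_const.mul (sm_norm_rpow (-α) h0)).exp

lemma sm_carlemanSlope (h0 : (0 : E3) ∉ U) : Sm U (carlemanSlope α τ s) :=
  (contDiffOn_const.mul (sm_norm_rpow _ h0)).sub (contDiffOn_const.mul (sm_norm_rpow _ h0))

lemma sm_carlemanCurv (h0 : (0 : E3) ∉ U) : Sm U (carlemanCurv α τ s) :=
  (contDiffOn_const.mul (sm_norm_rpow _ h0)).sub (contDiffOn_const.mul (sm_norm_rpow _ h0))

lemma carlemanRoot_sq {e σ : ℝ} (hs : 2 * s = e + 2 * σ) (hx : x ≠ 0) :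
    carlemanRoot α τ s x ^ 2 = carlemanWeight α τ e σ x := by
  have hr : 0 < ‖x‖ := norm_pos_iff.2 hx
  unfold carlemanRoot carlemanWeight
  rw [mul_pow, sq, ← Real.rpow_add hr, ← Real.rpow_add hr, ← two_mul, hs, sq, ← Real.exp_add]
  ring_nf

lemma carlemanWeight_mul_rpow {e e' σ p : ℝ} (h : e + p = e') (hx : x ≠ 0) :
    ‖x‖ ^ p * carlemanWeight α τ e σ x = carlemanWeight α τ e' σ x := by
  have hr : 0 < ‖x‖ := norm_pos_iff.2 hx
  unfold carlemanWeight
  rw [← h, Real.rpow_add hr]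
  ring

/-- For large `τ` the first term of the slope of the Carleman weight dominates. -/
lemma carlemanSlope_bounds {S : ℝ} (hα : 0 < α) (hs : |s| ≤ S) (hτ : 2 * S ≤ τ * α)
    (hx : x ≠ 0) (hx1 : ‖x‖ ≤ 1) :
    |s| * ‖x‖ ^ (-2 : ℝ) ≤ τ * α * ‖x‖ ^ (-α - 2) / 2 ∧
    τ * α * ‖x‖ ^ (-α - 2) / 2 ≤ carlemanSlope α τ s x ∧
    carlemanSlope α τ s x ≤ 2 * (τ * α * ‖x‖ ^ (-α - 2)) := by
  have hr : 0 < ‖x‖ := norm_pos_iff.2 hx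
  have h1 : ‖x‖ ^ (-2 : ℝ) ≤ ‖x‖ ^ (-α - 2) :=
    Real.rpow_le_rpow_of_exponent_ge hr hx1 (by linarith)
  have hp : 0 < ‖x‖ ^ (-α - 2) := by positivity
  have hq : 0 < ‖x‖ ^ (-2 : ℝ) := by positivity
  have hS : 0 ≤ S := (abs_nonneg s).trans hs
  have h2 : |s| * ‖x‖ ^ (-2 : ℝ) ≤ τ * α * ‖x‖ ^ (-α - 2) / 2 := by
    calc |s| * ‖x‖ ^ (-2 : ℝ) ≤ S * ‖x‖ ^ (-α - 2) := by gcongr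
      _ ≤ (τ * α / 2) * ‖x‖ ^ (-α - 2) := by gcongr; linarith
      _ = _ := by ring
  have h3 := mul_le_mul_of_nonneg_right (le_abs_self s) hq.le
  have h4 := mul_le_mul_of_nonneg_right (neg_abs_le s) hq.le
  refine ⟨h2, ?_, ?_⟩ <;> unfold carlemanSlope
  · linarith
  · have : 0 ≤ τ * α * ‖x‖ ^ (-α - 2) := mul_nonneg (by linarith) hp.le
    linarith

lemma carlemanCurv_mul_sq (hx : x ≠ 0) : carlemanCurv α τ s x * ‖x‖ ^ 2
    = (α + 2) * carlemanSlope α τ s x + α * s / ‖x‖ ^ 2 := by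
  have hr : 0 < ‖x‖ := norm_pos_iff.2 hx
  have e2 : ‖x‖ ^ (-2 : ℝ) = 1 / ‖x‖ ^ 2 := by
    rw [Real.rpow_neg hr.le, one_div]; norm_cast
  have e3 : ‖x‖ ^ (-4 : ℝ) * ‖x‖ ^ 2 = ‖x‖ ^ (-2 : ℝ) := by
    rw [← Real.rpow_natCast, ← Real.rpow_add hr]; norm_num
  have e4 : ‖x‖ ^ (-α - 4) * ‖x‖ ^ 2 = ‖x‖ ^ (-α - 2) := by
    rw [← Real.rpow_natCast, ← Real.rpow_add hr]; congr 1; push_cast; ring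
  unfold carlemanCurv carlemanSlope
  rw [sub_mul, mul_assoc _ _ (‖x‖ ^ 2), mul_assoc _ _ (‖x‖ ^ 2), e3, e4, e2]
  ring

lemma carlemanCurv_bounds {S : ℝ} (hα : 0 < α) (hs : |s| ≤ S) (hτ : 2 * S ≤ τ * α)
    (hx : x ≠ 0) (hx1 : ‖x‖ ≤ 1) :
    0 ≤ carlemanCurv α τ s x ∧
    carlemanCurv α τ s x * ‖x‖ ^ 2 ≤ (2 * α + 6) * carlemanSlope α τ s x ∧
    |(α + 2) * (α + 4) * (τ * α) * ‖x‖ ^ (-α - 6) - 8 * s * ‖x‖ ^ (-6 : ℝ)| * ‖x‖ ^ 4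
      ≤ (2 * (α + 2) * (α + 4) + 8) * carlemanSlope α τ s x := by
  obtain ⟨h1, h2, h3⟩ := carlemanSlope_bounds hα hs hτ hx hx1
  have hr : 0 < ‖x‖ := norm_pos_iff.2 hx
  have hS : 0 ≤ S := (abs_nonneg s).trans hs
  set t := τ * α * ‖x‖ ^ (-α - 2) with ht
  set q := ‖x‖ ^ (-2 : ℝ) with hq
  have hq0 : 0 ≤ q := by positivity
  have ht0 : 0 ≤ t := mul_nonneg (by linarith) (by positivity)
  have h4 := mul_le_mul_of_nonneg_right (le_abs_self s) hq0
  have h5 := mul_le_mul_of_nonneg_right (neg_abs_le s) hq0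
  have e3 : ‖x‖ ^ (-4 : ℝ) * ‖x‖ ^ 2 = q := by
    rw [← Real.rpow_natCast, ← Real.rpow_add hr]; norm_num [hq]
  have e4 : ‖x‖ ^ (-α - 4) * ‖x‖ ^ 2 = ‖x‖ ^ (-α - 2) := by
    rw [← Real.rpow_natCast, ← Real.rpow_add hr]; congr 1; push_cast; ring
  have e5 : ‖x‖ ^ (-6 : ℝ) * ‖x‖ ^ 4 = q := by
    rw [← Real.rpow_natCast, ← Real.rpow_add hr]; norm_num [hq]
  have e6 : ‖x‖ ^ (-α - 6) * ‖x‖ ^ 4 = ‖x‖ ^ (-α - 2) := by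
    rw [← Real.rpow_natCast, ← Real.rpow_add hr]; congr 1; push_cast; ring
  have hn : carlemanCurv α τ s x * ‖x‖ ^ 2 = (α + 2) * t - 2 * s * q := by
    unfold carlemanCurv
    rw [sub_mul, mul_assoc _ _ (‖x‖ ^ 2), mul_assoc _ _ (‖x‖ ^ 2), e3, e4]
    ring
  have hαt : 0 ≤ α * t := by positivity
  refine ⟨?_, ?_, ?_⟩
  · refine nonneg_of_mul_nonneg_left (b := ‖x‖ ^ 2) ?_ (by positivity)
    rw [hn]; linarith
  · rw [hn]
    have := mul_le_mul_of_nonneg_left h2 (by positivity : 0 ≤ 2 * α + 6)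
    linarith
  · rw [← abs_of_pos (by positivity : 0 < ‖x‖ ^ 4), ← abs_mul, sub_mul,
      mul_assoc _ _ (‖x‖ ^ 4), mul_assoc _ _ (‖x‖ ^ 4), e5, e6]
    have := mul_le_mul_of_nonneg_left h2 (by positivity : 0 ≤ 2 * (α + 2) * (α + 4) + 8)
    have h6 : 0 ≤ (α + 2) * (α + 4) * t := by positivity
    have e7 : (α + 2) * (α + 4) * (τ * α) * ‖x‖ ^ (-α - 2) = (α + 2) * (α + 4) * t := by
      rw [ht]; ring
    rw [e7, abs_le]
    constructor <;> linarith

end Weights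

section FirstOrder

variable {a : Fin 3 → Fin 3 → E3 → ℝ} {Ω : Set E3} {α : ℝ}

/-- Passing from the conjugated function `v = W f` back to `f`. -/
lemma conjugate_energy_le {W f : E3 → ℝ} {m : ℝ} {x : E3} (hm : 0 < m) {g : Fin 3 → ℝ}
    (hg : ∀ k, g k = W x * pd k f x - m * x k * (W x * f x)) :
    m * W x ^ 2 * ∑ k, pd k f x ^ 2 + m ^ 3 * ‖x‖ ^ 2 * W x ^ 2 * f x ^ 2
      ≤ 3 * (m * ∑ k, g k ^ 2 + m ^ 3 * ‖x‖ ^ 2 * (W x * f x) ^ 2) := by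
  have h : ∀ k, m * W x ^ 2 * pd k f x ^ 2
      ≤ 2 * (m * g k ^ 2) + 2 * (m ^ 3 * (x k) ^ 2 * (W x * f x) ^ 2) := fun k => by
    have e : W x * pd k f x = g k + m * x k * (W x * f x) := by rw [hg k]; ring
    have h1 : 0 ≤ m * (g k - m * x k * (W x * f x)) ^ 2 := by positivity
    have e2 : m * W x ^ 2 * pd k f x ^ 2 = m * (W x * pd k f x) ^ 2 := by ring
    rw [e2, e]
    linarith
  have hs := Finset.sum_le_sum fun k (_ : k ∈ Finset.univ) => h k
  rw [Finset.sum_add_distrib] at hs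
  simp only [← Finset.mul_sum, ← Finset.sum_mul] at hs
  rw [← norm_sq_eq_sum x] at hs
  have h2 : 0 ≤ m * ∑ k, g k ^ 2 := by positivity
  linarith

lemma weight_energy_le {τ s σ m : ℝ} {x : E3} (hα : 0 < α) (hτ : 0 < τ) (hx : x ≠ 0)
    (hs : s = σ + 2 + 2 * α) (hm : τ * α * ‖x‖ ^ (-α - 2) / 2 ≤ m) {F G : ℝ} (hF : 0 ≤ F)
    (hG : 0 ≤ G) :
    (α / 2) ^ 3 * (τ ^ 3 * (carlemanWeight α τ α σ x * F))
      + α / 2 * (τ * (carlemanWeight α τ (α + 2 * (1 + α)) σ x * G))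
      ≤ m * carlemanRoot α τ s x ^ 2 * G + m ^ 3 * ‖x‖ ^ 2 * carlemanRoot α τ s x ^ 2 * F := by
  have hr : 0 < ‖x‖ := norm_pos_iff.2 hx
  have e0 : carlemanRoot α τ s x ^ 2 = carlemanWeight α τ (4 * (1 + α)) σ x :=
    carlemanRoot_sq (by rw [hs]; ring) hx
  have e1 : ‖x‖ ^ (-α - 2) * carlemanWeight α τ (4 * (1 + α)) σ x
      = carlemanWeight α τ (α + 2 * (1 + α)) σ x := carlemanWeight_mul_rpow (by ring) hx
  have e2 : (‖x‖ ^ (-α - 2)) ^ 3 * ‖x‖ ^ 2 * carlemanWeight α τ (4 * (1 + α)) σ x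
      = carlemanWeight α τ α σ x := by
    rw [← Real.rpow_natCast, ← Real.rpow_natCast, ← Real.rpow_mul hr.le, ← Real.rpow_add hr]
    exact carlemanWeight_mul_rpow (by push_cast; ring) hx
  rw [e0, ← e1, ← e2]
  have hw := carlemanWeight_nonneg α τ (4 * (1 + α)) σ x
  set w := carlemanWeight α τ (4 * (1 + α)) σ x
  set t := ‖x‖ ^ (-α - 2) with ht
  have ht0 : 0 < t := by positivity
  calc _ = (τ * α * t / 2) * w * G + (τ * α * t / 2) ^ 3 * ‖x‖ ^ 2 * w * F := by ring
    _ ≤ _ := by gcongr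

/-- The Carleman estimate for `f` and its first derivatives. -/
lemma first_order_estimate (hΩ : IsOpen Ω) (h0 : (0 : E3) ∈ Ω) (ha : ∀ j k, Sm Ω (a j k))
    (hsym : ∀ j k y, a j k y = a k j y) (hα : 0 < α) {γ c : ℝ} (hc : 0 < c)
    (H : ∀ z : E3,
      c * ‖z‖ ^ 2 ≤ γ * (∑ i, z i * ∑ k, a i k 0 * z k) - ∑ i, (∑ k, a i k 0 * z k) ^ 2 ∧
      c * ‖z‖ ^ 4 ≤ (α + 2) * (∑ i, z i * ∑ k, a i k 0 * z k) ^ 2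
        - ‖z‖ ^ 2 * (∑ i, (∑ k, a i k 0 * z k) ^ 2)
        - γ * (‖z‖ ^ 2 * ∑ i, z i * ∑ k, a i k 0 * z k)) :
    ∃ r0 > (0 : ℝ), r0 ≤ 1 ∧ closedBall (0 : E3) r0 ⊆ Ω ∧ ∀ ν : ℝ, 0 < ν →
      ∃ τ0 ≥ (1 : ℝ), ∃ C > (0 : ℝ),
      ∀ σ : ℝ, |σ| ≤ ν → ∀ τ ≥ τ0, ∀ f : E3 → ℝ, IsTest r0 f →
      τ ^ 3 * (∫ x, carlemanWeight α τ α σ x * derivEnergy 0 f x)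
        + τ * (∫ x, carlemanWeight α τ (α + 2 * (1 + α)) σ x * derivEnergy 1 f x)
      ≤ C * ∫ x, carlemanWeight α τ (4 * (1 + α)) σ x * derivEnergy 0 (op2 a f) x := by
  obtain ⟨r1, hr1, hpos⟩ := Metric.eventually_nhds_iff_ball.1
    (eventually_local_positivity hΩ h0 ha hsym hc H)
  obtain ⟨r2, hr2, hball⟩ := Metric.isOpen_iff.1 hΩ 0 h0
  set r0 := min (min r1 1) (r2 / 2) with hr0
  have hr0pos : 0 < r0 := by positivity
  have hr0r1 : r0 ≤ r1 := (min_le_left _ _).trans (min_le_left _ _)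
  have hr01 : r0 ≤ 1 := (min_le_left _ _).trans (min_le_right _ _)
  have hBΩ : closedBall (0 : E3) r0 ⊆ Ω := (closedBall_subset_ball
    (lt_of_le_of_lt (min_le_right _ _) (by linarith))).trans hball
  refine ⟨r0, hr0pos, hr01, hBΩ, fun ν hν => ?_⟩
  have hB1 : ∀ x ∈ closedBall (0 : E3) r0, ‖x‖ ≤ 1 := fun x hx =>
    (mem_closedBall_zero_iff.1 hx).trans hr01
  set S := ν + 2 + 2 * α with hS
  obtain ⟨K, hK0, hK1, hKb⟩ := exists_coefBounds hΩ (isCompact_closedBall (0 : E3) r0) hBΩ hB1 ha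
    hsym γ (S + (2 * α + 6) + (2 * (α + 2) * (α + 4) + 8))
  obtain ⟨Λ, hΛ1, hΛ⟩ := exists_form_lower_bound (a := a) (γ := γ) hα hc hK1
  set cc := 2 * c / 3 with hcc
  have hccpos : 0 < cc := by positivity
  set d := cc * min ((α / 2) ^ 3) (α / 2) with hd
  have hdpos : 0 < d := by positivity
  refine ⟨1 + 2 * S / α + 2 * Λ / α, ?_, d⁻¹, by positivity, fun σ hσ τ hτ f hf => ?_⟩
  · have : 0 ≤ 2 * S / α + 2 * Λ / α := by positivity
    show _ ≤ _
    linarith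
  have hτpos : 0 < τ := by
    have : 0 < 1 + 2 * S / α + 2 * Λ / α := by positivity
    linarith
  have hτS : 2 * S ≤ τ * α := by
    rw [← div_le_iff₀ hα]
    have : 0 ≤ 2 * Λ / α := by positivity
    linarith
  have hτΛ : 2 * Λ ≤ τ * α := by
    rw [← div_le_iff₀ hα]
    have : 0 ≤ 2 * S / α := by positivity
    linarith
  set s := σ + 2 + 2 * α with hs
  have hsS : |s| ≤ S := by
    rw [abs_le] at hσ ⊢
    constructor <;> linarith
  set U := Ω \ {0} with hU
  have hUo : IsOpen U := hΩ.sdiff isClosed_singleton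
  have hU0 : (0 : E3) ∉ U := fun h => h.2 rfl
  have hKU : tsupport f ⊆ U := fun x hx =>
    ⟨hBΩ (ball_subset_closedBall (hf.supp hx).1), (hf.supp hx).2⟩
  have haU : ∀ j k, Sm U (a j k) := fun j k => (ha j k).mono Set.sdiff_subset
  set W := carlemanRoot α τ s with hW
  set m := carlemanSlope α τ s with hm
  set n := carlemanCurv α τ s with hn
  have hWg : ∀ y ∈ U, HasGrad W (fun j => -(m y * y j) * W y) y := fun y hy =>
    hasGrad_carlemanRoot hy.2
  set v : E3 → ℝ := fun y => W y * f y with hv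
  have hvs : Sm U v := (sm_carlemanRoot hU0).mul (hf.sm U)
  set F := carlemanFlux a m n γ v with hF
  have hFs : ∀ j, Sm U (F j) := fun j =>
    sm_carlemanFlux hUo haU (sm_carlemanSlope hU0) (sm_carlemanCurv hU0) hvs j
  have hcl : IsClosed (tsupport f) := isClosed_tsupport f
  have hv0 : ∀ x ∉ tsupport f, v x = 0 := fun x hx => by
    simp [hv, IsTest.eq_zero (f := f) x hx]
  have hF0 : ∀ j, ∀ x ∉ tsupport f, F j x = 0 := fun j x hx =>
    carlemanFlux_eq_zero (hv0 x hx) (fun k => pd_eq_zero_of_notMem hcl hv0 k x hx) j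
  have hpt : ∀ x, d * (τ ^ 3 * (carlemanWeight α τ α σ x * derivEnergy 0 f x)
        + τ * (carlemanWeight α τ (α + 2 * (1 + α)) σ x * derivEnergy 1 f x))
      ≤ carlemanWeight α τ (4 * (1 + α)) σ x * derivEnergy 0 (op2 a f) x
        - 4 * ∑ j, pd j (F j) x := by
    intro x
    by_cases hx : x ∈ tsupport f
    swap
    · have e1 := fun j => derivEnergy_eq_zero hcl j (IsTest.eq_zero (f := f)) x hx
      have e2 := derivEnergy_eq_zero hcl 0 (op2_eq_zero (a := a) hcl (IsTest.eq_zero (f := f))) x hx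
      have e3 := fun j => pd_eq_zero_of_notMem hcl (hF0 j) j x hx
      simp [e1, e2, e3]
    have hxU := hKU hx
    have hxn : x ≠ 0 := hxU.2
    have hxb := ball_subset_closedBall (hf.supp hx).1
    have hx1 := hB1 x hxb
    obtain ⟨p1, p2⟩ := hpos x (ball_subset_ball hr0r1 (hf.supp hx).1)
    obtain ⟨s1, s2, s3⟩ := carlemanSlope_bounds hα hsS hτS hxn hx1
    obtain ⟨n1, n2, n3⟩ := carlemanCurv_bounds hα hsS hτS hxn hx1
    have hr : 0 < ‖x‖ := norm_pos_iff.2 hxn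
    have ht : 0 < τ * α * ‖x‖ ^ (-α - 2) := by positivity
    have hmpos : 0 < m x := by linarith
    have hS0 : 0 ≤ S := (abs_nonneg _).trans hsS
    have hpp : 0 ≤ 2 * (α + 2) * (α + 4) + 8 := by positivity
    have hmΛ : Λ ≤ m x * ‖x‖ ^ 2 := by
      have e : ‖x‖ ^ (-α - 2) * ‖x‖ ^ 2 = ‖x‖ ^ (-α) := by
        rw [← Real.rpow_natCast, ← Real.rpow_add hr]; congr 1; push_cast; ring
      have h1 : 1 ≤ ‖x‖ ^ (-α) := Real.one_le_rpow_of_pos_of_le_one_of_nonpos hr hx1 (by linarith)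
      calc Λ ≤ τ * α / 2 * 1 := by linarith
        _ ≤ τ * α / 2 * ‖x‖ ^ (-α) := by gcongr
        _ = τ * α * ‖x‖ ^ (-α - 2) / 2 * ‖x‖ ^ 2 := by rw [← e]; ring
        _ ≤ m x * ‖x‖ ^ 2 := by gcongr
    have hlow := hΛ x hxn hx1 (hKb x hxb) p1 p2 m n v s
      ((α + 2) * (α + 4) * (τ * α) * ‖x‖ ^ (-α - 6) - 8 * s * ‖x‖ ^ (-6 : ℝ)) hmpos n1
      (carlemanCurv_mul_sq hxn)
      (n2.trans (mul_le_mul_of_nonneg_right (by linarith) hmpos.le)) (by linarith)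
      (n3.trans (mul_le_mul_of_nonneg_right (by linarith) hmpos.le)) hmΛ
    have hid := conjugated_identity (γ := γ) hUo hxU hsym haU (sm_carlemanSlope hU0)
      (sm_carlemanCurv hU0) (hasGrad_carlemanSlope (τ := τ) (s := s) (α := α) hxn)
      (hasGrad_carlemanCurv hxn) hvs
    have hop := weight_mul_op2 (γ := γ) hUo hxU hsym hWg (hasGrad_carlemanSlope hxn) (hf.sm U)
    have hAM := (mul_assoc _ _ _).symm.le.trans (four_mul_le_sq_add
      (∑ j, ∑ k, a j k x * pd j (pd k v) x + symmCoef a m γ x * v x)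
      (2 * m x * ∑ l, coefField a l x * pd l v x - skewCoef a m n γ x * v x))
    rw [hid, ← hop, mul_pow] at hAM
    have hen := conjugate_energy_le hmpos (fun k => pd_weight_mul hUo hWg (hf.sm U) k hxU)
    have hwe := weight_energy_le hα hτpos hxn hs s2 (sq_nonneg (f x))
      (Finset.sum_nonneg fun k (_ : k ∈ (Finset.univ : Finset (Fin 3))) => sq_nonneg (pd k f x))
    have e0 : W x ^ 2 = carlemanWeight α τ (4 * (1 + α)) σ x :=
      carlemanRoot_sq (by rw [hs]; ring) hxn
    have hA : derivEnergy 0 (op2 a f) x = op2 a f x ^ 2 := rfl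
    have hf0 : derivEnergy 0 f x = f x ^ 2 := rfl
    have hf1 : derivEnergy 1 f x = ∑ k, pd k f x ^ 2 := rfl
    rw [hA, hf0, hf1, ← e0]
    set P := τ ^ 3 * (carlemanWeight α τ α σ x * f x ^ 2) with hP
    set Q := τ * (carlemanWeight α τ (α + 2 * (1 + α)) σ x * ∑ k, pd k f x ^ 2) with hQ
    have hP0 : 0 ≤ P := by have := carlemanWeight_nonneg α τ α σ x; positivity
    have hQ0 : 0 ≤ Q := by
      have := carlemanWeight_nonneg α τ (α + 2 * (1 + α)) σ x; positivity
    have hmin : d * (P + Q) ≤ cc * ((α / 2) ^ 3 * P + α / 2 * Q) := by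
      rw [hd, mul_assoc]
      refine mul_le_mul_of_nonneg_left ?_ hccpos.le
      rw [mul_add]
      gcongr
      · exact min_le_left _ _
      · exact min_le_right _ _
    have g1 := mul_le_mul_of_nonneg_left (hwe.trans hen) hccpos.le
    refine hmin.trans (g1.trans ?_)
    rw [hcc]
    linarith
  have hwc : ∀ e, ContinuousOn (carlemanWeight α τ e σ) (tsupport f) := fun e =>
    continuousOn_carlemanWeight α τ e σ hf.zero_notMem
  have hI : ∀ e j, Integrable fun x => carlemanWeight α τ e σ x * derivEnergy j f x := fun e j =>
    integrable_weight_mul hf (hwc e) ((continuousOn_derivEnergy hUo j (hf.sm U)).mono hKU)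
      (derivEnergy_eq_zero hcl j IsTest.eq_zero)
  have hIA : Integrable fun x => carlemanWeight α τ (4 * (1 + α)) σ x
      * derivEnergy 0 (op2 a f) x :=
    integrable_weight_mul hf (hwc _)
      ((continuousOn_derivEnergy hUo 0 (sm_op2 hUo haU (hf.sm U))).mono hKU)
      (derivEnergy_eq_zero hcl 0 (op2_eq_zero hcl IsTest.eq_zero))
  have hIF : ∀ j, Integrable (pd j (F j)) := fun j =>
    integrable_of_continuousOn hf.isCompact (((hFs j).pd hUo j).continuousOn.mono hKU)
      (pd_eq_zero_of_notMem hcl (hF0 j) j)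
  have hIF' : Integrable fun x => 4 * ∑ j, pd j (F j) x :=
    (integrable_finsetSum _ fun j _ => hIF j).const_mul 4
  have hmono := integral_mono ((((hI _ 0).const_mul _).add ((hI _ 1).const_mul _)).const_mul d)
    (hIA.sub hIF') hpt
  simp only [Pi.add_apply, Pi.sub_apply] at hmono
  rw [integral_const_mul, integral_add ((hI _ 0).const_mul _) ((hI _ 1).const_mul _),
    integral_const_mul, integral_const_mul, integral_sub hIA hIF', integral_const_mul,
    integral_finsetSum _ (fun j _ => hIF j)] at hmono
  simp only [fun j => integral_pd_eq_zero hUo (hFs j) hf.isCompact hKU (hF0 j) j,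
    Finset.sum_const_zero, mul_zero, sub_zero] at hmono
  rw [← div_eq_inv_mul, le_div_iff₀ hdpos]
  linarith

end FirstOrder

section SecondOrder

lemma exists_sum_mul_decomposition {A : Fin 3 → Fin 3 → ℝ} (hsym : ∀ i j, A i j = A j i)
    (hA : ∀ ξ : Fin 3 → ℝ, 0 ≤ ∑ j, ∑ k, A j k * ξ j * ξ k) :
    ∃ (m : ℕ) (v : Fin m → Fin 3 → ℝ), ∀ j k, A j k = ∑ i, v i j * v i k := by
  have h : (Matrix.of A).PosSemidef := by
    refine Matrix.posSemidef_iff_dotProduct_mulVec.2 ⟨?_, fun ξ => ?_⟩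
    · ext i j; simp [hsym j i]
    · refine (hA ξ).trans_eq ?_
      simp only [dotProduct, Matrix.mulVec, Matrix.of_apply, Finset.mul_sum, star_trivial]
      exact Finset.sum_congr rfl fun j _ => Finset.sum_congr rfl fun k _ => by ring
  obtain ⟨m, v, hv⟩ := Matrix.posSemidef_iff_eq_sum_vecMulVec.1 h
  refine ⟨m, v, fun j k => ?_⟩
  have := congrFun (congrFun hv j) k
  simpa [Matrix.sum_apply, Matrix.vecMulVec_apply] using this

/-- Ellipticity bounds `tr(AHAH)` from below for symmetric `H`. -/
lemma elliptic_trace_bound {A : Fin 3 → Fin 3 → ℝ} (hsym : ∀ i j, A i j = A j i) {c0 : ℝ}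
    (hc0 : 0 < c0) (hA : ∀ ξ : Fin 3 → ℝ, c0 * (∑ i, ξ i ^ 2) ≤ ∑ j, ∑ k, A j k * ξ j * ξ k)
    (H : Fin 3 → Fin 3 → ℝ) (hH : ∀ i j, H i j = H j i) :
    c0 ^ 2 * ∑ l, ∑ m, H l m ^ 2
      ≤ ∑ j, ∑ k, ∑ l, ∑ m, A j k * A l m * (H l k * H j m) := by
  obtain ⟨N, v, hv⟩ := exists_sum_mul_decomposition hsym fun ξ =>
    le_trans (by positivity) (hA ξ)
  have h1 : ∑ j, ∑ k, ∑ l, ∑ m, A j k * A l m * (H l k * H j m)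
      = ∑ i, ∑ j, ∑ m, A j m * (∑ k, H j k * v i k) * (∑ l, H m l * v i l) := by
    have e : ∀ i, ∑ j, ∑ m, A j m * (∑ k, H j k * v i k) * (∑ l, H m l * v i l)
        = ∑ j, ∑ k, ∑ l, ∑ m, A l j * (H l k * H j m) * (v i k * v i m) := fun i => by
      simp only [Fin.sum_univ_three, hsym 1 0, hsym 2 0, hsym 2 1]
      ring
    simp only [e]
    rw [Finset.sum_comm]
    simp only [Finset.sum_comm (s := (Finset.univ : Finset (Fin N)))]
    simp only [← Finset.mul_sum, ← hv]
    simp only [Fin.sum_univ_three, hsym 1 0, hsym 2 0, hsym 2 1, hH 1 0, hH 2 0, hH 2 1]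
    ring
  have h2 : ∀ l, ∑ j, ∑ k, A j k * H l j * H l k = ∑ i, (∑ k, H l k * v i k) ^ 2 := fun l => by
    simp only [hv, Finset.sum_mul]
    simp only [Finset.sum_comm (t := (Finset.univ : Finset (Fin N)))]
    refine Finset.sum_congr rfl fun i _ => ?_
    simp only [Fin.sum_univ_three]
    ring
  rw [h1]
  calc c0 ^ 2 * ∑ l, ∑ m, H l m ^ 2 = c0 * ∑ l, c0 * ∑ m, H l m ^ 2 := by
        rw [← Finset.mul_sum]; ring
    _ ≤ c0 * ∑ l, ∑ i, (∑ k, H l k * v i k) ^ 2 := by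
        gcongr with l _
        rw [← h2]
        exact hA (H l)
    _ = ∑ i, c0 * ∑ l, (∑ k, H l k * v i k) ^ 2 := by
        rw [← Finset.mul_sum, Finset.sum_comm]
    _ ≤ _ := Finset.sum_le_sum fun i _ => hA fun l => ∑ k, H l k * v i k

variable {a : Fin 3 → Fin 3 → E3 → ℝ} {U : Set E3} {x : E3} {w f : E3 → ℝ}

lemma second_order_identity (hU : IsOpen U) (hx : x ∈ U) {b : E3 → ℝ} (hb : Sm U b) (hf : Sm U f)
    (j k l m : Fin 3) :
    pd j (fun y => b y * (pd k f y * pd l (pd m f) y)) x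
        - pd l (fun y => b y * (pd k f y * pd j (pd m f) y)) x
      = b x * (pd j (pd k f) x * pd l (pd m f) x) - b x * (pd l (pd k f) x * pd j (pd m f) x)
        + pd k f x * (pd j b x * pd l (pd m f) x - pd l b x * pd j (pd m f) x) := by
  have hB := hb.hasGrad hU hx
  have hk := (hf.pd hU k).hasGrad hU hx
  have hlm := fun i => ((hf.pd hU m).pd hU i).hasGrad hU hx
  rw [(hB.mul (hk.mul (hlm l))).eq j, (hB.mul (hk.mul (hlm j))).eq l,
    pd_comm_apply (hf.pd hU m) hU hx j l]
  ring

lemma op2_sq (a : Fin 3 → Fin 3 → E3 → ℝ) (f : E3 → ℝ) (x : E3) :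
    op2 a f x ^ 2 = ∑ j, ∑ k, ∑ l, ∑ m, a j k x * a l m x
      * (pd j (pd k f) x * pd l (pd m f) x) := by
  unfold op2
  rw [sq]
  simp only [Finset.sum_mul, Finset.mul_sum]
  exact Finset.sum_congr rfl fun j _ => Finset.sum_congr rfl fun k _ =>
    Finset.sum_congr rfl fun l _ => Finset.sum_congr rfl fun m _ => by ring

lemma mul_cross_le {ε w B u h D : ℝ} (hε : 0 < ε) (hw : 0 ≤ w) (hD : |D| ≤ B * w) :
    |u * (D * h)| ≤ w * (ε * h ^ 2 + B ^ 2 / (4 * ε) * u ^ 2) := by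
  have h1 : |u * (D * h)| ≤ |u| * (B * w * |h|) := by
    rw [abs_mul, abs_mul]; gcongr
  have h2 : w * (ε * h ^ 2 + B ^ 2 / (4 * ε) * u ^ 2) - |u| * (B * w * |h|)
      = w * ε * (|h| - B / (2 * ε) * |u|) ^ 2 := by
    rw [← sq_abs h, ← sq_abs u]
    field_simp
    ring
  have h3 : 0 ≤ w * ε * (|h| - B / (2 * ε) * |u|) ^ 2 := by positivity
  linarith

lemma sum_four_le {A H : Fin 3 → Fin 3 → ℝ} {u : Fin 3 → ℝ} {w ε M : ℝ}
    {D : Fin 3 → Fin 3 → Fin 3 → Fin 3 → ℝ}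
    (h : ∀ j k l m, A j k * A l m * (H l k * H j m) * w
      ≤ w * (A j k * A l m * (H j k * H l m))
        + w * (ε * H l m ^ 2 + ε * H j m ^ 2 + M * u k ^ 2) - D j k l m) :
    (∑ j, ∑ k, ∑ l, ∑ m, A j k * A l m * (H l k * H j m)) * w
      ≤ w * (∑ j, ∑ k, ∑ l, ∑ m, A j k * A l m * (H j k * H l m))
        + w * (18 * ε * (∑ l, ∑ m, H l m ^ 2) + 27 * M * ∑ k, u k ^ 2)
        - ∑ j, ∑ k, ∑ l, ∑ m, D j k l m := by
  have e : ∑ j, ∑ k, ∑ l, ∑ m, (ε * H l m ^ 2 + ε * H j m ^ 2 + M * u k ^ 2)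
      = 18 * ε * (∑ l, ∑ m, H l m ^ 2) + 27 * M * ∑ k, u k ^ 2 := by
    simp only [Fin.sum_univ_three]
    ring
  rw [← e]
  simp only [Finset.sum_mul, Finset.mul_sum, ← Finset.sum_add_distrib, ← Finset.sum_sub_distrib]
  exact Finset.sum_le_sum fun j _ => Finset.sum_le_sum fun k _ => Finset.sum_le_sum fun l _ =>
    Finset.sum_le_sum fun m _ => h j k l m

/-- The weighted Hessian is controlled by `Af`, the gradient and a divergence. -/
lemma second_order_pointwise (hU : IsOpen U) (hx : x ∈ U) (hsym : ∀ j k y, a j k y = a k j y)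
    (ha : ∀ j k, Sm U (a j k)) (hf : Sm U f) (hw : Sm U w) (hw0 : 0 ≤ w x) {L K c0 : ℝ}
    (hc0 : 0 < c0) (hell : ∀ ξ : Fin 3 → ℝ, c0 * (∑ i, ξ i ^ 2) ≤ ∑ j, ∑ k, a j k x * ξ j * ξ k)
    (hL : 1 ≤ L) (hdw : ∀ i, |pd i w x| ≤ L * w x) (hK : ∀ j k, |a j k x| ≤ K)
    (hdK : ∀ i j k, |pd i (a j k) x| ≤ K) :
    c0 ^ 2 / 2 * (w x * ∑ l, ∑ m, pd l (pd m f) x ^ 2)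
      ≤ w x * op2 a f x ^ 2 + 4374 * K ^ 4 / c0 ^ 2 * (L ^ 2 * (w x * ∑ k, pd k f x ^ 2))
        - ∑ j, ∑ k, ∑ l, ∑ m,
          (pd j (fun y => w y * (a j k y * a l m y) * (pd k f y * pd l (pd m f) y)) x
            - pd l (fun y => w y * (a j k y * a l m y) * (pd k f y * pd j (pd m f) y)) x) := by
  have hK0 : 0 ≤ K := (abs_nonneg _).trans (hK 0 0)
  have hb : ∀ j k l m, Sm U fun y => w y * (a j k y * a l m y) := fun j k l m =>
    hw.mul ((ha j k).mul (ha l m))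
  have hdb : ∀ j k l m i, |pd i (fun y => w y * (a j k y * a l m y)) x|
      ≤ 3 * K ^ 2 * L * w x := fun j k l m i => by
    rw [((hw.hasGrad hU hx).mul (((ha j k).hasGrad hU hx).mul ((ha l m).hasGrad hU hx))).eq i]
    have t1 : |pd i w x * (a j k x * a l m x)| ≤ L * w x * (K * K) := by
      rw [abs_mul, abs_mul]
      have := hdw i
      have := hK j k
      have := hK l m
      gcongr
    have t2 : |pd i (a j k) x * a l m x| ≤ K * K := by
      rw [abs_mul]; exact mul_le_mul (hdK _ _ _) (hK _ _) (abs_nonneg _) hK0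
    have t3 : |a j k x * pd i (a l m) x| ≤ K * K := by
      rw [abs_mul]; exact mul_le_mul (hK _ _) (hdK _ _ _) (abs_nonneg _) hK0
    have t4 : |w x * (pd i (a j k) x * a l m x + a j k x * pd i (a l m) x)|
        ≤ L * w x * (K * K + K * K) := by
      rw [abs_mul, abs_of_nonneg hw0]
      refine mul_le_mul (le_mul_of_one_le_left hw0 hL) ((abs_add_le _ _).trans (add_le_add t2 t3))
        (abs_nonneg _) (by positivity)
    refine (abs_add_le _ _).trans ((add_le_add t1 t4).trans (le_of_eq ?_))
    ring
  have hterm : ∀ j k l m,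
      a j k x * a l m x * (pd l (pd k f) x * pd j (pd m f) x) * w x
      ≤ w x * (a j k x * a l m x * (pd j (pd k f) x * pd l (pd m f) x))
        + w x * (c0 ^ 2 / 36 * pd l (pd m f) x ^ 2 + c0 ^ 2 / 36 * pd j (pd m f) x ^ 2
          + (3 * K ^ 2 * L) ^ 2 / (4 * (c0 ^ 2 / 36)) * 2 * pd k f x ^ 2)
        - (pd j (fun y => w y * (a j k y * a l m y) * (pd k f y * pd l (pd m f) y)) x
            - pd l (fun y => w y * (a j k y * a l m y) * (pd k f y * pd j (pd m f) y)) x) := by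
    intro j k l m
    rw [second_order_identity hU hx (hb j k l m) hf j k l m]
    have g1 := mul_cross_le (u := pd k f x) (h := pd l (pd m f) x)
      (by positivity : 0 < c0 ^ 2 / 36) hw0 (hdb j k l m j)
    have g2 := mul_cross_le (u := pd k f x) (h := pd j (pd m f) x)
      (by positivity : 0 < c0 ^ 2 / 36) hw0 (hdb j k l m l)
    have g1' := (abs_le.1 g1).2
    have g2' := (abs_le.1 g2).1
    linarith
  have htr := mul_le_mul_of_nonneg_right (elliptic_trace_bound (fun i j => hsym i j x) hc0 hell
    (fun l m => pd l (pd m f) x) fun i j => pd_comm_apply hf hU hx i j) hw0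
  have hsum := sum_four_le hterm
  rw [← op2_sq] at hsum
  have e3 : 54 * ((3 * K ^ 2 * L) ^ 2 / (4 * (c0 ^ 2 / 36)) * 2)
      = 2 * (4374 * K ^ 4 / c0 ^ 2 * L ^ 2) := by
    field_simp; ring
  have e4 : 27 * ((3 * K ^ 2 * L) ^ 2 / (4 * (c0 ^ 2 / 36)) * 2)
      = 4374 * K ^ 4 / c0 ^ 2 * L ^ 2 := by linarith
  rw [e4] at hsum
  linarith

end SecondOrder

section Assembly

variable {a : Fin 3 → Fin 3 → E3 → ℝ} {Ω : Set E3} {α : ℝ}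

lemma integral_sum_eq_zero {ι : Type*} [Fintype ι] {g : ι → E3 → ℝ}
    (h : ∀ i, Integrable (g i) ∧ ∫ x, g i x = 0) :
    Integrable (fun x => ∑ i, g i x) ∧ ∫ x, ∑ i, g i x = 0 := by
  refine ⟨integrable_finsetSum _ fun i _ => (h i).1, ?_⟩
  rw [integral_finsetSum _ fun i _ => (h i).1]
  exact Finset.sum_eq_zero fun i _ => (h i).2

/-- The weighted second derivatives are controlled by `Af` and the first derivatives. -/
lemma second_order_estimate (hΩ : IsOpen Ω) (ha : ∀ j k, Sm Ω (a j k))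
    (hsym : ∀ j k y, a j k y = a k j y) (hα : 0 < α) (hell : UnifElliptic a Ω) {r0 : ℝ}
    (hr01 : r0 ≤ 1) (hBΩ : closedBall (0 : E3) r0 ⊆ Ω) (ν : ℝ) (hν : 0 < ν) :
    ∃ τ0 ≥ (1 : ℝ), ∃ C > (0 : ℝ), ∀ σ : ℝ, |σ| ≤ ν → ∀ τ ≥ τ0, ∀ f : E3 → ℝ, IsTest r0 f →
      (∫ x, carlemanWeight α τ (α + 4 * (1 + α)) σ x * derivEnergy 2 f x)
      ≤ C * ((∫ x, carlemanWeight α τ (α + 4 * (1 + α)) σ x * derivEnergy 0 (op2 a f) x)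
        + τ ^ 2 * ∫ x, carlemanWeight α τ (α + 2 * (1 + α)) σ x * derivEnergy 1 f x) := by
  obtain ⟨c0, hc0, hell⟩ := hell
  have hB1 : ∀ x ∈ closedBall (0 : E3) r0, ‖x‖ ≤ 1 := fun x hx =>
    (mem_closedBall_zero_iff.1 hx).trans hr01
  obtain ⟨K, -, hK1, hK⟩ := exists_coefBounds hΩ (isCompact_closedBall (0 : E3) r0) hBΩ hB1 ha
    hsym 0 0
  set S := (α + 4 * (1 + α)) / 2 + ν with hS
  have hSpos : 0 < S := by positivity
  set M := 1 + 4374 * K ^ 4 / c0 ^ 2 * (4 * α + 1) ^ 2 with hM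
  have hMpos : 0 < M := by positivity
  refine ⟨1 + 2 * S / α, le_add_of_nonneg_right (by positivity), (c0 ^ 2 / 2)⁻¹ * M,
    by positivity, fun σ hσ τ hτ f hf => ?_⟩
  have hτ1 : 1 ≤ τ := (le_add_of_nonneg_right (by positivity)).trans hτ
  have hτS : 2 * S ≤ τ * α := by
    rw [← div_le_iff₀ hα]
    linarith
  set s := (α + 4 * (1 + α)) / 2 + σ with hs
  have hsS : |s| ≤ S := by
    rw [abs_le] at hσ ⊢
    constructor <;> linarith
  set U := Ω \ {0} with hU
  have hUo : IsOpen U := hΩ.sdiff isClosed_singleton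
  have hU0 : (0 : E3) ∉ U := fun h => h.2 rfl
  have hKU : tsupport f ⊆ U := fun x hx =>
    ⟨hBΩ (ball_subset_closedBall (hf.supp hx).1), (hf.supp hx).2⟩
  have haU : ∀ j k, Sm U (a j k) := fun j k => (ha j k).mono Set.sdiff_subset
  have hcl : IsClosed (tsupport f) := isClosed_tsupport f
  set w : E3 → ℝ := fun y => carlemanRoot α τ s y * carlemanRoot α τ s y with hw
  have hws : Sm U w := (sm_carlemanRoot hU0).mul (sm_carlemanRoot hU0)
  have hwe : ∀ x, x ≠ 0 → w x = carlemanWeight α τ (α + 4 * (1 + α)) σ x := fun x hx => by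
    rw [← carlemanRoot_sq (s := s) (by rw [hs]; ring) hx, sq]
  set F : Fin 3 → Fin 3 → Fin 3 → Fin 3 → E3 → ℝ := fun j k l m y =>
    w y * (a j k y * a l m y) * (pd k f y * pd l (pd m f) y) with hF
  set G : Fin 3 → Fin 3 → Fin 3 → Fin 3 → E3 → ℝ := fun j k l m y =>
    w y * (a j k y * a l m y) * (pd k f y * pd j (pd m f) y) with hG
  have hFs : ∀ j k l m, Sm U (F j k l m) := fun j k l m =>
    (hws.mul ((haU j k).mul (haU l m))).mul
      (((hf.sm U).pd hUo k).mul (((hf.sm U).pd hUo m).pd hUo l))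
  have hGs : ∀ j k l m, Sm U (G j k l m) := fun j k l m =>
    (hws.mul ((haU j k).mul (haU l m))).mul
      (((hf.sm U).pd hUo k).mul (((hf.sm U).pd hUo m).pd hUo j))
  have hd0 : ∀ k, ∀ x ∉ tsupport f, pd k f x = 0 := fun k =>
    pd_eq_zero_of_notMem hcl IsTest.eq_zero k
  have hF0 : ∀ j k l m, ∀ x ∉ tsupport f, F j k l m x = 0 := fun j k l m x hx => by
    simp [hF, hd0 k x hx]
  have hG0 : ∀ j k l m, ∀ x ∉ tsupport f, G j k l m x = 0 := fun j k l m x hx => by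
    simp [hG, hd0 k x hx]
  have hdiv : ∀ {g : E3 → ℝ}, Sm U g → (∀ x ∉ tsupport f, g x = 0) → ∀ i,
      Integrable (pd i g) ∧ ∫ x, pd i g x = 0 := fun hg h0 i =>
    ⟨integrable_of_continuousOn hf.isCompact ((hg.pd hUo i).continuousOn.mono hKU)
      (pd_eq_zero_of_notMem hcl h0 i), integral_pd_eq_zero hUo hg hf.isCompact hKU h0 i⟩
  obtain ⟨hID, hD⟩ := integral_sum_eq_zero fun j => integral_sum_eq_zero fun k =>
    integral_sum_eq_zero fun l => integral_sum_eq_zero fun m =>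
    (⟨(hdiv (hFs j k l m) (hF0 j k l m) j).1.sub (hdiv (hGs j k l m) (hG0 j k l m) l).1, by
      rw [← sub_zero (0 : ℝ)]
      nth_rewrite 1 [← (hdiv (hFs j k l m) (hF0 j k l m) j).2]
      rw [← (hdiv (hGs j k l m) (hG0 j k l m) l).2]
      exact integral_sub (hdiv (hFs j k l m) (hF0 j k l m) j).1
        (hdiv (hGs j k l m) (hG0 j k l m) l).1⟩ :
      Integrable (fun x => pd j (F j k l m) x - pd l (G j k l m) x) ∧
        ∫ x, (pd j (F j k l m) x - pd l (G j k l m) x) = 0)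
  have hpt : ∀ x, c0 ^ 2 / 2 * (carlemanWeight α τ (α + 4 * (1 + α)) σ x * derivEnergy 2 f x)
      ≤ carlemanWeight α τ (α + 4 * (1 + α)) σ x * derivEnergy 0 (op2 a f) x
        + 4374 * K ^ 4 / c0 ^ 2 * ((4 * α + 1) ^ 2 * (τ ^ 2
          * (carlemanWeight α τ (α + 2 * (1 + α)) σ x * derivEnergy 1 f x)))
        - ∑ j, ∑ k, ∑ l, ∑ m, (pd j (F j k l m) x - pd l (G j k l m) x) := by
    intro x
    by_cases hx : x ∈ tsupport f
    swap
    · have e1 := fun j => derivEnergy_eq_zero hcl j (IsTest.eq_zero (f := f)) x hx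
      have e2 := derivEnergy_eq_zero hcl 0 (op2_eq_zero (a := a) hcl (IsTest.eq_zero (f := f))) x hx
      have e3 := fun j k l m => pd_eq_zero_of_notMem hcl (hF0 j k l m) j x hx
      have e4 := fun j k l m => pd_eq_zero_of_notMem hcl (hG0 j k l m) l x hx
      simp [e1, e2, e3, e4]
    have hxU := hKU hx
    have hxn : x ≠ 0 := hxU.2
    have hxb := ball_subset_closedBall (hf.supp hx).1
    have hx1 := hB1 x hxb
    have hr : 0 < ‖x‖ := norm_pos_iff.2 hxn
    obtain ⟨-, s2, s3⟩ := carlemanSlope_bounds hα hsS hτS hxn hx1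
    have hw0 : 0 ≤ w x := mul_self_nonneg _
    have ht1 : 1 ≤ ‖x‖ ^ (-α - 1) :=
      Real.one_le_rpow_of_pos_of_le_one_of_nonpos hr hx1 (by linarith)
    have hdw : ∀ i, |pd i w x| ≤ (4 * α + 1) * (τ * ‖x‖ ^ (-α - 1)) * w x := fun i => by
      have hg := hasGrad_carlemanRoot (α := α) (τ := τ) (s := s) hxn
      rw [(hg.mul hg).eq i]
      have e : ‖x‖ ^ (-α - 2) * ‖x‖ = ‖x‖ ^ (-α - 1) := by
        rw [← Real.rpow_add_one hr.ne']; congr 1; ring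
      have hm0 : 0 ≤ carlemanSlope α τ s x := le_trans (by positivity) s2
      have hmx : |carlemanSlope α τ s x * x i| ≤ 2 * (τ * α * ‖x‖ ^ (-α - 2)) * ‖x‖ := by
        rw [abs_mul, abs_of_nonneg hm0]
        exact mul_le_mul s3 (abs_coord_le x i) (abs_nonneg _) (hm0.trans s3)
      calc _ = |-(2 * (carlemanSlope α τ s x * x i) * w x)| := by
            rw [hw]; congr 1; ring
        _ = 2 * |carlemanSlope α τ s x * x i| * w x := by
            rw [abs_neg, abs_mul, abs_mul, abs_of_nonneg hw0, abs_two]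
        _ ≤ 2 * (2 * (τ * α * ‖x‖ ^ (-α - 2)) * ‖x‖) * w x := by gcongr
        _ = 4 * α * (τ * ‖x‖ ^ (-α - 1)) * w x := by rw [← e]; ring
        _ ≤ _ := by gcongr; linarith
    have hL : 1 ≤ (4 * α + 1) * (τ * ‖x‖ ^ (-α - 1)) :=
      one_le_mul_of_one_le_of_one_le (by linarith) (one_le_mul_of_one_le_of_one_le hτ1 ht1)
    have h := second_order_pointwise hUo hxU hsym haU (hf.sm U) hws hw0 hc0
      (hell x (hBΩ hxb)) hL hdw (hK x hxb).coef (hK x hxb).dcoef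
    have e5 : (‖x‖ ^ (-α - 1)) ^ 2 * w x = carlemanWeight α τ (α + 2 * (1 + α)) σ x := by
      rw [hwe x hxn, ← Real.rpow_natCast, ← Real.rpow_mul hr.le]
      exact carlemanWeight_mul_rpow (by push_cast; ring) hxn
    have e6 : derivEnergy 2 f x = ∑ l, ∑ m, pd l (pd m f) x ^ 2 := by
      rw [Finset.sum_comm]; rfl
    have hA : derivEnergy 0 (op2 a f) x = op2 a f x ^ 2 := rfl
    have hf1 : derivEnergy 1 f x = ∑ k, pd k f x ^ 2 := rfl
    rw [← e5, ← hwe x hxn, e6, hA, hf1]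
    refine h.trans (le_of_eq ?_)
    congr 2
    ring
  have hwc : ∀ e, ContinuousOn (carlemanWeight α τ e σ) (tsupport f) := fun e =>
    continuousOn_carlemanWeight α τ e σ hf.zero_notMem
  have hI : ∀ e j, Integrable fun x => carlemanWeight α τ e σ x * derivEnergy j f x := fun e j =>
    integrable_weight_mul hf (hwc e) ((continuousOn_derivEnergy hUo j (hf.sm U)).mono hKU)
      (derivEnergy_eq_zero hcl j IsTest.eq_zero)
  have hIA : Integrable fun x => carlemanWeight α τ (α + 4 * (1 + α)) σ x
      * derivEnergy 0 (op2 a f) x :=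
    integrable_weight_mul hf (hwc _)
      ((continuousOn_derivEnergy hUo 0 (sm_op2 hUo haU (hf.sm U))).mono hKU)
      (derivEnergy_eq_zero hcl 0 (op2_eq_zero hcl IsTest.eq_zero))
  have hI1 := (((hI (α + 2 * (1 + α)) 1).const_mul (τ ^ 2)).const_mul
    ((4 * α + 1) ^ 2)).const_mul (4374 * K ^ 4 / c0 ^ 2)
  have hIS : Integrable fun x => carlemanWeight α τ (α + 4 * (1 + α)) σ x
      * derivEnergy 0 (op2 a f) x + 4374 * K ^ 4 / c0 ^ 2 * ((4 * α + 1) ^ 2 * (τ ^ 2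
        * (carlemanWeight α τ (α + 2 * (1 + α)) σ x * derivEnergy 1 f x))) := hIA.add hI1
  have hmono := integral_mono ((hI _ 2).const_mul _) (hIS.sub hID) hpt
  simp only [Pi.sub_apply] at hmono
  rw [integral_const_mul, integral_sub hIS hID, hD, sub_zero, integral_add hIA hI1,
    integral_const_mul, integral_const_mul, integral_const_mul] at hmono
  have p0 : 0 ≤ ∫ x, carlemanWeight α τ (α + 4 * (1 + α)) σ x * derivEnergy 0 (op2 a f) x :=
    integral_nonneg fun x => mul_nonneg (carlemanWeight_nonneg _ _ _ _ _) (derivEnergy_nonneg _ _ _)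
  have p1 : 0 ≤ ∫ x, carlemanWeight α τ (α + 2 * (1 + α)) σ x * derivEnergy 1 f x :=
    integral_nonneg fun x => mul_nonneg (carlemanWeight_nonneg _ _ _ _ _) (derivEnergy_nonneg _ _ _)
  rw [mul_assoc, ← div_eq_inv_mul, le_div_iff₀' (by positivity)]
  refine hmono.trans ?_
  rw [hM]
  have q0 : 0 ≤ 4374 * K ^ 4 / c0 ^ 2 * (4 * α + 1) ^ 2
    * ∫ x, carlemanWeight α τ (α + 4 * (1 + α)) σ x * derivEnergy 0 (op2 a f) x := by positivity
  have q1 : 0 ≤ τ ^ 2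
    * ∫ x, carlemanWeight α τ (α + 2 * (1 + α)) σ x * derivEnergy 1 f x := by positivity
  linarith

/-- The Carleman estimate for scalar test functions, without additional derivatives. -/
lemma carlemanHolds_zero (hΩ : IsOpen Ω) (h0 : (0 : E3) ∈ Ω) (ha : ∀ j k, Sm Ω (a j k))
    (hsym : ∀ j k y, a j k y = a k j y) (hα : 0 < α) (hell : UnifElliptic a Ω)
    (heig : EigCond a α) : CarlemanHolds a α 0 := by
  have hherm : (coefMatrix a 0).IsHermitian := by
    ext j k
    simpa [coefMatrix] using hsym k j 0
  obtain ⟨c0, hc0, hell0⟩ := id hell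
  obtain ⟨γ, c, hc, H⟩ := spectral_inequality hherm hc0 (fun ξ => (hell0 0 h0 ξ).trans_eq <| by
    simp only [Finset.mul_sum]
    exact Finset.sum_congr rfl fun i _ => Finset.sum_congr rfl fun k _ => by
      simp only [coefMatrix, Matrix.of_apply]; ring) (heig hherm)
  obtain ⟨r0, hr0, hr01, hBΩ, h1⟩ := first_order_estimate hΩ h0 ha hsym hα hc H
  intro ν hν
  obtain ⟨τ1, hτ1, C1, hC1, h1⟩ := h1 ν hν
  obtain ⟨τ2, hτ2, C2, hC2, h2⟩ := second_order_estimate hΩ ha hsym hα hell hr01 hBΩ ν hν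
  refine ⟨max τ1 τ2, hτ1.le.trans (le_max_left _ _), r0, hr0, hr01, C1 + C2 * (1 + C1),
    by positivity, fun σ hσ τ hτ f hf => ?_⟩
  have g1 := h1 σ hσ τ ((le_max_left _ _).trans hτ) f hf
  have g2 := h2 σ hσ τ ((le_max_right _ _).trans hτ) f hf
  have hτ1' : 1 ≤ τ := hτ1.le.trans ((le_max_left _ _).trans hτ)
  have hτpos : 0 < τ := one_pos.trans_le hτ1'
  set U := Ω \ {0} with hU
  have hUo : IsOpen U := hΩ.sdiff isClosed_singleton
  have hKU : tsupport f ⊆ U := fun x hx =>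
    ⟨hBΩ (ball_subset_closedBall (hf.supp hx).1), (hf.supp hx).2⟩
  have haU : ∀ j k, Sm U (a j k) := fun j k => (ha j k).mono Set.sdiff_subset
  have hcl : IsClosed (tsupport f) := isClosed_tsupport f
  have hIA : ∀ e, Integrable fun x => carlemanWeight α τ e σ x
      * derivEnergy 0 (op2 a f) x := fun e =>
    integrable_weight_mul hf (continuousOn_carlemanWeight α τ e σ hf.zero_notMem)
      ((continuousOn_derivEnergy hUo 0 (sm_op2 hUo haU (hf.sm U))).mono hKU)
      (derivEnergy_eq_zero hcl 0 (op2_eq_zero hcl IsTest.eq_zero))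
  have hAA : (∫ x, carlemanWeight α τ (α + 4 * (1 + α)) σ x * derivEnergy 0 (op2 a f) x)
      ≤ ∫ x, carlemanWeight α τ (4 * (1 + α)) σ x * derivEnergy 0 (op2 a f) x := by
    refine integral_mono (hIA _) (hIA _) fun x => ?_
    by_cases hx : x ∈ tsupport f
    · refine mul_le_mul_of_nonneg_right ?_ (derivEnergy_nonneg _ _ _)
      exact carlemanWeight_anti α τ _ _ σ (by linarith) (hKU hx).2
        ((mem_ball_zero_iff.1 (hf.supp hx).1).le.trans hr01)
    · simp [derivEnergy_eq_zero hcl 0 (op2_eq_zero (a := a) hcl (IsTest.eq_zero (f := f))) x hx]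
  have hnn : ∀ e j (g : E3 → ℝ), 0 ≤ ∫ x, carlemanWeight α τ e σ x * derivEnergy j g x :=
    fun e j g => integral_nonneg fun x =>
      mul_nonneg (carlemanWeight_nonneg _ _ _ _ _) (derivEnergy_nonneg _ _ _)
  have x0 : α + 2 * ((0 : ℕ) : ℝ) * (1 + α) = α := by norm_num
  have x1 : α + 2 * ((1 : ℕ) : ℝ) * (1 + α) = α + 2 * (1 + α) := by norm_num
  have x2 : α + 2 * ((2 : ℕ) : ℝ) * (1 + α) = α + 4 * (1 + α) := by norm_num
  have x3 : 2 * (2 + ((0 : ℕ) : ℝ)) * (1 + α) = 4 * (1 + α) := by norm_num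
  have y0 : τ ^ ((3 : ℤ) - 2 * ((0 : ℕ) : ℤ)) = τ ^ 3 := by norm_cast
  have y1 : τ ^ ((3 : ℤ) - 2 * ((1 : ℕ) : ℤ)) = τ := by norm_num
  have y2 : τ ^ ((3 : ℤ) - 2 * ((2 : ℕ) : ℤ)) = τ⁻¹ := by norm_num
  have y3 : τ ^ (-(2 : ℤ) * ((0 : ℕ) : ℤ)) = 1 := by norm_num
  rw [Finset.sum_range_succ, Finset.sum_range_succ, Finset.sum_range_succ, Finset.sum_range_zero,
    Finset.sum_range_succ, Finset.sum_range_zero, x0, x1, x2, x3, y0, y1, y2, y3]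
  set I0 := ∫ x, carlemanWeight α τ α σ x * derivEnergy 0 f x
  set I1 := ∫ x, carlemanWeight α τ (α + 2 * (1 + α)) σ x * derivEnergy 1 f x
  set I2 := ∫ x, carlemanWeight α τ (α + 4 * (1 + α)) σ x * derivEnergy 2 f x
  set B := ∫ x, carlemanWeight α τ (4 * (1 + α)) σ x * derivEnergy 0 (op2 a f) x
  set B' := ∫ x, carlemanWeight α τ (α + 4 * (1 + α)) σ x * derivEnergy 0 (op2 a f) x
  have hI0 : 0 ≤ τ ^ 3 * I0 := mul_nonneg (by positivity) (hnn _ _ _)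
  have hB' : 0 ≤ B' := hnn _ _ _
  have hτi : τ⁻¹ ≤ 1 := inv_le_one_of_one_le₀ hτ1'
  have g3 : τ⁻¹ * I2 ≤ C2 * (B + C1 * B) := by
    calc τ⁻¹ * I2 ≤ τ⁻¹ * (C2 * (B' + τ ^ 2 * I1)) := by gcongr
      _ = C2 * (τ⁻¹ * B' + τ * I1) := by field_simp
      _ ≤ C2 * (1 * B' + C1 * B) := mul_le_mul_of_nonneg_left
        (add_le_add (by gcongr) (by linarith)) hC2.le
      _ ≤ C2 * (B + C1 * B) := by rw [one_mul]; gcongr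
  linarith

end Assembly

/-- **Iterated Carleman estimate for a strongly elliptic second-order operator**
(Corollary 4.3).  For `A = Σ a_jk(x)∂²_{jk}` strongly elliptic with `G^s`
coefficients, `α > (λ₃-λ₁)/λ₁` at `0` and `s < 1 + 1/α`: for every `ν > 0` there
are `τ₀, r₀, C > 0` such that for all `k ≤ ν`, `|σ| ≤ ν`, `τ ≥ τ₀` and smooth `V`
compactly supported in `B(0,r₀) \ {0}`:
`Σ_{j=0}^{k+2} τ^{3-2j} ∫ |x|^{α+2j(1+α)} |x|^{2σ} e^{2τ|x|^{-α}} |D^j V|²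
  ≤ C Σ_{j=0}^{k} τ^{-2j} ∫ |x|^{2(2+j)(1+α)} |x|^{2σ} e^{2τ|x|^{-α}} |D^j(AV)|²`. -/
theorem carleman_iterated
    (Ω : Set E3) (hΩopen : IsOpen Ω) (h0Ω : (0 : E3) ∈ Ω)
    (s α : ℝ) (hs : 1 ≤ s) (hα : 0 < α) (hsα : s < 1 + 1 / α)
    (a : Fin 3 → Fin 3 → E3 → ℝ)
    (hsym : ∀ j k : Fin 3, ∀ x : E3, a j k x = a k j x)
    (hG : ∀ j k : Fin 3, GevreyOn s Ω (a j k))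
    (hell : UnifElliptic a Ω)
    (heig : EigCond a α) :
    ∀ ν : ℝ, 0 < ν → ∃ τ0 > (0 : ℝ), ∃ r0 > (0 : ℝ), ∃ C > (0 : ℝ),
      ∀ k : ℕ, (k : ℝ) ≤ ν → ∀ σ : ℝ, |σ| ≤ ν → ∀ τ : ℝ, τ ≥ τ0 →
        ∀ V : E3 → E7, ContDiff ℝ (⊤ : ℕ∞) V → tsupport V ⊆ ball (0 : E3) r0 \ {0} →
          (∑ j ∈ Finset.range (k + 3), τ ^ ((3 : ℤ) - 2 * j)
              * ∫ x : E3, ‖x‖ ^ (α + 2 * (j : ℝ) * (1 + α)) * ‖x‖ ^ (2 * σ)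
                  * Real.exp (2 * τ * ‖x‖ ^ (-α)) * ‖iteratedFDeriv ℝ j V x‖ ^ 2)
          ≤ C * ∑ j ∈ Finset.range (k + 1), τ ^ (-(2 : ℤ) * j)
              * ∫ x : E3, ‖x‖ ^ (2 * (2 + (j : ℝ)) * (1 + α)) * ‖x‖ ^ (2 * σ)
                  * Real.exp (2 * τ * ‖x‖ ^ (-α)) * ‖iteratedFDeriv ℝ j (op2V a V) x‖ ^ 2 := by
  exact carleman_vector_of_scalar hΩopen h0Ω (fun j k => (hG j k).1) hα
    (carlemanHolds_zero hΩopen h0Ω (fun j k => (hG j k).1) hsym hα hell heig)
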